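/- Let N ≥ 3, 2* = 2N/(N−2), and let (u_k)_{k∈ℕ} be a sequence in C_c^∞(ℝ^N) with sup_k ∫_{ℝ^N}(|∇u_k|² + u_k²) dx < ∞ and with ∫_{ℝ^N} |u_k|^p dx → 0 for some p ∈ (2, 2*). Then there exist a subsequence of (u_k) (still denoted (u_k)), sequences of points (y_k^{(n)})_{k∈ℕ} in ℝ^N and of integers (j_k^{(n)})_{k∈ℕ} in ℕ with j_k^{(n)} → ∞ (n ∈ ℕ), and functions w^{(n)} ∈ L^{2*}(ℝ^N) with weak gradients ∇w^{(n)} ∈ L²(ℝ^N; ℝ^N), such that: (a) for each n, 2^{−j_k^{(n)}(N−2)/2} u_k(y_k^{(n)} + 2^{−j_k^{(n)}} ξ) → w^{(n)}(ξ) for almost every ξ ∈ ℝ^N; (b) for all n ≠ n' the pairs (j_k^{(n)}, y_k^{(n)}) and (j_k^{(n')}, y_k^{(n')}) are asymptotically decoupled; (c) with W_k^{(n)}(x) = 2^{j_k^{(n)}(N−2)/2} χ(x − y_k^{(n)}) w^{(n)}(2^{j_k^{(n)}}(x − y_k^{(n)})), for every ε > 0 there exist ν ∈ ℕ and K ∈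 ℕ such that for all k ≥ K, (∫_{ℝ^N} |u_k − Σ_{n=1}^{ν} W_k^{(n)}|^{2*} dx)^{1/2*} < ε; (d) Σ_{n∈ℕ} ∫_{ℝ^N} |∇w^{(n)}|² dx ≤ liminf_k ∫_{ℝ^N} |∇u_k|² dx. -/

import Mathlib

open MeasureTheory Filter Topology
open scoped RealInnerProductSpace

noncomputable section

/-- A locally integrable function `w` on ℝ^N has weak gradient `g`. -/
def HasWeakGradient {N : ℕ} (w : EuclideanSpace ℝ (Fin N) → ℝ)
    (g : EuclideanSpace ℝ (Fin N) → EuclideanSpace ℝ (Fin N)) : Prop :=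
  ∀ φ : EuclideanSpace ℝ (Fin N) → ℝ, ContDiff ℝ (⊤ : ℕ∞) φ → HasCompactSupport φ →
    ∀ i : Fin N, (∫ x, w x * fderiv ℝ φ x (EuclideanSpace.single i 1)) = -∫ x, g x i * φ x

section AbstractDecomposition

variable {H : Type*} [NormedAddCommGroup H] [InnerProductSpace ℝ H]

/-- Weak convergence in a Hilbert space along a filter. -/
def WeakTendsto {ι : Type*} (l : Filter ι) (v : ι → H) (w : H) : Prop :=
  ∀ h, Tendsto (fun k => ⟪h, v k⟫) l (𝓝 ⟪h, w⟫)

theorem WeakTendsto.unique {ι : Type*} {l : Filter ι} [l.NeBot] {v : ι → H} {w w' : H}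
    (h : WeakTendsto l v w) (h' : WeakTendsto l v w') : w = w' :=
  ext_inner_left ℝ fun z => tendsto_nhds_unique (h z) (h' z)

theorem WeakTendsto.sub {ι : Type*} {l : Filter ι} {v v' : ι → H} {w w' : H}
    (h : WeakTendsto l v w) (h' : WeakTendsto l v' w') :
    WeakTendsto l (fun k => v k - v' k) (w - w') := fun z => by
  simpa only [inner_sub_right] using (h z).sub (h' z)

theorem WeakTendsto.sum {ι κ : Type*} {l : Filter ι} {s : Finset κ} {v : κ → ι → H} {w : κ → H}
    (h : ∀ i ∈ s, WeakTendsto l (v i) (w i)) :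
    WeakTendsto l (fun k => ∑ i ∈ s, v i k) (∑ i ∈ s, w i) := fun z => by
  simpa only [inner_sum] using tendsto_finsetSum s fun i hi => h i hi z

theorem exists_weakTendsto_of_bounded [CompleteSpace H] {ι : Type*} (l : Ultrafilter ι) {v : ι → H}
    {C : ℝ} (hv : ∀ k, ‖v k‖ ≤ C) : ∃ w, WeakTendsto l v w := by
  let f : ι → WeakDual ℝ H := fun k => StrongDual.toWeakDual (InnerProductSpace.toDual ℝ H (v k))
  have hc := WeakDual.isCompact_closedBall (𝕜 := ℝ) (0 : StrongDual ℝ H) C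
  obtain ⟨x, -, hx⟩ := hc.ultrafilter_le_nhds (l.map f) (by
    rw [le_principal_iff, Ultrafilter.coe_map, mem_map]
    refine univ_mem' fun k => ?_
    simp only [Set.mem_preimage, Metric.mem_closedBall, dist_zero_right]
    change ‖InnerProductSpace.toDual ℝ H (v k)‖ ≤ C
    simpa using hv k)
  have hx' : Tendsto f l (𝓝 x) := hx
  refine ⟨(InnerProductSpace.toDual ℝ H).symm (WeakDual.toStrongDual x), fun h => ?_⟩
  have h1 := ((WeakDual.eval_continuous h).tendsto x).comp hx'
  have h2 : ⟪h, (InnerProductSpace.toDual ℝ H).symm (WeakDual.toStrongDual x)⟫ = x h := by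
    rw [real_inner_comm, InnerProductSpace.toDual_symm_apply]; rfl
  rw [h2]
  refine h1.congr fun k => ?_
  change InnerProductSpace.toDual ℝ H (v k) h = _
  rw [InnerProductSpace.toDual_apply_apply, real_inner_comm]

theorem tendsto_inner_of_tendsto_of_weakTendsto {ι : Type*} {l : Filter ι} {v z : ι → H} {w x : H}
    {C : ℝ} (hv : ∀ k, ‖v k‖ ≤ C) (h : WeakTendsto l v w) (hz : Tendsto z l (𝓝 x)) :
    Tendsto (fun k => ⟪z k, v k⟫) l (𝓝 ⟪x, w⟫) := by
  have h1 : Tendsto (fun k => ⟪z k - x, v k⟫) l (𝓝 0) := by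
    have h2 : Tendsto (fun k => ‖z k - x‖ * C) l (𝓝 0) := by
      simpa using (tendsto_iff_norm_sub_tendsto_zero.1 hz).mul_const C
    refine squeeze_zero_norm (fun k => ?_) h2
    exact (norm_inner_le_norm _ _).trans (mul_le_mul_of_nonneg_left (hv k) (norm_nonneg _))
  simpa [inner_sub_left] using h1.add (h x)

variable {D : Type*} (T : D → H ≃ₗᵢ[ℝ] H)

theorem weakTendsto_symm_of_tendsto {ι : Type*} {l : Filter ι} {d d' : ι → D} {U : ι → H} {w : H}
    {C : ℝ} (hU : ∀ k, ‖U k‖ ≤ C) (Q : H ≃ₗᵢ[ℝ] H)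
    (hQ : ∀ h, Tendsto (fun k => (T (d' k)).symm (T (d k) h)) l (𝓝 (Q h)))
    (hw : WeakTendsto l (fun k => (T (d k)).symm (U k)) w) :
    WeakTendsto l (fun k => (T (d' k)).symm (U k)) (Q w) := by
  intro h
  have h1 : Tendsto (fun k => (T (d k)).symm (T (d' k) h)) l (𝓝 (Q.symm h)) := by
    rw [tendsto_iff_norm_sub_tendsto_zero]
    have h2 := tendsto_iff_norm_sub_tendsto_zero.1 (hQ (Q.symm h))
    refine h2.congr fun k => ?_
    calc ‖(T (d' k)).symm (T (d k) (Q.symm h)) - Q (Q.symm h)‖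
        = ‖T (d' k) ((T (d' k)).symm (T (d k) (Q.symm h)) - h)‖ := by
          rw [LinearIsometryEquiv.norm_map, Q.apply_symm_apply]
      _ = ‖(T (d k)).symm (T (d k) (Q.symm h) - T (d' k) h)‖ := by
        rw [LinearIsometryEquiv.norm_map (T (d k)).symm, map_sub]; simp
      _ = ‖(T (d k)).symm (T (d' k) h) - Q.symm h‖ := by rw [map_sub, norm_sub_rev]; simp
  have h3 := tendsto_inner_of_tendsto_of_weakTendsto (v := fun k => (T (d k)).symm (U k))
    (C := C) (fun k => by simpa using hU k) hw h1
  have h4 : ⟪Q.symm h, w⟫ = ⟪h, Q w⟫ := by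
    rw [← Q.inner_map_map]; simp
  rw [h4] at h3
  refine h3.congr fun k => ?_
  rw [(T (d k)).symm.inner_map_map, ← (T (d' k)).inner_map_map h]
  simp

theorem tendsto_sq_norm_sub_sum {ι κ : Type*} {l : Filter ι} {U : ι → H} {L : ℝ}
    (hL : Tendsto (fun k => ‖U k‖ ^ 2) l (𝓝 L)) (s : Finset κ) (d : κ → ι → D) (w : κ → H)
    (hw : ∀ i ∈ s, WeakTendsto l (fun k => (T (d i k)).symm (U k)) (w i))
    (hd : ∀ i ∈ s, ∀ j ∈ s, i ≠ j → ∀ h h', Tendsto (fun k => ⟪T (d i k) h, T (d j k) h'⟫) l (𝓝 0)) :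
    Tendsto (fun k => ‖U k - ∑ i ∈ s, T (d i k) (w i)‖ ^ 2) l (𝓝 (L - ∑ i ∈ s, ‖w i‖ ^ 2)) := by
  classical
  have key : Tendsto (fun k => ‖U k‖ ^ 2 - 2 * ∑ i ∈ s, ⟪U k, T (d i k) (w i)⟫ +
      ∑ i ∈ s, ∑ j ∈ s, ⟪T (d i k) (w i), T (d j k) (w j)⟫) l
      (𝓝 (L - 2 * ∑ i ∈ s, ‖w i‖ ^ 2 + ∑ i ∈ s, ∑ j ∈ s, if i = j then ‖w i‖ ^ 2 else 0)) := by
    refine (hL.sub ((tendsto_finsetSum s fun i hi => ?_).const_mul 2)).add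
      (tendsto_finsetSum s fun i hi => tendsto_finsetSum s fun j hj => ?_)
    · have h1 := hw i hi (w i)
      rw [real_inner_self_eq_norm_sq] at h1
      refine h1.congr fun k => ?_
      rw [real_inner_comm, ← (T (d i k)).inner_map_map]; simp
    · by_cases hij : i = j
      · subst hij
        simpa using tendsto_const_nhds
      · simpa [hij] using hd i hi j hj hij (w i) (w j)
  have h1 : ∑ i ∈ s, ∑ j ∈ s, (if i = j then ‖w i‖ ^ 2 else 0) = ∑ i ∈ s, ‖w i‖ ^ 2 :=
    Finset.sum_congr rfl fun i hi => by simp [hi]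
  rw [h1, show L - 2 * ∑ i ∈ s, ‖w i‖ ^ 2 + ∑ i ∈ s, ‖w i‖ ^ 2 = L - ∑ i ∈ s, ‖w i‖ ^ 2 by ring]
    at key
  refine key.congr fun k => ?_
  rw [norm_sub_sq_real, inner_sum, ← real_inner_self_eq_norm_sq (∑ i ∈ s, T (d i k) (w i)),
    sum_inner]
  simp only [inner_sum]

theorem sum_sq_norm_weakTendsto_le {ι κ : Type*} {l : Filter ι} [l.NeBot] {U : ι → H} {L : ℝ}
    (hL : Tendsto (fun k => ‖U k‖ ^ 2) l (𝓝 L)) (s : Finset κ) (d : κ → ι → D) (w : κ → H)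
    (hw : ∀ i ∈ s, WeakTendsto l (fun k => (T (d i k)).symm (U k)) (w i))
    (hd : ∀ i ∈ s, ∀ j ∈ s, i ≠ j → ∀ h h', Tendsto (fun k => ⟪T (d i k) h, T (d j k) h'⟫) l (𝓝 0)) :
    ∑ i ∈ s, ‖w i‖ ^ 2 ≤ L :=
  sub_nonneg.1 (ge_of_tendsto' (tendsto_sq_norm_sub_sum T hL s d w hw hd) fun _ => by positivity)

/-- Profile decomposition of a bounded sequence in a Hilbert space modulo a family of isometries,
along an ultrafilter. -/
theorem exists_profiles [CompleteSpace H] (l : Ultrafilter ℕ) (dec : (ℕ → D) → (ℕ → D) → Prop)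
    (hsymm : ∀ d d', dec d d' → dec d' d) (hirr : ∀ d, ¬ dec d d)
    (hdec : ∀ d d', dec d d' → ∀ h h', Tendsto (fun k => ⟪T (d k) h, T (d' k) h'⟫) l (𝓝 0))
    (hndec : ∀ d d', ¬ dec d d' → ∃ Q : H ≃ₗᵢ[ℝ] H, ∀ h,
      Tendsto (fun k => (T (d' k)).symm (T (d k) h)) l (𝓝 (Q h)))
    (pad : ℕ → ℕ → D) (hpad : ∀ m n, m ≠ n → dec (pad m) (pad n))
    (U : ℕ → H) {C : ℝ} (hU : ∀ k, ‖U k‖ ≤ C) {L : ℝ}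
    (hL : Tendsto (fun k => ‖U k‖ ^ 2) l (𝓝 L)) :
    ∃ (e : ℕ → ℕ → D) (w : ℕ → H),
      (∀ n, WeakTendsto l (fun k => (T (e n k)).symm (U k)) (w n)) ∧
      (∀ m n, m ≠ n → dec (e m) (e n)) ∧
      (∀ n, w n ≠ 0 ∨ e n ∈ Set.range pad) ∧
      Summable (fun n => ‖w n‖ ^ 2) ∧ ∑' n, ‖w n‖ ^ 2 ≤ L ∧
      ∀ (φ : H) (ε : ℝ), 0 < ε → ∃ ν₀ : ℕ, ∀ ν ≥ ν₀, ∀ᶠ k in (l : Filter ℕ), ∀ d : D,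
        |⟪φ, (T d).symm (U k - ∑ n ∈ Finset.range ν, T (e n k) (w n))⟫| ≤ ε := by
  classical
  have hex : ∀ d : ℕ → D, ∃ w, WeakTendsto l (fun k => (T (d k)).symm (U k)) w := fun d =>
    exists_weakTendsto_of_bounded l (C := C) fun k => by simpa using hU k
  choose W hW using hex
  let S : Set (Set (ℕ → D)) := {F | F.Pairwise dec ∧ ∀ d ∈ F, W d ≠ 0 ∨ d ∈ Set.range pad}
  have hpadS : Set.range pad ∈ S := by
    refine ⟨?_, fun d hd => Or.inr hd⟩
    rintro _ ⟨m, rfl⟩ _ ⟨n, rfl⟩ hmn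
    exact hpad m n fun h => hmn (by rw [h])
  obtain ⟨F, hpF, hF⟩ := zorn_subset_nonempty S (by
    intro c hc hchain _
    refine ⟨⋃₀ c, ⟨?_, ?_⟩, fun s hs => Set.subset_sUnion_of_mem hs⟩
    · exact (Set.pairwise_sUnion hchain.directedOn).2 fun s hs => (hc hs).1
    · rintro d ⟨s, hs, hd⟩
      exact (hc hs).2 d hd) _ hpadS
  have hFS : F ∈ S := hF.prop
  have hbessel : ∀ s : Finset F, ∑ i ∈ s, ‖W i‖ ^ 2 ≤ L := fun s =>
    sum_sq_norm_weakTendsto_le T hL s (fun i => (i : ℕ → D)) (fun i => W i) (fun i _ => hW i)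
      fun i _ j _ hij => hdec _ _ (hFS.1 i.2 j.2 fun h => hij (Subtype.ext h))
  have hsum : Summable fun i : F => ‖W i‖ ^ 2 :=
    summable_of_sum_le (fun i => by positivity) hbessel
  have hcount : F.Countable := by
    have h1 : (Subtype.val '' (Function.support fun i : F => ‖W i‖ ^ 2)).Countable :=
      hsum.countable_support.image _
    refine (h1.union (Set.countable_range pad)).mono fun d hd => ?_
    rcases hFS.2 d hd with h | h
    · exact Or.inl ⟨⟨d, hd⟩, by simpa using h, rfl⟩
    · exact Or.inr h
  have hinf : Infinite F := by
    refine Infinite.of_injective (fun m : ℕ => (⟨pad m, hpF ⟨m, rfl⟩⟩ : F)) fun m n hmn => ?_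
    by_contra hne
    have h1 := hpad m n hne
    have h2 : pad m = pad n := congrArg Subtype.val hmn
    rw [h2] at h1
    exact hirr _ h1
  have : Countable F := hcount.to_subtype
  obtain ⟨hden⟩ := nonempty_denumerable F
  let E : ℕ ≃ F := (Denumerable.eqv F).symm
  have hdecE : ∀ m n, m ≠ n → dec (E m) (E n) := fun m n hmn =>
    hFS.1 (E m).2 (E n).2 fun h => hmn (E.injective (Subtype.ext h))
  have hsumE : Summable fun n : ℕ => ‖W (E n)‖ ^ 2 := (E.summable_iff (f := fun i : F => ‖W i‖ ^ 2)).2 hsum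
  have hmax : ∀ d, W d ≠ 0 → ∃ n, ¬ dec (E n) d := by
    intro d hd
    by_contra! hcon
    have hins : insert d F ∈ S := by
      refine ⟨?_, ?_⟩
      · rw [Set.pairwise_insert]
        refine ⟨hFS.1, fun b hb _ => ?_⟩
        have := hcon (E.symm ⟨b, hb⟩)
        simp only [Equiv.apply_symm_apply] at this
        exact ⟨hsymm _ _ this, this⟩
      · rintro b (rfl | hb)
        · exact Or.inl hd
        · exact hFS.2 b hb
    have hdF : d ∈ F := hF.le_of_ge hins (Set.subset_insert d F) (Set.mem_insert d F)
    have := hcon (E.symm ⟨d, hdF⟩)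
    simp only [Equiv.apply_symm_apply] at this
    exact hirr _ this
  refine ⟨fun n => E n, fun n => W (E n), fun n => hW _, hdecE, fun n => hFS.2 _ (E n).2, hsumE,
    hsumE.tsum_le_of_sum_le fun s => ?_, fun φ ε hε => ?_⟩
  · have := hbessel (s.map E.toEmbedding)
    simpa using this
  have hsmall : ∀ᶠ n in atTop, ‖φ‖ * ‖W (E n)‖ < ε := by
    have h1 : Tendsto (fun n => ‖W (E n)‖) atTop (𝓝 0) := by
      have := hsumE.tendsto_atTop_zero.sqrt
      simpa [Real.sqrt_sq (norm_nonneg _)] using this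
    have h2 : Tendsto (fun n => ‖φ‖ * ‖W (E n)‖) atTop (𝓝 0) := by simpa using h1.const_mul ‖φ‖
    exact h2.eventually_lt_const hε
  obtain ⟨ν₀, hν₀⟩ := eventually_atTop.1 hsmall
  refine ⟨ν₀, fun ν hν => ?_⟩
  by_contra hcon
  rw [← Ultrafilter.eventually_not] at hcon
  set R : ℕ → H := fun k => U k - ∑ n ∈ Finset.range ν, T ((E n : ℕ → D) k) (W (E n)) with hR
  have hcon' : ∀ᶠ k in (l : Filter ℕ), ∃ d : D, ε < |⟪φ, (T d).symm (R k)⟫| := by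
    filter_upwards [hcon] with k hk
    push Not at hk
    exact hk
  have : Nonempty D := ⟨pad 0 0⟩
  have hch : ∀ k, ∃ d : D, (∃ d : D, ε < |⟪φ, (T d).symm (R k)⟫|) → ε < |⟪φ, (T d).symm (R k)⟫| := by
    intro k
    by_cases h : ∃ d : D, ε < |⟪φ, (T d).symm (R k)⟫|
    · obtain ⟨d, hd⟩ := h
      exact ⟨d, fun _ => hd⟩
    · exact ⟨Classical.arbitrary D, fun h' => absurd h' h⟩
  choose d hd using hch
  have hRb : ∀ k, ‖R k‖ ≤ C + ∑ n ∈ Finset.range ν, ‖W (E n)‖ := fun k =>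
    (norm_sub_le _ _).trans (add_le_add (hU k) ((norm_sum_le _ _).trans (by simp)))
  obtain ⟨ω, hω⟩ := exists_weakTendsto_of_bounded l (v := fun k => (T (d k)).symm (R k))
    (C := C + ∑ n ∈ Finset.range ν, ‖W (E n)‖) fun k => by simpa using hRb k
  have hωφ : ε ≤ |⟪φ, ω⟫| := by
    refine ge_of_tendsto (hω φ).abs ?_
    filter_upwards [hcon'] with k hk using (hd k hk).le
  have hshift : ∀ a : ℕ → D, WeakTendsto l (fun k => (T (a k)).symm (R k)) (W a) ∨ ∃ n < ν, ¬ dec (E n) a := by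
    intro a
    by_cases h : ∃ n < ν, ¬ dec (E n) a
    · exact Or.inr h
    push Not at h
    refine Or.inl ?_
    have h1 : WeakTendsto l
        (fun k => ∑ n ∈ Finset.range ν, (T (a k)).symm (T ((E n : ℕ → D) k) (W (E n))))
        (∑ n ∈ Finset.range ν, (0 : H)) := WeakTendsto.sum fun n hn z => by
      have h2 := hdec _ _ (hsymm _ _ (h n (Finset.mem_range.1 hn))) z (W (E n))
      rw [inner_zero_right]
      refine h2.congr fun k => ?_
      rw [← (T (a k)).symm.inner_map_map]; simp
    have h3 := (hW a).sub h1
    simpa [hR] using h3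
  have hzero : ∀ n < ν, WeakTendsto l (fun k => (T ((E n : ℕ → D) k)).symm (R k)) (0 : H) := by
    intro m hm
    have h1 : WeakTendsto l
        (fun k => ∑ n ∈ Finset.range ν, (T ((E m : ℕ → D) k)).symm (T ((E n : ℕ → D) k) (W (E n))))
        (∑ n ∈ Finset.range ν, if n = m then W (E m) else 0) := WeakTendsto.sum fun n hn z => by
      by_cases hnm : n = m
      · subst hnm
        simp
      · have h2 := hdec _ _ (hdecE m n (Ne.symm hnm)) z (W (E n))
        simp only [hnm, if_false, inner_zero_right]
        refine h2.congr fun k => ?_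
        rw [← (T ((E m : ℕ → D) k)).symm.inner_map_map]; simp
    have h3 := (hW (E m)).sub h1
    simpa [hR, hm] using h3
  rcases hshift d with h0 | ⟨n, hn, hnd⟩
  · have hωW := hω.unique h0
    have hW0 : W d ≠ 0 := by
      intro h
      rw [hωW, h] at hωφ
      simp at hωφ
      linarith
    obtain ⟨n, hn⟩ := hmax d hW0
    obtain ⟨Q, hQ⟩ := hndec _ _ hn
    rcases lt_or_ge n ν with hnν | hnν
    · have := weakTendsto_symm_of_tendsto T hRb Q hQ (hzero n hnν)
      rw [hω.unique this] at hωφ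
      simp at hωφ
      linarith
    · have h1 := weakTendsto_symm_of_tendsto T hU Q hQ (hW (E n))
      have h2 : ‖W d‖ = ‖W (E n)‖ := by rw [(hW d).unique h1, Q.norm_map]
      have h3 : |⟪φ, ω⟫| ≤ ‖φ‖ * ‖W (E n)‖ := by
        rw [hωW, ← h2]; exact abs_real_inner_le_norm _ _
      have h4 := hν₀ n (hν.trans hnν)
      linarith
  · obtain ⟨Q, hQ⟩ := hndec _ _ hnd
    have := weakTendsto_symm_of_tendsto T hRb Q hQ (hzero n hn)
    rw [hω.unique this] at hωφ
    simp at hωφ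
    linarith

end AbstractDecomposition

section AveragesAndTranslations

set_option linter.unusedSectionVars false

theorem sq_lintegral_le_lintegral_sq {α : Type*} [MeasurableSpace α] {ν : Measure α}
    [IsProbabilityMeasure ν] {g : α → ENNReal} (hg : AEMeasurable g ν) :
    (∫⁻ x, g x ∂ν) ^ 2 ≤ ∫⁻ x, g x ^ 2 ∂ν := by
  have h := ENNReal.lintegral_mul_le_Lp_mul_Lq ν Real.HolderConjugate.two_two hg
    (aemeasurable_const (b := (1 : ENNReal)))
  simp only [Pi.mul_apply, mul_one, ENNReal.one_rpow, lintegral_const, measure_univ] at h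
  calc (∫⁻ x, g x ∂ν) ^ 2 ≤ ((∫⁻ x, g x ^ (2 : ℝ) ∂ν) ^ (1 / 2 : ℝ)) ^ 2 := by gcongr
    _ = ∫⁻ x, g x ^ 2 ∂ν := by
      rw [← ENNReal.rpow_natCast, ← ENNReal.rpow_mul]
      norm_num

variable {E : Type*} [NormedAddCommGroup E] [NormedSpace ℝ E] [MeasurableSpace E] [BorelSpace E]
  [FiniteDimensional ℝ E] {μ : Measure E} [μ.IsAddHaarMeasure]

theorem enorm_sub_le_lintegral_fderiv {f : E → ℝ} (hf : ContDiff ℝ 1 f) (x h : E) :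
    ‖f x - f (x + h)‖ₑ ≤ ‖h‖ₑ * ∫⁻ t in Set.Ioc (0 : ℝ) 1, ‖fderiv ℝ f (x + t • h)‖ₑ := by
  have hder : ∀ t : ℝ, HasDerivAt (fun t : ℝ => f (x + t • h)) (fderiv ℝ f (x + t • h) h) t := by
    intro t
    have h1 : HasDerivAt (fun t : ℝ => x + t • h) h t := by
      simpa using ((hasDerivAt_id t).smul_const h).const_add x
    exact ((hf.differentiable one_ne_zero _).hasFDerivAt).comp_hasDerivAt t h1
  have hcont : Continuous fun t : ℝ => fderiv ℝ f (x + t • h) h :=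
    ((hf.continuous_fderiv one_ne_zero).comp (by fun_prop)).clm_apply continuous_const
  have hint := intervalIntegral.integral_eq_sub_of_hasDerivAt (a := 0) (b := 1)
    (fun t _ => hder t) (hcont.intervalIntegrable _ _)
  simp only [one_smul, zero_smul, add_zero] at hint
  rw [← enorm_neg, neg_sub, ← hint, intervalIntegral.integral_of_le zero_le_one,
    ← lintegral_const_mul' _ _ enorm_ne_top]
  refine (enorm_integral_le_lintegral_enorm _).trans (lintegral_mono fun t => ?_)
  rw [mul_comm]
  exact ContinuousLinearMap.le_opENorm _ _

theorem lintegral_sq_sub_translate_le {f : E → ℝ} (hf : ContDiff ℝ 1 f) (h : E) :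
    ∫⁻ x, ‖f x - f (x + h)‖ₑ ^ 2 ∂μ ≤ ‖h‖ₑ ^ 2 * ∫⁻ x, ‖fderiv ℝ f x‖ₑ ^ 2 ∂μ := by
  have hc : Continuous fun x => ‖fderiv ℝ f x‖ₑ := (hf.continuous_fderiv one_ne_zero).enorm
  have : IsProbabilityMeasure (volume.restrict (Set.Ioc (0 : ℝ) 1)) := ⟨by simp⟩
  calc ∫⁻ x, ‖f x - f (x + h)‖ₑ ^ 2 ∂μ
      ≤ ∫⁻ x, ‖h‖ₑ ^ 2 * (∫⁻ t in Set.Ioc (0 : ℝ) 1, ‖fderiv ℝ f (x + t • h)‖ₑ ^ 2) ∂μ := by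
        refine lintegral_mono fun x => ?_
        refine (pow_le_pow_left' (enorm_sub_le_lintegral_fderiv hf x h) 2).trans ?_
        rw [mul_pow]
        gcongr
        exact sq_lintegral_le_lintegral_sq (hc.comp (by fun_prop)).aemeasurable
    _ = ‖h‖ₑ ^ 2 * ∫⁻ t in Set.Ioc (0 : ℝ) 1, (∫⁻ x, ‖fderiv ℝ f (x + t • h)‖ₑ ^ 2 ∂μ) := by
        rw [lintegral_const_mul' _ _ (by simp), lintegral_lintegral_swap]
        refine Measurable.aemeasurable ?_
        exact ((ENNReal.continuous_pow 2).comp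
          (hc.comp (by fun_prop : Continuous fun z : E × ℝ => z.1 + z.2 • h))).measurable
    _ = ‖h‖ₑ ^ 2 * ∫⁻ x, ‖fderiv ℝ f x‖ₑ ^ 2 ∂μ := by
        congr 1
        have : ∀ t : ℝ, ∫⁻ x, ‖fderiv ℝ f (x + t • h)‖ₑ ^ 2 ∂μ = ∫⁻ x, ‖fderiv ℝ f x‖ₑ ^ 2 ∂μ :=
          fun t => lintegral_add_right_eq_self (fun x => ‖fderiv ℝ f x‖ₑ ^ 2) (t • h)
        simp [this]

theorem integrable_comp_add_smul {f : E → ℝ} (hf : Continuous f) (hfc : HasCompactSupport f)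
    (ν : Measure E) [IsFiniteMeasure ν] (s : ℝ) (x : E) : Integrable (fun h => f (x + s • h)) ν := by
  obtain ⟨C, hC⟩ := hf.bounded_above_of_compact_support hfc
  exact Integrable.of_bound (hf.comp (by fun_prop)).aestronglyMeasurable C
    (ae_of_all _ fun h => hC _)

theorem lintegral_sq_sub_average_le {f : E → ℝ} (hf : ContDiff ℝ 1 f) (hfc : HasCompactSupport f)
    (ν : Measure E) [IsProbabilityMeasure ν] (hν : ∀ᵐ h ∂ν, ‖h‖ ≤ 1) (s : ℝ) :
    ∫⁻ x, ‖f x - ∫ h, f (x + s • h) ∂ν‖ₑ ^ 2 ∂μ ≤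
      ‖s‖ₑ ^ 2 * ∫⁻ x, ‖fderiv ℝ f x‖ₑ ^ 2 ∂μ := by
  have hc := hf.continuous
  calc ∫⁻ x, ‖f x - ∫ h, f (x + s • h) ∂ν‖ₑ ^ 2 ∂μ
      ≤ ∫⁻ x, ∫⁻ h, ‖f x - f (x + s • h)‖ₑ ^ 2 ∂ν ∂μ := by
        refine lintegral_mono fun x => ?_
        have h1 : f x - ∫ h, f (x + s • h) ∂ν = ∫ h, (f x - f (x + s • h)) ∂ν := by
          rw [integral_sub (integrable_const _) (integrable_comp_add_smul hc hfc ν s x)]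
          simp
        rw [h1]
        refine (pow_le_pow_left' (enorm_integral_le_lintegral_enorm _) 2).trans ?_
        exact sq_lintegral_le_lintegral_sq (by fun_prop)
    _ = ∫⁻ h, ∫⁻ x, ‖f x - f (x + s • h)‖ₑ ^ 2 ∂μ ∂ν := by
        rw [lintegral_lintegral_swap]
        refine Continuous.aemeasurable ?_
        have : Continuous fun z : E × E => f z.1 - f (z.1 + s • z.2) := by fun_prop
        exact (ENNReal.continuous_pow 2).comp this.enorm
    _ ≤ ∫⁻ h, ‖s‖ₑ ^ 2 * ∫⁻ x, ‖fderiv ℝ f x‖ₑ ^ 2 ∂μ ∂ν := by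
        refine lintegral_mono_ae ?_
        filter_upwards [hν] with h hh
        refine (lintegral_sq_sub_translate_le hf (s • h)).trans ?_
        gcongr
        rw [enorm_smul]
        refine mul_le_of_le_one_right' ?_
        rw [← ofReal_norm]
        exact ENNReal.ofReal_le_one.2 hh
    _ = _ := by simp

end AveragesAndTranslations

section ImprovedSobolev

set_option linter.unusedSectionVars false

theorem exists_smooth_truncation (c : ℝ) (hc : 2 ≤ c) :
    ∃ (θ : ℝ → ℝ) (M : ℝ), ContDiff ℝ 1 θ ∧ 0 ≤ M ∧ (∀ s, |deriv θ s| ≤ M) ∧ θ 0 = 0 ∧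
      (∀ s, 2 ≤ |s| → |s| ≤ c → θ s = s) ∧ (∀ s, |s| ≤ c → |s - θ s| ≤ 2) ∧
      (∀ s, |s - θ s| ≤ |s|) ∧ (∀ s, |s| < 1 → deriv θ s = 0) ∧
      (∀ s, 2 * c < |s| → deriv θ s = 0) := by
  let b₁ : ContDiffBump (0 : ℝ) := ⟨1, 2, by norm_num, by norm_num⟩
  let b₂ : ContDiffBump (0 : ℝ) := ⟨c, 2 * c, by linarith, by linarith⟩
  let θ : ℝ → ℝ := fun s => s * ((1 - b₁ s) * b₂ s)
  have hsm : ContDiff ℝ 1 θ :=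
    contDiff_id.mul ((contDiff_const.sub b₁.contDiff).mul b₂.contDiff)
  have hz1 : ∀ s, |s| < 1 → θ s = 0 := fun s hs => by
    have : b₁ s = 1 := b₁.one_of_mem_closedBall (by simpa [b₁] using hs.le)
    simp [θ, this]
  have hz2 : ∀ s, 2 * c < |s| → θ s = 0 := fun s hs => by
    have : b₂ s = 0 := b₂.zero_of_le_dist (by simpa [b₂] using hs.le)
    simp [θ, this]
  have hcs : HasCompactSupport θ := by
    refine HasCompactSupport.intro (isCompact_closedBall (0 : ℝ) (2 * c)) fun s hs => hz2 s ?_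
    simpa using hs
  obtain ⟨M, hM⟩ := (hsm.continuous_deriv le_rfl).bounded_above_of_compact_support hcs.deriv
  have hψ : ∀ s, 0 ≤ (1 - b₁ s) * b₂ s ∧ (1 - b₁ s) * b₂ s ≤ 1 := fun s => by
    have h1 := b₁.nonneg (x := s)
    have h2 := b₁.le_one (x := s)
    have h3 := b₂.nonneg (x := s)
    have h4 := b₂.le_one (x := s)
    exact ⟨mul_nonneg (by linarith) h3, mul_le_one₀ (by linarith) h3 h4⟩
  have hmid : ∀ s, 2 ≤ |s| → |s| ≤ c → θ s = s := fun s hs hs' => by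
    have h1 : b₁ s = 0 := b₁.zero_of_le_dist (by simpa [b₁] using hs)
    have h2 : b₂ s = 1 := b₂.one_of_mem_closedBall (by simpa [b₂] using hs')
    simp [θ, h1, h2]
  have habs : ∀ s, |s - θ s| ≤ |s| := fun s => by
    have h1 : s - θ s = s * (1 - (1 - b₁ s) * b₂ s) := by simp only [θ]; ring
    rw [h1, abs_mul]
    refine mul_le_of_le_one_right (abs_nonneg _) ?_
    rw [abs_le]
    constructor <;> linarith [(hψ s).1, (hψ s).2]
  refine ⟨θ, M, hsm, (norm_nonneg _).trans (hM 0), fun s => hM s, by simp [θ], hmid,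
    fun s hs => ?_, habs, fun s hs => ?_, fun s hs => ?_⟩
  · rcases le_or_gt 2 |s| with h | h
    · simp [hmid s h hs]
    · exact (habs s).trans h.le
  · have : θ =ᶠ[𝓝 s] fun _ => 0 := by
      filter_upwards [continuous_abs.isOpen_preimage _ isOpen_Iio |>.mem_nhds hs] with x hx
      exact hz1 x hx
    rw [this.deriv_eq]; simp
  · have : θ =ᶠ[𝓝 s] fun _ => 0 := by
      filter_upwards [continuous_abs.isOpen_preimage _ isOpen_Ioi |>.mem_nhds hs] with x hx
      exact hz2 x hx
    rw [this.deriv_eq]; simp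

variable {E : Type*} [NormedAddCommGroup E] [NormedSpace ℝ E] [MeasurableSpace E] [BorelSpace E]
  [FiniteDimensional ℝ E] {μ : Measure E} [μ.IsAddHaarMeasure]

theorem lintegral_lintegral_add_smul {F : E → ENNReal} (hF : Measurable F)
    (ν : Measure E) [IsProbabilityMeasure ν] (s : ℝ) :
    ∫⁻ x, ∫⁻ h, F (x + s • h) ∂ν ∂μ = ∫⁻ x, F x ∂μ := by
  rw [lintegral_lintegral_swap]
  · have : ∀ h : E, ∫⁻ x, F (x + s • h) ∂μ = ∫⁻ x, F x ∂μ :=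
      fun h => lintegral_add_right_eq_self F (s • h)
    simp [this]
  · exact (hF.comp (by fun_prop : Measurable fun z : E × E => z.1 + s • z.2)).aemeasurable

theorem ENNReal_sq_le_of_le_add {τ a b : ENNReal} (h : τ ≤ a + b) :
    τ ^ 2 ≤ 4 * a ^ 2 + 2 * τ * b := by
  rcases le_or_gt τ (2 * a) with h1 | h1
  · calc τ ^ 2 ≤ (2 * a) ^ 2 := by gcongr
      _ = 4 * a ^ 2 := by rw [mul_pow]; norm_num
      _ ≤ _ := le_self_add
  · have hτ : 2 * a ≠ ⊤ := h1.ne_top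
    have h2 : τ ≤ 2 * b := by
      rcases eq_or_ne τ ⊤ with rfl | hτt
      · have : b = ⊤ := by
          by_contra hb
          have : a ≠ ⊤ := fun h => hτ (by simp [h])
          simp_all
        simp [this]
      · have h3 : τ + τ ≤ τ + 2 * b := by
          calc τ + τ ≤ (a + b) + (a + b) := add_le_add h h
            _ = 2 * a + 2 * b := by ring
            _ ≤ τ + 2 * b := by gcongr
        exact (ENNReal.add_le_add_iff_left hτt).1 h3
    calc τ ^ 2 = τ * τ := sq τ
      _ ≤ τ * (2 * b) := by gcongr
      _ = 2 * τ * b := by ring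
      _ ≤ _ := le_add_self

/-- Estimate of a level set of `u` through its averages at a scale adapted to the level. -/
theorem measure_level_le {c M : ℝ} (hc : 8 ≤ c) {θ : ℝ → ℝ} (hθ : ContDiff ℝ 1 θ)
    (hM : ∀ s, |deriv θ s| ≤ M) (hθ0 : θ 0 = 0)
    (hmid : ∀ s, 2 ≤ |s| → |s| ≤ c → θ s = s) (hlow : ∀ s, |s| ≤ c → |s - θ s| ≤ 2)
    (habs : ∀ s, |s - θ s| ≤ |s|) (hd1 : ∀ s, |s| < 1 → deriv θ s = 0)
    (hd2 : ∀ s, 2 * c < |s| → deriv θ s = 0)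
    {u : E → ℝ} (hu : ContDiff ℝ 1 u) (huc : HasCompactSupport u)
    (ν : Measure E) [IsProbabilityMeasure ν] (hν : ∀ᵐ h ∂ν, ‖h‖ ≤ 1) {s t : ℝ} (ht : 0 < t)
    (hav : ∀ x, |∫ h, u (x + s • h) ∂ν| ≤ t) :
    ENNReal.ofReal t ^ 2 * μ {x | 4 * t ≤ |u x| ∧ |u x| ≤ 8 * t} ≤
      4 * ‖s‖ₑ ^ 2 * ENNReal.ofReal M ^ 2 *
        (∫⁻ x, {x | t ≤ |u x| ∧ |u x| ≤ 2 * c * t}.indicator (fun x => ‖fderiv ℝ u x‖ₑ ^ 2) x ∂μ) +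
      2 * ENNReal.ofReal t * ∫⁻ x, {x | c * t < |u x|}.indicator (fun x => ‖u x‖ₑ) x ∂μ := by
  have huC := hu.continuous
  set f : E → ℝ := fun x => t * θ (u x / t) with hf
  have hfs : ContDiff ℝ 1 f := contDiff_const.mul (hθ.comp (hu.div_const t))
  have hfc : HasCompactSupport f := huc.comp_left (g := fun s => t * θ (s / t)) (by simp [hθ0])
  have hfd : ∀ x, ‖fderiv ℝ f x‖ₑ ^ 2 ≤ ENNReal.ofReal M ^ 2 *
      {x | t ≤ |u x| ∧ |u x| ≤ 2 * c * t}.indicator (fun x => ‖fderiv ℝ u x‖ₑ ^ 2) x := by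
    intro x
    have h1 : HasFDerivAt f (deriv θ (u x / t) • fderiv ℝ u x) x := by
      have h2 := (hu.differentiable one_ne_zero x).hasFDerivAt
      have h3 : HasFDerivAt (fun x => u x / t) (t⁻¹ • fderiv ℝ u x) x := by
        simpa [div_eq_inv_mul] using h2.const_mul t⁻¹
      have h4 := (hθ.differentiable one_ne_zero (u x / t)).hasDerivAt
      have h5 := (h4.comp_hasFDerivAt x h3).const_mul t
      have h6 : deriv θ (u x / t) • fderiv ℝ u x =
          t • deriv θ (u x / t) • t⁻¹ • fderiv ℝ u x := by
        rw [smul_smul, smul_smul]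
        congr 1
        field_simp
      rw [h6]
      exact h5
    rw [h1.fderiv, enorm_smul, mul_pow]
    by_cases hx : x ∈ {x | t ≤ |u x| ∧ |u x| ≤ 2 * c * t}
    · rw [Set.indicator_of_mem hx]
      gcongr
      rw [← ofReal_norm]
      exact ENNReal.ofReal_le_ofReal (hM _)
    · have : deriv θ (u x / t) = 0 := by
        simp only [Set.mem_ofPred_eq, not_and_or, not_le] at hx
        rcases hx with hx | hx
        · exact hd1 _ (by rw [abs_div, abs_of_pos ht, div_lt_one ht]; exact hx)
        · exact hd2 _ (by rw [abs_div, abs_of_pos ht, lt_div_iff₀ ht]; exact hx)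
      rw [this]; simp
  set G : E → ENNReal := {x | c * t < |u x|}.indicator (fun x => ‖u x‖ₑ) with hG
  have hGm : Measurable G := by
    refine Measurable.indicator huC.enorm.measurable ?_
    exact (isOpen_lt continuous_const huC.abs).measurableSet
  set B : E → ENNReal := fun x => ∫⁻ h, G (x + s • h) ∂ν with hB
  have hdiff : ∀ x, ‖u x - f x‖ₑ ≤ ENNReal.ofReal (2 * t) + G x := by
    intro x
    have h1 : u x - f x = t * (u x / t - θ (u x / t)) := by
      simp only [hf]; field_simp
    by_cases hx : c * t < |u x|
    · have h2 : ‖u x - f x‖ ≤ ‖u x‖ := by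
        rw [h1, norm_mul, Real.norm_eq_abs, Real.norm_eq_abs, abs_of_pos ht]
        calc t * |u x / t - θ (u x / t)| ≤ t * |u x / t| :=
              mul_le_mul_of_nonneg_left (habs _) ht.le
          _ = ‖u x‖ := by rw [abs_div, abs_of_pos ht, Real.norm_eq_abs]; field_simp
      have h3 : G x = ‖u x‖ₑ := Set.indicator_of_mem (s := {x | c * t < |u x|}) hx _
      rw [h3]
      exact (enorm_le_iff_norm_le.2 h2).trans le_add_self
    · have h2 : ‖u x - f x‖ ≤ 2 * t := by
        rw [h1, norm_mul, Real.norm_eq_abs, Real.norm_eq_abs, abs_of_pos ht, mul_comm]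
        gcongr
        refine hlow _ ?_
        rw [abs_div, abs_of_pos ht, div_le_iff₀ ht]
        exact not_lt.1 hx
      rw [← ofReal_norm]
      exact (ENNReal.ofReal_le_ofReal h2).trans le_self_add
  have hpt : ∀ x ∈ {x | 4 * t ≤ |u x| ∧ |u x| ≤ 8 * t},
      ENNReal.ofReal t ≤ ‖f x - ∫ h, f (x + s • h) ∂ν‖ₑ + B x := by
    rintro x ⟨hx1, hx2⟩
    have hfx : f x = u x := by
      have : θ (u x / t) = u x / t := by
        refine hmid _ ?_ ?_
        · rw [abs_div, abs_of_pos ht, le_div_iff₀ ht]; linarith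
        · rw [abs_div, abs_of_pos ht, div_le_iff₀ ht]; nlinarith
      simp only [hf, this]; field_simp
    have h1 : f x = (f x - ∫ h, f (x + s • h) ∂ν) + ∫ h, u (x + s • h) ∂ν -
        ∫ h, (u (x + s • h) - f (x + s • h)) ∂ν := by
      rw [integral_sub (integrable_comp_add_smul huC huc ν s x)
        (integrable_comp_add_smul hfs.continuous hfc ν s x)]
      ring
    have h2 : ‖∫ h, (u (x + s • h) - f (x + s • h)) ∂ν‖ₑ ≤ ENNReal.ofReal (2 * t) + B x := by
      refine (enorm_integral_le_lintegral_enorm _).trans ?_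
      refine (lintegral_mono fun h => hdiff (x + s • h)).trans ?_
      rw [lintegral_add_left measurable_const]
      simp [hB]
    have h3 : ‖∫ h, u (x + s • h) ∂ν‖ₑ ≤ ENNReal.ofReal t := by
      rw [← ofReal_norm]
      exact ENNReal.ofReal_le_ofReal (hav x)
    have h4 : ENNReal.ofReal (4 * t) ≤ ‖f x‖ₑ := by
      rw [← ofReal_norm, hfx]
      exact ENNReal.ofReal_le_ofReal hx1
    have h5 : ‖f x‖ₑ ≤ ‖f x - ∫ h, f (x + s • h) ∂ν‖ₑ + ENNReal.ofReal t +
        (ENNReal.ofReal (2 * t) + B x) := by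
      conv_lhs => rw [h1]
      refine enorm_sub_le.trans (add_le_add ((enorm_add_le _ _).trans ?_) h2)
      gcongr
    have h6 : ENNReal.ofReal (4 * t) = ENNReal.ofReal (3 * t) + ENNReal.ofReal t := by
      rw [← ENNReal.ofReal_add (by positivity) ht.le]; congr 1; ring
    have h7 : ENNReal.ofReal (3 * t) = ENNReal.ofReal t + ENNReal.ofReal (2 * t) := by
      rw [← ENNReal.ofReal_add ht.le (by positivity)]; congr 1; ring
    have h8 := h4.trans h5
    rw [h6] at h8
    refine (ENNReal.add_le_add_iff_left (a := ENNReal.ofReal (3 * t)) ENNReal.ofReal_ne_top).1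
      (h8.trans (le_of_eq ?_))
    rw [h7]; ring
  have hmeas : MeasurableSet {x | 4 * t ≤ |u x| ∧ |u x| ≤ 8 * t} :=
    ((isClosed_le continuous_const huC.abs).inter
      (isClosed_le huC.abs continuous_const)).measurableSet
  have hBm : Measurable B :=
    (hGm.comp (by fun_prop : Measurable fun z : E × E => z.1 + s • z.2)).lintegral_prod_right'
  calc ENNReal.ofReal t ^ 2 * μ {x | 4 * t ≤ |u x| ∧ |u x| ≤ 8 * t}
      = ∫⁻ x, {x | 4 * t ≤ |u x| ∧ |u x| ≤ 8 * t}.indicator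
          (fun _ => ENNReal.ofReal t ^ 2) x ∂μ := by
        rw [lintegral_indicator_const hmeas]
    _ ≤ ∫⁻ x, (4 * ‖f x - ∫ h, f (x + s • h) ∂ν‖ₑ ^ 2 + 2 * ENNReal.ofReal t * B x) ∂μ := by
        refine lintegral_mono fun x => ?_
        refine Set.indicator_le (s := {x | 4 * t ≤ |u x| ∧ |u x| ≤ 8 * t})
          (g := fun x => 4 * ‖f x - ∫ h, f (x + s • h) ∂ν‖ₑ ^ 2 + 2 * ENNReal.ofReal t * B x)
          (fun x hx => ENNReal_sq_le_of_le_add (hpt x hx)) x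
    _ = 4 * (∫⁻ x, ‖f x - ∫ h, f (x + s • h) ∂ν‖ₑ ^ 2 ∂μ) +
          2 * ENNReal.ofReal t * ∫⁻ x, G x ∂μ := by
        rw [lintegral_add_right _ (hBm.const_mul _), lintegral_const_mul' _ _ (by simp),
          lintegral_const_mul' _ _ (by finiteness), hB, lintegral_lintegral_add_smul hGm]
    _ ≤ _ := by
        refine add_le_add ?_ le_rfl
        rw [mul_assoc (4 * ‖s‖ₑ ^ 2), mul_assoc 4]
        refine mul_le_mul_right ?_ _
        refine (lintegral_sq_sub_average_le hfs hfc ν hν s).trans ?_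
        gcongr
        rw [← lintegral_const_mul' _ _ (by finiteness)]
        exact lintegral_mono hfd

end ImprovedSobolev

section ImprovedSobolevInequality

set_option linter.unusedSectionVars false

/-- The function `t ^ e` on a planar set. -/
def powerKernel (S : Set (ℝ × ℝ)) (e : ℝ) : ℝ × ℝ → ENNReal :=
  S.indicator fun z => ENNReal.ofReal (z.1 ^ e)

theorem measurable_powerKernel {S : Set (ℝ × ℝ)} (hS : MeasurableSet S) (e : ℝ) :
    Measurable (powerKernel S e) :=
  Measurable.indicator (by fun_prop) hS

theorem ofReal_le_lintegral_powerKernel {q v : ℝ} (hq : 1 ≤ q) (hv : 0 ≤ v) :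
    ENNReal.ofReal ((8 ^ q)⁻¹ * v ^ q) ≤
      ∫⁻ t in Set.Ioi (0 : ℝ),
        powerKernel {z | 4 * z.1 ≤ z.2 ∧ z.2 ≤ 8 * z.1} (q - 1) (t, v) := by
  rcases hv.eq_or_lt with rfl | hv
  · simp [Real.zero_rpow (by linarith : q ≠ 0)]
  calc ENNReal.ofReal ((8 ^ q)⁻¹ * v ^ q)
      = ∫⁻ _ in Set.Icc (v / 8) (v / 4), ENNReal.ofReal ((v / 8) ^ (q - 1)) := by
        rw [setLIntegral_const, Real.volume_Icc, ← ENNReal.ofReal_mul (by positivity)]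
        congr 1
        have h1 : (v / 8) ^ q = (v / 8) ^ (q - 1) * (v / 8) := by
          rw [← Real.rpow_add_one (by positivity)]; congr 1; ring
        have h2 : v / 4 - v / 8 = v / 8 := by ring
        rw [h2, ← h1, Real.div_rpow hv.le (by norm_num)]
        field_simp
    _ ≤ ∫⁻ t in Set.Icc (v / 8) (v / 4),
          powerKernel {z | 4 * z.1 ≤ z.2 ∧ z.2 ≤ 8 * z.1} (q - 1) (t, v) := by
        refine setLIntegral_mono' measurableSet_Icc fun t ht => ?_
        have hmem : (t, v) ∈ {z : ℝ × ℝ | 4 * z.1 ≤ z.2 ∧ z.2 ≤ 8 * z.1} := by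
          constructor
          · have := ht.2; simp only; linarith
          · have := ht.1; simp only; linarith
        rw [powerKernel, Set.indicator_of_mem hmem]
        exact ENNReal.ofReal_le_ofReal
          (Real.rpow_le_rpow (by positivity) ht.1 (by linarith))
    _ ≤ _ := by
        refine lintegral_mono_set fun t ht => ?_
        have := ht.1
        simp only [Set.mem_Ioi]
        linarith [div_pos hv (by norm_num : (0 : ℝ) < 8)]

theorem lintegral_powerKernel_neg_one_le {c v : ℝ} (hc : 0 < c) :
    ∫⁻ t in Set.Ioi (0 : ℝ), powerKernel {z | z.1 ≤ z.2 ∧ z.2 ≤ c * z.1} (-1) (t, v) ≤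
      ENNReal.ofReal c := by
  rcases le_or_gt v 0 with hv | hv
  · refine (le_of_eq ?_).trans zero_le
    rw [setLIntegral_congr_fun (g := fun _ => 0) measurableSet_Ioi, lintegral_zero]
    intro t ht
    refine Set.indicator_of_notMem ?_ _
    rintro ⟨h1, -⟩
    exact absurd (lt_of_lt_of_le ht h1) (not_lt.2 hv)
  · calc ∫⁻ t in Set.Ioi (0 : ℝ), powerKernel {z | z.1 ≤ z.2 ∧ z.2 ≤ c * z.1} (-1) (t, v)
        ≤ ∫⁻ t in Set.Ioi (0 : ℝ),
            (Set.Iic v).indicator (fun _ => ENNReal.ofReal (c / v)) t := by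
          refine setLIntegral_mono' measurableSet_Ioi fun t (ht : 0 < t) => ?_
          rw [powerKernel]
          by_cases h : (t, v) ∈ {z : ℝ × ℝ | z.1 ≤ z.2 ∧ z.2 ≤ c * z.1}
          · rw [Set.indicator_of_mem h, Set.indicator_of_mem (show t ∈ Set.Iic v from h.1)]
            refine ENNReal.ofReal_le_ofReal ?_
            rw [Real.rpow_neg_one, le_div_iff₀ hv, inv_mul_le_iff₀ ht, mul_comm]
            exact h.2
          · rw [Set.indicator_of_notMem h]; exact zero_le
      _ = ENNReal.ofReal c := by
          rw [lintegral_indicator_const measurableSet_Iic, Measure.restrict_apply measurableSet_Iic,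
            Set.inter_comm, Set.Ioi_inter_Iic, Real.volume_Ioc, ← ENNReal.ofReal_mul (by positivity)]
          congr 1
          field_simp
          ring

theorem lintegral_powerKernel_le {c e v : ℝ} (hc : 0 < c) (he : 0 ≤ e) (hv : 0 ≤ v) :
    ∫⁻ t in Set.Ioi (0 : ℝ), powerKernel {z | c * z.1 < z.2} e (t, v) ≤
      ENNReal.ofReal ((v / c) ^ (e + 1)) := by
  calc ∫⁻ t in Set.Ioi (0 : ℝ), powerKernel {z | c * z.1 < z.2} e (t, v)
      ≤ ∫⁻ t in Set.Ioi (0 : ℝ),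
          (Set.Iic (v / c)).indicator (fun _ => ENNReal.ofReal ((v / c) ^ e)) t := by
        refine setLIntegral_mono' measurableSet_Ioi fun t (ht : 0 < t) => ?_
        rw [powerKernel]
        by_cases h : (t, v) ∈ {z : ℝ × ℝ | c * z.1 < z.2}
        · have h' : t ≤ v / c := by
            rw [le_div_iff₀ hc, mul_comm]
            exact le_of_lt h
          rw [Set.indicator_of_mem h, Set.indicator_of_mem (show t ∈ Set.Iic (v / c) from h')]
          exact ENNReal.ofReal_le_ofReal (Real.rpow_le_rpow ht.le h' he)
        · rw [Set.indicator_of_notMem h]; exact zero_le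
    _ = ENNReal.ofReal ((v / c) ^ (e + 1)) := by
        rw [lintegral_indicator_const measurableSet_Iic, Measure.restrict_apply measurableSet_Iic,
          Set.inter_comm, Set.Ioi_inter_Iic, Real.volume_Ioc, ← ENNReal.ofReal_mul (by positivity),
          sub_zero, ← Real.rpow_add_one' (by positivity) (by linarith)]

variable {E : Type*} [NormedAddCommGroup E] [NormedSpace ℝ E] [MeasurableSpace E] [BorelSpace E]
  [FiniteDimensional ℝ E] {μ : Measure E} [μ.IsAddHaarMeasure]

theorem lintegral_powerKernel_swap {S : Set (ℝ × ℝ)} (hS : MeasurableSet S) (e : ℝ) {v : E → ℝ}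
    (hv : Continuous v) {F : E → ENNReal} (hF : Measurable F) :
    ∫⁻ t in Set.Ioi (0 : ℝ), ∫⁻ x, powerKernel S e (t, v x) * F x ∂μ =
      ∫⁻ x, (∫⁻ t in Set.Ioi (0 : ℝ), powerKernel S e (t, v x)) * F x ∂μ := by
  have hk := measurable_powerKernel hS e
  have hv' := hv.measurable
  have hm : Measurable fun z : ℝ × E => powerKernel S e (z.1, v z.2) :=
    hk.comp (by fun_prop)
  rw [lintegral_lintegral_swap]
  · refine lintegral_congr fun x => ?_
    rw [lintegral_mul_const]
    exact hk.comp (by fun_prop)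
  · exact (hm.mul (hF.comp measurable_snd)).aemeasurable

theorem lintegral_powerKernel_mul (S : Set (ℝ × ℝ)) (e t : ℝ) (v : E → ℝ) (F : E → ENNReal) :
    ∫⁻ x, powerKernel S e (t, v x) * F x ∂μ =
      ENNReal.ofReal (t ^ e) * ∫⁻ x, {x | (t, v x) ∈ S}.indicator F x ∂μ := by
  rw [← lintegral_const_mul' _ _ ENNReal.ofReal_ne_top]
  refine lintegral_congr fun x => ?_
  by_cases h : (t, v x) ∈ S
  · rw [powerKernel, Set.indicator_of_mem h, Set.indicator_of_mem (s := {x | (t, v x) ∈ S}) h]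
  · rw [powerKernel, Set.indicator_of_notMem h,
      Set.indicator_of_notMem (s := {x | (t, v x) ∈ S}) h]
    simp

theorem exists_scale {a ρ t : ℝ} (ha : 0 < a) (hρ : 0 < ρ) (ht : 0 < t) :
    ∃ j : ℤ, ρ * ((2 : ℝ) ^ a) ^ j ≤ t ∧ ((2 : ℝ) ^ (-j)) ^ 2 ≤ 4 * (ρ / t) ^ (2 / a) := by
  obtain ⟨j, hj1, hj2⟩ := exists_mem_Ico_zpow (x := t / ρ) (y := (2 : ℝ) ^ a) (by positivity)
    (Real.one_lt_rpow (by norm_num) ha)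
  refine ⟨j, by rwa [le_div_iff₀' hρ] at hj1, ?_⟩
  have h1 : ((2 : ℝ) ^ a) ^ (j + 1) = ((2 : ℝ) ^ (j + 1)) ^ a := by
    rw [← Real.rpow_intCast, ← Real.rpow_mul (by norm_num), mul_comm, Real.rpow_mul (by norm_num),
      Real.rpow_intCast]
  rw [h1] at hj2
  have h2 : (t / ρ) ^ (2 / a) ≤ ((2 : ℝ) ^ (j + 1)) ^ 2 := by
    calc (t / ρ) ^ (2 / a) ≤ (((2 : ℝ) ^ (j + 1)) ^ a) ^ (2 / a) :=
          Real.rpow_le_rpow (by positivity) hj2.le (by positivity)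
      _ = ((2 : ℝ) ^ (j + 1)) ^ 2 := by
          rw [← Real.rpow_mul (by positivity), ← Real.rpow_natCast]
          congr 1
          push_cast
          field_simp
  have h3 : (ρ / t) ^ (2 / a) = ((t / ρ) ^ (2 / a))⁻¹ := by
    rw [← Real.inv_rpow (by positivity), inv_div]
  rw [h3, zpow_neg, inv_pow, ← div_eq_mul_inv, le_div_iff₀ (by positivity), inv_mul_le_iff₀
    (by positivity)]
  refine h2.trans (le_of_eq ?_)
  rw [zpow_add_one₀ (by norm_num)]
  ring

/-- Improved Sobolev inequality: the critical norm is controlled by the Dirichlet integral and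
the supremum of the rescaled averages. -/
theorem exists_lintegral_rpow_le_of_average_le (μ : Measure E) [μ.IsAddHaarMeasure]
    {a : ℝ} (ha : 0 < a) :
    ∃ K : NNReal, ∀ (u : E → ℝ) (ν : Measure E) (ρ : ℝ), ContDiff ℝ 1 u → HasCompactSupport u →
      IsProbabilityMeasure ν → (∀ᵐ h ∂ν, ‖h‖ ≤ 1) → 0 < ρ →
      (∀ (j : ℤ) x, |∫ h, u (x + (2 : ℝ) ^ (-j) • h) ∂ν| ≤ ρ * ((2 : ℝ) ^ a) ^ j) →
      ∫⁻ x, ‖u x‖ₑ ^ (2 + 2 / a) ∂μ ≤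
        K * ENNReal.ofReal (ρ ^ (2 / a)) * ∫⁻ x, ‖fderiv ℝ u x‖ₑ ^ 2 ∂μ := by
  set q : ℝ := 2 + 2 / a with hq
  have hq2 : 2 < q := by
    have : 0 < 2 / a := by positivity
    linarith
  set c : ℝ := 4 * 8 ^ q with hcdef
  have h8q : (1 : ℝ) ≤ 8 ^ q := Real.one_le_rpow (by norm_num) (by linarith)
  have hc8 : 8 ≤ c := by
    have : (8 : ℝ) ^ (1 : ℝ) ≤ 8 ^ q := Real.rpow_le_rpow_of_exponent_le (by norm_num) (by linarith)
    rw [Real.rpow_one] at this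
    linarith
  have hc0 : 0 < c := by linarith
  obtain ⟨θ, M, hθ, hM0, hM, hθ0, hmid, hlow, habs, hd1, hd2⟩ :=
    exists_smooth_truncation c (by linarith)
  refine ⟨Real.toNNReal (64 * c * 8 ^ q * M ^ 2), fun u ν ρ hu huc _ hν hρ hav => ?_⟩
  have hcu := hu.continuous
  have hv : Continuous fun x => |u x| := hcu.abs
  have hS1 : MeasurableSet {z : ℝ × ℝ | 4 * z.1 ≤ z.2 ∧ z.2 ≤ 8 * z.1} := by measurability
  have hS2 : MeasurableSet {z : ℝ × ℝ | z.1 ≤ z.2 ∧ z.2 ≤ 2 * c * z.1} := by measurability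
  have hS3 : MeasurableSet {z : ℝ × ℝ | c * z.1 < z.2} := by measurability
  set D := ∫⁻ x, ‖fderiv ℝ u x‖ₑ ^ 2 ∂μ with hD
  set I := ∫⁻ x, ‖u x‖ₑ ^ q ∂μ with hI
  have hDm : Measurable fun x => ‖fderiv ℝ u x‖ₑ ^ 2 :=
    ((hu.continuous_fderiv one_ne_zero).enorm.measurable).pow_const 2
  have hum : Measurable fun x => ‖u x‖ₑ := hcu.enorm.measurable
  have hIfin : I ≠ ⊤ := by
    have h1 : MemLp u (ENNReal.ofReal q) μ := hcu.memLp_of_hasCompactSupport huc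
    have h2 := lintegral_rpow_enorm_lt_top_of_eLpNorm_lt_top
      (by simpa using by linarith) ENNReal.ofReal_ne_top h1.2
    rw [ENNReal.toReal_ofReal (by linarith)] at h2
    exact h2.ne
  have hpow : ∀ x, ‖u x‖ₑ ^ q = ENNReal.ofReal (|u x| ^ q) := fun x => by
    rw [← ofReal_norm, Real.norm_eq_abs, ENNReal.ofReal_rpow_of_nonneg (abs_nonneg _) (by linarith)]
  have hpt : ∀ t ∈ Set.Ioi (0 : ℝ),
      ∫⁻ x, powerKernel {z | 4 * z.1 ≤ z.2 ∧ z.2 ≤ 8 * z.1} (q - 1) (t, |u x|) * 1 ∂μ ≤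
      ENNReal.ofReal (16 * M ^ 2 * ρ ^ (2 / a)) *
        (∫⁻ x, powerKernel {z | z.1 ≤ z.2 ∧ z.2 ≤ 2 * c * z.1} (-1) (t, |u x|) *
          ‖fderiv ℝ u x‖ₑ ^ 2 ∂μ) +
      2 * ∫⁻ x, powerKernel {z | c * z.1 < z.2} (q - 2) (t, |u x|) * ‖u x‖ₑ ∂μ := by
    intro t (ht : 0 < t)
    obtain ⟨j, hj1, hj2⟩ := exists_scale ha hρ ht
    have hlev := measure_level_le (μ := μ) hc8 hθ hM hθ0 hmid hlow habs hd1 hd2 hu huc ν hν ht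
      (s := (2 : ℝ) ^ (-j)) (fun x => (hav j x).trans hj1)
    have hmS : MeasurableSet {x | (t, |u x|) ∈ {z : ℝ × ℝ | 4 * z.1 ≤ z.2 ∧ z.2 ≤ 8 * z.1}} :=
      (measurable_const.prodMk hv.measurable) hS1
    rw [lintegral_powerKernel_mul, lintegral_powerKernel_mul, lintegral_powerKernel_mul,
      lintegral_indicator_const hmS, one_mul]
    have hT1 : ENNReal.ofReal (t ^ (q - 1)) =
        ENNReal.ofReal (t ^ (q - 3)) * ENNReal.ofReal t ^ 2 := by
      rw [← ENNReal.ofReal_pow ht.le, ← ENNReal.ofReal_mul (by positivity), ← Real.rpow_natCast,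
        ← Real.rpow_add ht]
      congr 2; push_cast; ring
    have hT3 : ENNReal.ofReal (t ^ (q - 2)) = ENNReal.ofReal (t ^ (q - 3)) * ENNReal.ofReal t := by
      rw [← ENNReal.ofReal_mul (by positivity), ← Real.rpow_add_one ht.ne']
      congr 2; ring
    have hT2 : ENNReal.ofReal (t ^ (q - 3)) *
        (4 * ‖(2 : ℝ) ^ (-j)‖ₑ ^ 2 * ENNReal.ofReal M ^ 2) ≤
        ENNReal.ofReal (16 * M ^ 2 * ρ ^ (2 / a)) * ENNReal.ofReal (t ^ (-1 : ℝ)) := by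
      have h4 : (4 : ENNReal) = ENNReal.ofReal 4 := by simp
      rw [← ofReal_norm, Real.norm_eq_abs, abs_of_pos (by positivity), h4,
        ← ENNReal.ofReal_pow (by positivity), ← ENNReal.ofReal_pow hM0,
        ← ENNReal.ofReal_mul (by positivity), ← ENNReal.ofReal_mul (by positivity),
        ← ENNReal.ofReal_mul (by positivity), ← ENNReal.ofReal_mul (by positivity)]
      refine ENNReal.ofReal_le_ofReal ?_
      have h5 : t ^ (q - 3) = t ^ (2 / a) * t ^ (-1 : ℝ) := by
        rw [← Real.rpow_add ht]; congr 1; rw [hq]; ring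
      rw [Real.div_rpow hρ.le ht.le] at hj2
      calc t ^ (q - 3) * (4 * ((2 : ℝ) ^ (-j)) ^ 2 * M ^ 2)
          ≤ t ^ (q - 3) * (4 * (4 * (ρ ^ (2 / a) / t ^ (2 / a))) * M ^ 2) := by gcongr
        _ = 16 * M ^ 2 * ρ ^ (2 / a) * t ^ (-1 : ℝ) := by
            rw [h5]
            have : t ^ (2 / a) ≠ 0 := by positivity
            field_simp
            ring
    rw [hT1, hT3, mul_assoc]
    refine (mul_le_mul_right hlev _).trans ?_
    rw [mul_add, ← mul_assoc, ← mul_assoc (ENNReal.ofReal (16 * M ^ 2 * ρ ^ (2 / a)))]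
    refine add_le_add (mul_le_mul_left hT2 _) (le_of_eq ?_)
    simp only [Set.mem_ofPred_eq]
    ring
  have hint := setLIntegral_mono' (μ := volume) measurableSet_Ioi hpt
  have hm2 : Measurable fun t => ENNReal.ofReal (16 * M ^ 2 * ρ ^ (2 / a)) *
      (∫⁻ x, powerKernel {z | z.1 ≤ z.2 ∧ z.2 ≤ 2 * c * z.1} (-1) (t, |u x|) *
          ‖fderiv ℝ u x‖ₑ ^ 2 ∂μ) := by
    refine Measurable.const_mul (Measurable.lintegral_prod_right' (f := fun z : ℝ × E =>
      powerKernel {z | z.1 ≤ z.2 ∧ z.2 ≤ 2 * c * z.1} (-1) (z.1, |u z.2|) *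
          ‖fderiv ℝ u z.2‖ₑ ^ 2) ?_) _
    exact ((measurable_powerKernel hS2 _).comp
      (measurable_fst.prodMk (hv.measurable.comp measurable_snd))).mul (hDm.comp measurable_snd)
  rw [lintegral_add_left hm2, lintegral_const_mul' _ _ ENNReal.ofReal_ne_top,
    lintegral_const_mul' _ _ (by simp), lintegral_powerKernel_swap hS1 _ hv measurable_const,
    lintegral_powerKernel_swap hS2 _ hv hDm, lintegral_powerKernel_swap hS3 _ hv hum] at hint
  have hL : ENNReal.ofReal (8 ^ q)⁻¹ * I ≤
      ∫⁻ x, (∫⁻ t in Set.Ioi (0 : ℝ),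
        powerKernel {z | 4 * z.1 ≤ z.2 ∧ z.2 ≤ 8 * z.1} (q - 1) (t, |u x|)) * 1 ∂μ := by
    rw [hI, ← lintegral_const_mul' _ _ ENNReal.ofReal_ne_top]
    refine lintegral_mono fun x => ?_
    rw [mul_one, hpow, ← ENNReal.ofReal_mul (by positivity)]
    exact ofReal_le_lintegral_powerKernel (by linarith) (abs_nonneg _)
  have hA : ∫⁻ x, (∫⁻ t in Set.Ioi (0 : ℝ),
        powerKernel {z | z.1 ≤ z.2 ∧ z.2 ≤ 2 * c * z.1} (-1) (t, |u x|)) *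
          ‖fderiv ℝ u x‖ₑ ^ 2 ∂μ ≤ ENNReal.ofReal (2 * c) * D := by
    rw [hD, ← lintegral_const_mul' _ _ ENNReal.ofReal_ne_top]
    refine lintegral_mono fun x => ?_
    exact mul_le_mul_left (lintegral_powerKernel_neg_one_le (by positivity)) _
  have hB : ∫⁻ x, (∫⁻ t in Set.Ioi (0 : ℝ),
        powerKernel {z | c * z.1 < z.2} (q - 2) (t, |u x|)) * ‖u x‖ₑ ∂μ ≤
      ENNReal.ofReal ((4 * 8 ^ q)⁻¹) * I := by
    rw [hI, ← lintegral_const_mul' _ _ ENNReal.ofReal_ne_top]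
    refine lintegral_mono fun x => ?_
    refine (mul_le_mul_left
      (lintegral_powerKernel_le hc0 (by linarith) (abs_nonneg (u x))) _).trans ?_
    rw [hpow, ← ofReal_norm, ← ENNReal.ofReal_mul (by positivity),
      ← ENNReal.ofReal_mul (by positivity), Real.norm_eq_abs]
    refine ENNReal.ofReal_le_ofReal ?_
    have h1 : q - 2 + 1 = q - 1 := by ring
    have h2 : |u x| ^ q = |u x| ^ (q - 1) * |u x| := by
      rw [← Real.rpow_add_one' (abs_nonneg _) (by linarith)]; congr 1; ring
    have h3 : c ≤ c ^ (q - 1) := by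
      conv_lhs => rw [← Real.rpow_one c]
      exact Real.rpow_le_rpow_of_exponent_le (by linarith) (by linarith)
    rw [h1, h2, Real.div_rpow (abs_nonneg _) hc0.le, ← mul_assoc, div_eq_inv_mul]
    gcongr
  have hfin : ENNReal.ofReal (8 ^ q)⁻¹ * I ≤
      ENNReal.ofReal (16 * M ^ 2 * ρ ^ (2 / a)) * (ENNReal.ofReal (2 * c) * D) +
        2 * (ENNReal.ofReal ((4 * 8 ^ q)⁻¹) * I) :=
    hL.trans (hint.trans (by gcongr))
  have hsplit : ENNReal.ofReal (8 ^ q)⁻¹ * I =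
      2 * (ENNReal.ofReal ((4 * 8 ^ q)⁻¹) * I) + ENNReal.ofReal ((2 * 8 ^ q)⁻¹) * I := by
    have h2 : (2 : ENNReal) = ENNReal.ofReal 2 := by simp
    rw [← mul_assoc, ← add_mul, h2, ← ENNReal.ofReal_mul (by norm_num),
      ← ENNReal.ofReal_add (by positivity) (by positivity)]
    congr 2
    field_simp
    norm_num
  rw [hsplit, add_comm, ENNReal.add_le_add_iff_right (by finiteness)] at hfin
  calc I = ENNReal.ofReal (2 * 8 ^ q) * (ENNReal.ofReal ((2 * 8 ^ q)⁻¹) * I) := by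
        rw [← mul_assoc, ← ENNReal.ofReal_mul (by positivity),
          mul_inv_cancel₀ (by positivity)]
        simp
    _ ≤ ENNReal.ofReal (2 * 8 ^ q) *
        (ENNReal.ofReal (16 * M ^ 2 * ρ ^ (2 / a)) * (ENNReal.ofReal (2 * c) * D)) := by gcongr
    _ = _ := by
        rw [← mul_assoc, ← mul_assoc, ← ENNReal.ofReal_mul (by positivity),
          ← ENNReal.ofReal_mul (by positivity), ENNReal.ofNNReal_toNNReal,
          ← ENNReal.ofReal_mul (by positivity)]
        congr 2
        ring

end ImprovedSobolevInequality

section Dilations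

set_option linter.unusedSectionVars false

variable {E F : Type*} [NormedAddCommGroup E] [NormedSpace ℝ E] [MeasurableSpace E] [BorelSpace E]
  [FiniteDimensional ℝ E] [NormedAddCommGroup F] [NormedSpace ℝ F]

/-- The rescaling of `f` by the factor `2 ^ j` around the point `y`, where `d = (j, y)`. -/
def dil (b : ℝ) (d : ℤ × E) (f : E → F) : E → F :=
  fun x => ((2 : ℝ) ^ b) ^ d.1 • f ((2 : ℝ) ^ d.1 • (x - d.2))

/-- The parameter of the composition of two rescalings. -/
def dcomp (d e : ℤ × E) : ℤ × E := (d.1 + e.1, d.2 + (2 : ℝ) ^ (-d.1) • e.2)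

/-- The parameter of the inverse rescaling. -/
def dinv (d : ℤ × E) : ℤ × E := (-d.1, -((2 : ℝ) ^ d.1 • d.2))

theorem dil_dil (b : ℝ) (d e : ℤ × E) (f : E → F) : dil b d (dil b e f) = dil b (dcomp d e) f := by
  funext x
  simp only [dil, dcomp, smul_smul]
  have h2 : (2 : ℝ) ≠ 0 := by norm_num
  rw [zpow_add₀ (by positivity)]
  congr 2
  rw [zpow_add₀ h2, mul_comm, mul_smul, sub_add_eq_sub_sub, smul_sub _ (x - d.2),
    smul_smul ((2 : ℝ) ^ d.1), ← zpow_add₀ h2]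
  simp

theorem dil_zero (b : ℝ) (f : E → F) : dil b (0 : ℤ × E) f = f := by
  funext x; simp [dil]

theorem dcomp_dinv (d : ℤ × E) : dcomp d (dinv d) = 0 := by
  simp only [dcomp, dinv, smul_neg, smul_smul]
  rw [← zpow_add₀ (by norm_num)]
  ext <;> simp

theorem dinv_dcomp (d : ℤ × E) : dcomp (dinv d) d = 0 := by
  simp only [dcomp, dinv, neg_neg]
  ext <;> simp

theorem dil_add (b : ℝ) (d : ℤ × E) (f g : E → F) : dil b d (f + g) = dil b d f + dil b d g := by
  funext x; simp [dil]

theorem dil_const_smul (b : ℝ) (d : ℤ × E) (c : ℝ) (f : E → F) :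
    dil b d (c • f) = c • dil b d f := by
  funext x; simp [dil, smul_comm c]

/-- The change of variables underlying a rescaling. -/
def dilHomeo (d : ℤ × E) : E ≃ₜ E :=
  (Homeomorph.addRight (-d.2)).trans (Homeomorph.smulOfNeZero ((2 : ℝ) ^ d.1) (by positivity))

theorem dilHomeo_apply (d : ℤ × E) (x : E) : dilHomeo d x = (2 : ℝ) ^ d.1 • (x - d.2) := by
  simp [dilHomeo, sub_eq_add_neg]

theorem dil_eq_comp (b : ℝ) (d : ℤ × E) (f : E → F) :
    dil b d f = ((2 : ℝ) ^ b) ^ d.1 • (f ∘ dilHomeo d) := by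
  funext x; simp [dil, dilHomeo_apply]

variable (μ : Measure E) [μ.IsAddHaarMeasure]

theorem map_dilHomeo (d : ℤ × E) :
    μ.map (dilHomeo d) = ENNReal.ofReal (((2 : ℝ) ^ d.1) ^ Module.finrank ℝ E)⁻¹ • μ := by
  have h1 : (dilHomeo d : E → E) = (fun x => (2 : ℝ) ^ d.1 • x) ∘ fun x => x + -d.2 := by
    funext x; simp [dilHomeo_apply, sub_eq_add_neg]
  rw [h1, ← Measure.map_map (by fun_prop) (by fun_prop), map_add_right_eq_self,
    Measure.map_addHaar_smul _ (by positivity), abs_of_pos (by positivity)]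

theorem quasiMeasurePreserving_dilHomeo (d : ℤ × E) :
    Measure.QuasiMeasurePreserving (dilHomeo d) μ μ := by
  refine ⟨(dilHomeo d).measurable, ?_⟩
  rw [map_dilHomeo]
  exact Measure.smul_absolutelyContinuous

variable {μ}

theorem dil_congr_ae (b : ℝ) (d : ℤ × E) {f g : E → F} (h : f =ᵐ[μ] g) :
    dil b d f =ᵐ[μ] dil b d g := by
  rw [dil_eq_comp, dil_eq_comp]
  exact ((quasiMeasurePreserving_dilHomeo μ d).ae_eq_comp h).const_smul _

theorem aestronglyMeasurable_dil (b : ℝ) (d : ℤ × E) {f : E → F} (hf : AEStronglyMeasurable f μ) :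
    AEStronglyMeasurable (dil b d f) μ := by
  rw [dil_eq_comp]
  exact (hf.comp_quasiMeasurePreserving (quasiMeasurePreserving_dilHomeo μ d)).const_smul _

theorem eLpNorm_dil {b : ℝ} {p : ENNReal} (hp0 : p ≠ 0) (hp : p ≠ ⊤)
    (d : ℤ × E) (f : E → F) :
    eLpNorm (dil b d f) p μ =
      ENNReal.ofReal ((2 : ℝ) ^ ((d.1 : ℝ) * (b - Module.finrank ℝ E / p.toReal))) *
        eLpNorm f p μ := by
  have hp0' : 0 < p.toReal := ENNReal.toReal_pos hp0 hp
  rw [dil_eq_comp, eLpNorm_const_smul,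
    ← (dilHomeo d).measurableEmbedding.eLpNorm_map_measure, map_dilHomeo,
    eLpNorm_smul_measure_of_ne_top hp, smul_eq_mul, ← mul_assoc]
  congr 1
  rw [← ofReal_norm, Real.norm_eq_abs, abs_of_pos (by positivity),
    ENNReal.ofReal_rpow_of_pos (by positivity), ← ENNReal.ofReal_mul (by positivity)]
  congr 1
  rw [← Real.rpow_intCast, ← Real.rpow_mul (by norm_num), ← Real.rpow_intCast, ← Real.rpow_natCast,
    ← Real.rpow_mul (by norm_num), ← Real.rpow_neg (by norm_num), ← Real.rpow_mul (by norm_num),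
    ← Real.rpow_add (by norm_num)]
  congr 1
  simp only [ENNReal.toReal_div, ENNReal.toReal_one]
  ring

theorem eLpNorm_dil_of_eq {b : ℝ} {p : ENNReal} (hp0 : p ≠ 0) (hp : p ≠ ⊤)
    (hb : b * p.toReal = Module.finrank ℝ E) (d : ℤ × E) (f : E → F) :
    eLpNorm (dil b d f) p μ = eLpNorm f p μ := by
  have hp0' : p.toReal ≠ 0 := (ENNReal.toReal_pos hp0 hp).ne'
  rw [eLpNorm_dil hp0 hp, ← hb, mul_div_cancel_right₀ _ hp0']
  simp

theorem memLp_dil (b : ℝ) {p : ENNReal} (hp0 : p ≠ 0) (hp : p ≠ ⊤) (d : ℤ × E) {f : E → F}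
    (hf : MemLp f p μ) : MemLp (dil b d f) p μ := by
  refine ⟨aestronglyMeasurable_dil b d hf.1, ?_⟩
  rw [eLpNorm_dil hp0 hp]
  exact ENNReal.mul_lt_top ENNReal.ofReal_lt_top hf.2

/-- Rescaling as an isometry of `Lp`. -/
def dilLp {b : ℝ} {p : ENNReal} [Fact (1 ≤ p)] (hp : p ≠ ⊤)
    (hb : b * p.toReal = Module.finrank ℝ E) (d : ℤ × E) : Lp F p μ →ₗᵢ[ℝ] Lp F p μ where
  toFun f := (memLp_dil b (zero_lt_one.trans_le Fact.out).ne' hp d (Lp.memLp f)).toLp _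
  map_add' f g := by
    rw [← MemLp.toLp_add, MemLp.toLp_eq_toLp_iff, ← dil_add]
    exact dil_congr_ae b d (Lp.coeFn_add f g)
  map_smul' c f := by
    rw [RingHom.id_apply, ← MemLp.toLp_const_smul, MemLp.toLp_eq_toLp_iff, ← dil_const_smul]
    exact dil_congr_ae b d (Lp.coeFn_smul c f)
  norm_map' f := by
    simp only [LinearMap.coe_mk, AddHom.coe_mk]
    rw [Lp.norm_toLp, eLpNorm_dil_of_eq (zero_lt_one.trans_le Fact.out).ne' hp hb, Lp.norm_def]

theorem coeFn_dilLp {b : ℝ} {p : ENNReal} [Fact (1 ≤ p)] (hp : p ≠ ⊤)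
    (hb : b * p.toReal = Module.finrank ℝ E) (d : ℤ × E) (f : Lp F p μ) :
    dilLp hp hb d f =ᵐ[μ] dil b d f :=
  MemLp.coeFn_toLp (memLp_dil b (zero_lt_one.trans_le Fact.out).ne' hp d (Lp.memLp f))

theorem dilLp_dilLp {b : ℝ} {p : ENNReal} [Fact (1 ≤ p)] (hp : p ≠ ⊤)
    (hb : b * p.toReal = Module.finrank ℝ E) (d e : ℤ × E) (f : Lp F p μ) :
    dilLp hp hb d (dilLp hp hb e f) = dilLp hp hb (dcomp d e) f := by
  refine Lp.ext ((coeFn_dilLp hp hb _ _).trans ((dil_congr_ae b d (coeFn_dilLp hp hb e f)).trans ?_))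
  rw [dil_dil]
  exact (coeFn_dilLp hp hb _ _).symm

theorem dilLp_zero {b : ℝ} {p : ENNReal} [Fact (1 ≤ p)] (hp : p ≠ ⊤)
    (hb : b * p.toReal = Module.finrank ℝ E) (f : Lp F p μ) : dilLp hp hb 0 f = f := by
  refine Lp.ext ((coeFn_dilLp hp hb _ _).trans ?_)
  rw [dil_zero]

/-- Rescaling as an isometric equivalence of `Lp`. -/
def dilEquiv {b : ℝ} {p : ENNReal} [Fact (1 ≤ p)] (hp : p ≠ ⊤)
    (hb : b * p.toReal = Module.finrank ℝ E) (d : ℤ × E) : Lp F p μ ≃ₗᵢ[ℝ] Lp F p μ where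
  toLinearEquiv := LinearEquiv.ofLinearMap (dilLp hp hb d).toLinearMap
    (dilLp hp hb (dinv d)).toLinearMap
    (by ext1 f; simp [dilLp_dilLp, dcomp_dinv, dilLp_zero])
    (by ext1 f; simp [dilLp_dilLp, dinv_dcomp, dilLp_zero])
  norm_map' f := (dilLp hp hb d).norm_map f

theorem dilEquiv_apply {b : ℝ} {p : ENNReal} [Fact (1 ≤ p)] (hp : p ≠ ⊤)
    (hb : b * p.toReal = Module.finrank ℝ E) (d : ℤ × E) (f : Lp F p μ) :
    dilEquiv hp hb d f = dilLp hp hb d f := rfl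

theorem dilEquiv_symm_apply {b : ℝ} {p : ENNReal} [Fact (1 ≤ p)] (hp : p ≠ ⊤)
    (hb : b * p.toReal = Module.finrank ℝ E) (d : ℤ × E) (f : Lp F p μ) :
    (dilEquiv hp hb d).symm f = dilLp hp hb (dinv d) f := rfl

end Dilations

section Decoupling

set_option linter.unusedSectionVars false

variable {E F : Type*} [NormedAddCommGroup E] [NormedSpace ℝ E] [MeasurableSpace E] [BorelSpace E]
  [FiniteDimensional ℝ E] [NormedAddCommGroup F] [NormedSpace ℝ F]
  {μ : Measure E} [μ.IsAddHaarMeasure]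

theorem exists_lintegral_closedBall_le (F : Type*) [NormedAddCommGroup F] (μ : Measure E)
    [μ.IsAddHaarMeasure] {p : ENNReal} (hp : 1 ≤ p) (R : ℝ) :
    ∃ K : NNReal, ∀ f : E → F, AEStronglyMeasurable f μ →
      ∫⁻ x in Metric.closedBall 0 R, ‖f x‖ₑ ∂μ ≤ K * eLpNorm f p μ := by
  have hB : μ (Metric.closedBall (0 : E) R) ≠ ⊤ := measure_closedBall_lt_top.ne
  have hexp : 0 ≤ 1 / (1 : ENNReal).toReal - 1 / p.toReal := by
    rcases eq_or_ne p ⊤ with rfl | h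
    · simp
    · have : 1 ≤ p.toReal := ENNReal.toReal_one ▸ ENNReal.toReal_mono h hp
      simp only [ENNReal.toReal_one, div_one, sub_nonneg]
      exact div_le_one_of_le₀ this (by positivity)
  refine ⟨(μ (Metric.closedBall (0 : E) R) ^ (1 / (1 : ENNReal).toReal - 1 / p.toReal)).toNNReal,
    fun f hf => ?_⟩
  rw [ENNReal.coe_toNNReal (ENNReal.rpow_ne_top_of_nonneg hexp hB), ← eLpNorm_one_eq_lintegral_enorm]
  refine (eLpNorm_le_eLpNorm_mul_rpow_measure_univ hp hf.restrict).trans ?_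
  rw [Measure.restrict_apply_univ, mul_comm]
  gcongr
  exact Measure.restrict_le_self

theorem tendsto_ofReal_two_rpow_neg_mul {c : ℝ} (hc : 0 < c) {K : ENNReal} (hK : K ≠ ⊤) :
    Tendsto (fun x : ℝ => ENNReal.ofReal ((2 : ℝ) ^ (-(c * x))) * K) atTop (𝓝 0) := by
  have h1 : Tendsto (fun x : ℝ => (2 : ℝ) ^ (-(c * x))) atTop (𝓝 0) :=
    (tendsto_rpow_atBot_of_base_gt_one 2 (by norm_num)).comp
      (tendsto_neg_atTop_atBot.comp (tendsto_id.const_mul_atTop hc))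
  have h2 := ENNReal.Tendsto.mul_const (ENNReal.tendsto_ofReal h1) (Or.inr hK)
  simpa using h2

theorem tendsto_lintegral_dil_of_continuous {b : ℝ} (hb0 : 0 < b)
    (hbn : b < Module.finrank ℝ E) {ι : Type*} {l : Filter ι} {δ : ι → ℤ × E}
    (hδ : Tendsto (fun k => |((δ k).1 : ℝ)| + (1 + (2 : ℝ) ^ (δ k).1) * ‖(δ k).2‖) l atTop)
    {f : E → F} (hf : Continuous f) (hfc : HasCompactSupport f) (R : ℝ) :
    Tendsto (fun k => ∫⁻ x in Metric.closedBall 0 R, ‖dil b (δ k) f x‖ₑ ∂μ) l (𝓝 0) := by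
  obtain ⟨C, hC⟩ := hf.bounded_above_of_compact_support hfc
  obtain ⟨ρ, hρ⟩ := hfc.isCompact.isBounded.subset_closedBall 0
  have hB : μ (Metric.closedBall (0 : E) R) ≠ ⊤ := measure_closedBall_lt_top.ne
  have hf1 : MemLp f 1 μ := hf.memLp_of_hasCompactSupport hfc
  rw [ENNReal.tendsto_nhds_zero]
  intro ε hε
  have hev1 := (tendsto_ofReal_two_rpow_neg_mul hb0
    (K := ENNReal.ofReal C * μ (Metric.closedBall (0 : E) R)) (by finiteness)).eventually
      (eventually_le_nhds hε)
  have hev2 := (tendsto_ofReal_two_rpow_neg_mul (sub_pos.2 hbn) hf1.2.ne).eventually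
      (eventually_le_nhds hε)
  obtain ⟨L, hL⟩ := eventually_atTop.1 (hev1.and hev2)
  filter_upwards [hδ.eventually_gt_atTop
    (|L| + (1 + (2 : ℝ) ^ |L|) * (|R| + (2 : ℝ) ^ |L| * |ρ|))] with k hk
  rcases le_or_gt L ((δ k).1 : ℝ) with h1 | h1
  · refine le_trans ?_ (hL _ h1).2
    rw [← eLpNorm_one_eq_lintegral_enorm]
    refine (eLpNorm_mono_measure _ Measure.restrict_le_self).trans ?_
    rw [eLpNorm_dil one_ne_zero ENNReal.one_ne_top]
    refine le_of_eq ?_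
    congr 3
    simp only [ENNReal.toReal_one]
    ring
  rcases le_or_gt L (-((δ k).1 : ℝ)) with h2 | h2
  · refine le_trans ?_ (hL _ h2).1
    calc ∫⁻ x in Metric.closedBall 0 R, ‖dil b (δ k) f x‖ₑ ∂μ
        ≤ ∫⁻ x in Metric.closedBall 0 R,
            ENNReal.ofReal ((2 : ℝ) ^ (-(b * -((δ k).1 : ℝ)))) * ENNReal.ofReal C ∂μ := by
          refine lintegral_mono fun x => ?_
          have h3 : ‖((2 : ℝ) ^ b) ^ (δ k).1‖ₑ =
              ENNReal.ofReal ((2 : ℝ) ^ (-(b * -((δ k).1 : ℝ)))) := by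
            rw [← ofReal_norm, Real.norm_eq_abs, abs_of_pos (by positivity), ← Real.rpow_intCast,
              ← Real.rpow_mul (by norm_num)]
            congr 2; ring
          rw [dil, enorm_smul, h3]
          gcongr
          rw [← ofReal_norm]
          exact ENNReal.ofReal_le_ofReal (hC _)
      _ = _ := by rw [lintegral_const, Measure.restrict_apply_univ, mul_assoc]
  · have hLabs : |((δ k).1 : ℝ)| ≤ |L| := by
      rw [abs_le]; constructor <;> linarith [le_abs_self L]
    have h2L : (2 : ℝ) ^ (δ k).1 ≤ (2 : ℝ) ^ |L| := by
      rw [← Real.rpow_intCast]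
      exact Real.rpow_le_rpow_of_exponent_le (by norm_num) ((le_abs_self _).trans hLabs)
    have h2L' : 1 ≤ (2 : ℝ) ^ |L| * (2 : ℝ) ^ (δ k).1 := by
      rw [← Real.rpow_intCast, ← Real.rpow_add (by norm_num)]
      refine Real.one_le_rpow (by norm_num) ?_
      linarith [neg_abs_le ((δ k).1 : ℝ)]
    have hz : |R| + (2 : ℝ) ^ |L| * |ρ| < ‖(δ k).2‖ := by
      by_contra hcon
      push Not at hcon
      refine absurd hk (not_lt.2 ?_)
      gcongr
    refine (le_of_eq ?_).trans zero_le
    rw [setLIntegral_congr_fun (g := fun _ => 0) Metric.isClosed_closedBall.measurableSet,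
      lintegral_zero]
    intro x hx
    have hx' : ‖x‖ ≤ |R| := (mem_closedBall_zero_iff.1 hx).trans (le_abs_self R)
    have hout : f ((2 : ℝ) ^ (δ k).1 • (x - (δ k).2)) = 0 := by
      refine image_eq_zero_of_notMem_tsupport fun hmem => ?_
      have h3 := mem_closedBall_zero_iff.1 (hρ hmem)
      rw [norm_smul, Real.norm_eq_abs, abs_of_pos (by positivity)] at h3
      have h4 : ‖(δ k).2‖ ≤ ‖x‖ + ‖x - (δ k).2‖ := by
        have := norm_sub_norm_le (δ k).2 x
        rw [norm_sub_rev] at this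
        linarith
      have h5 : ‖x - (δ k).2‖ ≤ (2 : ℝ) ^ |L| * |ρ| := by
        calc ‖x - (δ k).2‖ ≤ ((2 : ℝ) ^ |L| * (2 : ℝ) ^ (δ k).1) * ‖x - (δ k).2‖ :=
              le_mul_of_one_le_left (norm_nonneg _) h2L'
          _ = (2 : ℝ) ^ |L| * ((2 : ℝ) ^ (δ k).1 * ‖x - (δ k).2‖) := by ring
          _ ≤ _ := by gcongr; exact h3.trans (le_abs_self ρ)
      linarith
    simp [dil, hout]

/-- Decoupled rescalings of a fixed function vanish locally. -/
theorem tendsto_lintegral_dil {b : ℝ} {p : ENNReal} (hp1 : 1 < p) (hp : p ≠ ⊤) (hb0 : 0 < b)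
    (hb : b * p.toReal = Module.finrank ℝ E) {ι : Type*} {l : Filter ι} {δ : ι → ℤ × E}
    (hδ : Tendsto (fun k => |((δ k).1 : ℝ)| + (1 + (2 : ℝ) ^ (δ k).1) * ‖(δ k).2‖) l atTop)
    {f : E → F} (hf : MemLp f p μ) (R : ℝ) :
    Tendsto (fun k => ∫⁻ x in Metric.closedBall 0 R, ‖dil b (δ k) f x‖ₑ ∂μ) l (𝓝 0) := by
  have hp0 : p ≠ 0 := (zero_lt_one.trans hp1).ne'
  have hp1' : 1 < p.toReal := by
    rw [← ENNReal.toReal_one]; exact (ENNReal.toReal_lt_toReal ENNReal.one_ne_top hp).2 hp1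
  obtain ⟨K, hK⟩ := exists_lintegral_closedBall_le F μ hp1.le R
  rw [ENNReal.tendsto_nhds_zero]
  intro ε hε
  obtain ⟨η, hη0, hη⟩ : ∃ η : ENNReal, η ≠ 0 ∧ K * η ≤ ε / 2 := by
    have h1 : Tendsto (fun η : ENNReal => K * η) (𝓝 0) (𝓝 0) := by
      have := ENNReal.Tendsto.const_mul (a := (K : ENNReal)) (tendsto_id (α := ENNReal) (x := 𝓝 0))
        (Or.inr ENNReal.coe_ne_top)
      simpa using this
    have h2 := (h1.mono_left (nhdsWithin_le_nhds (s := Set.Ioi 0))).eventually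
      (eventually_le_nhds (ENNReal.half_pos hε.ne'))
    obtain ⟨η, h3, h4⟩ := (h2.and self_mem_nhdsWithin).exists
    exact ⟨η, h4.ne', h3⟩
  obtain ⟨g, hgc, hfg, hg, hgp⟩ := hf.exists_hasCompactSupport_eLpNorm_sub_le hp hη0
  have hbn : b < Module.finrank ℝ E := by rw [← hb]; nlinarith
  have h1 := tendsto_lintegral_dil_of_continuous (μ := μ) hb0 hbn hδ hg hgc R
  filter_upwards [h1.eventually (eventually_le_nhds (ENNReal.half_pos hε.ne'))] with k hk
  have hd : dil b (δ k) f = dil b (δ k) (f - g) + dil b (δ k) g := by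
    rw [← dil_add, sub_add_cancel]
  calc ∫⁻ x in Metric.closedBall 0 R, ‖dil b (δ k) f x‖ₑ ∂μ
      ≤ ∫⁻ x in Metric.closedBall 0 R, (‖dil b (δ k) (f - g) x‖ₑ + ‖dil b (δ k) g x‖ₑ) ∂μ := by
        refine lintegral_mono fun x => ?_
        rw [hd]
        exact enorm_add_le _ _
    _ = (∫⁻ x in Metric.closedBall 0 R, ‖dil b (δ k) (f - g) x‖ₑ ∂μ) +
          ∫⁻ x in Metric.closedBall 0 R, ‖dil b (δ k) g x‖ₑ ∂μ :=
        lintegral_add_left' (aestronglyMeasurable_dil b _ (hf.1.sub hgp.1)).restrict.enorm _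
    _ ≤ ε / 2 + ε / 2 := by
        refine add_le_add ((hK _ (aestronglyMeasurable_dil b _ (hf.1.sub hgp.1))).trans ?_) hk
        rw [eLpNorm_dil_of_eq hp0 hp hb]
        exact (mul_le_mul_right hfg _).trans hη
    _ = ε := ENNReal.add_halves ε

/-- The parameter of the rescaling `d'` seen from the rescaling `d`. -/
def relDil (d d' : ℤ × E) : ℤ × E := dcomp (dinv d) d'

theorem relDil_size (d d' : ℤ × E) :
    |((relDil d d').1 : ℝ)| + (1 + (2 : ℝ) ^ (relDil d d').1) * ‖(relDil d d').2‖ =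
      |(d'.1 : ℝ) - d.1| + ((2 : ℝ) ^ d'.1 + (2 : ℝ) ^ d.1) * ‖d.2 - d'.2‖ := by
  simp only [relDil, dcomp, dinv, neg_neg]
  rw [neg_add_eq_sub, neg_add_eq_sub, ← smul_sub, norm_smul, Real.norm_eq_abs,
    abs_of_pos (show (0 : ℝ) < 2 ^ d.1 by positivity), ← mul_assoc, norm_sub_rev, zpow_sub₀ (by norm_num)]
  push_cast
  congr 2
  have : (2 : ℝ) ^ d.1 ≠ 0 := by positivity
  field_simp
  exact add_comm _ _

variable (E) in
/-- Asymptotic decoupling of two sequences of rescalings along a filter. -/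
def Decoupled {ι : Type*} (l : Filter ι) (d d' : ι → ℤ × E) : Prop :=
  Tendsto (fun k => |((d' k).1 : ℝ) - (d k).1| +
    ((2 : ℝ) ^ (d' k).1 + (2 : ℝ) ^ (d k).1) * ‖(d k).2 - (d' k).2‖) l atTop

theorem Decoupled.symm {ι : Type*} {l : Filter ι} {d d' : ι → ℤ × E} (h : Decoupled E l d d') :
    Decoupled E l d' d := by
  refine h.congr fun k => ?_
  rw [abs_sub_comm, norm_sub_rev, add_comm ((2 : ℝ) ^ (d' k).1)]

theorem not_decoupled_self {ι : Type*} {l : Filter ι} [l.NeBot] (d : ι → ℤ × E) :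
    ¬ Decoupled E l d d := by
  intro h
  simp only [Decoupled, sub_self, abs_zero, norm_zero, mul_zero, add_zero] at h
  exact not_tendsto_const_atTop _ _ h

theorem Decoupled.tendsto_relDil {ι : Type*} {l : Filter ι} {d d' : ι → ℤ × E}
    (h : Decoupled E l d d') :
    Tendsto (fun k => |((relDil (d k) (d' k)).1 : ℝ)| + (1 + (2 : ℝ) ^ (relDil (d k) (d' k)).1) *
      ‖(relDil (d k) (d' k)).2‖) l atTop :=
  h.congr fun _ => (relDil_size _ _).symm

theorem enorm_inner_le_mul_lintegral {F : Type*} [NormedAddCommGroup F] [InnerProductSpace ℝ F]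
    {g : E → F} (hg : MemLp g 2 μ) {C R : ℝ} (hC : ∀ x, ‖g x‖ ≤ C)
    (hR : ∀ x, x ∉ Metric.closedBall 0 R → g x = 0) (f : Lp F 2 μ) :
    ‖⟪hg.toLp g, f⟫‖ₑ ≤ ENNReal.ofReal C * ∫⁻ x in Metric.closedBall 0 R, ‖f x‖ₑ ∂μ := by
  rw [L2.inner_def]
  refine (enorm_integral_le_lintegral_enorm _).trans ?_
  rw [← lintegral_const_mul' _ _ ENNReal.ofReal_ne_top,
    ← lintegral_indicator Metric.isClosed_closedBall.measurableSet]
  refine lintegral_mono_ae ?_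
  filter_upwards [hg.coeFn_toLp] with x hx
  rw [hx]
  by_cases h : x ∈ Metric.closedBall (0 : E) R
  · rw [Set.indicator_of_mem h, ← ofReal_norm, ← ofReal_norm, ← ENNReal.ofReal_mul
      ((norm_nonneg _).trans (hC x))]
    refine ENNReal.ofReal_le_ofReal ((norm_inner_le_norm _ _).trans ?_)
    gcongr
    exact hC x
  · rw [hR x h]; simp

theorem tendsto_inner_of_tendsto_lintegral {F : Type*} [NormedAddCommGroup F]
    [InnerProductSpace ℝ F] {ι : Type*} {l : Filter ι} {f : ι → Lp F 2 μ} {C : ℝ}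
    (hC : ∀ k, ‖f k‖ ≤ C)
    (hf : ∀ R : ℝ, Tendsto (fun k => ∫⁻ x in Metric.closedBall 0 R, ‖f k x‖ₑ ∂μ) l (𝓝 0))
    (h : Lp F 2 μ) : Tendsto (fun k => ⟪h, f k⟫) l (𝓝 0) := by
  rw [Metric.tendsto_nhds]
  intro ε hε
  have hC' : 0 < |C| + 1 := by positivity
  obtain ⟨g, hgc, hhg, hg, hgp⟩ := (Lp.memLp h).exists_hasCompactSupport_eLpNorm_sub_le
    (by simp) (ε := ENNReal.ofReal (ε / 2 / (|C| + 1))) (by simpa using by positivity)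
  obtain ⟨M, hM⟩ := hg.bounded_above_of_compact_support hgc
  obtain ⟨R, hR⟩ := hgc.isCompact.isBounded.subset_closedBall 0
  have hM' : Tendsto (fun k => ENNReal.ofReal M * ∫⁻ x in Metric.closedBall 0 R, ‖f k x‖ₑ ∂μ) l
      (𝓝 0) := by
    simpa using ENNReal.Tendsto.const_mul (hf R) (Or.inr (ENNReal.ofReal_ne_top (r := M)))
  filter_upwards [hM'.eventually (gt_mem_nhds (ENNReal.ofReal_pos.2 (half_pos hε)))] with k hk
  have h1 : ‖⟪hgp.toLp g, f k⟫‖ < ε / 2 := by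
    have := (enorm_inner_le_mul_lintegral hgp hM (R := R) (fun x hx => ?_) (f k)).trans_lt hk
    · rw [← ofReal_norm] at this
      exact (ENNReal.ofReal_lt_ofReal_iff (half_pos hε)).1 this
    · exact image_eq_zero_of_notMem_tsupport fun hmem => hx (hR hmem)
  have h2 : ‖h - hgp.toLp g‖ ≤ ε / 2 / (|C| + 1) := by
    rw [Lp.norm_def]
    refine ENNReal.toReal_le_of_le_ofReal (by positivity) (le_trans (le_of_eq ?_) hhg)
    refine eLpNorm_congr_ae ?_
    filter_upwards [Lp.coeFn_sub h (hgp.toLp g), hgp.coeFn_toLp] with x hx hx'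
    rw [hx, Pi.sub_apply, Pi.sub_apply, hx']
  rw [dist_zero_right]
  calc ‖⟪h, f k⟫‖ = ‖⟪h - hgp.toLp g, f k⟫ + ⟪hgp.toLp g, f k⟫‖ := by
        rw [← inner_add_left, sub_add_cancel]
    _ ≤ ‖h - hgp.toLp g‖ * ‖f k‖ + ‖⟪hgp.toLp g, f k⟫‖ :=
        (norm_add_le _ _).trans (add_le_add (norm_inner_le_norm _ _) le_rfl)
    _ < ε / 2 / (|C| + 1) * (|C| + 1) + ε / 2 := by
        refine add_lt_add_of_le_of_lt ?_ h1
        gcongr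
        exact (hC k).trans ((le_abs_self C).trans (by linarith))
    _ = ε := by field_simp; ring

theorem Decoupled.tendsto_inner_dilLp {F : Type*} [NormedAddCommGroup F]
    [InnerProductSpace ℝ F] {ι : Type*} {l : Filter ι} {b : ℝ} (hb0 : 0 < b)
    (hp : (2 : ENNReal) ≠ ⊤) (hb : b * (2 : ENNReal).toReal = Module.finrank ℝ E)
    {d d' : ι → ℤ × E} (hd : Decoupled E l d d') (h h' : Lp F 2 μ) :
    Tendsto (fun k => ⟪dilEquiv hp hb (d k) h, dilEquiv hp hb (d' k) h'⟫) l (𝓝 0) := by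
  have h1 : ∀ k, ⟪dilEquiv hp hb (d k) h, dilEquiv hp hb (d' k) h'⟫ =
      ⟪h, dilLp hp hb (relDil (d k) (d' k)) h'⟫ := by
    intro k
    rw [← (dilEquiv hp hb (d k)).symm.inner_map_map, LinearIsometryEquiv.symm_apply_apply,
      dilEquiv_symm_apply, dilEquiv_apply, dilLp_dilLp]
    rfl
  simp_rw [h1]
  refine tendsto_inner_of_tendsto_lintegral (C := ‖h'‖) (fun k => by simp) (fun R => ?_) h
  refine (tendsto_lintegral_dil (by norm_num) hp hb0 hb hd.tendsto_relDil (Lp.memLp h') R).congr ?_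
  intro k
  refine lintegral_congr_ae (ae_restrict_of_ae ?_)
  filter_upwards [coeFn_dilLp hp hb (relDil (d k) (d' k)) h'] with x hx
  rw [hx]

theorem tendsto_dilLp_translation {F : Type*} [NormedAddCommGroup F] [NormedSpace ℝ F]
    {ι : Type*} {l : Filter ι} {b : ℝ} {p : ENNReal} [Fact (1 ≤ p)] (hp : p ≠ ⊤)
    (hb : b * p.toReal = Module.finrank ℝ E) {z : ι → E} {z₀ : E} (hz : Tendsto z l (𝓝 z₀))
    (h : Lp F p μ) :
    Tendsto (fun k => dilLp hp hb ((0 : ℤ), z k) h) l (𝓝 (dilLp hp hb ((0 : ℤ), z₀) h)) := by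
  let G : C(E, C(E, E)) := ContinuousMap.curry ⟨fun w : E × E => w.2 - w.1, by fun_prop⟩
  have hG : ∀ z, MeasurePreserving (G z) μ μ := fun z => measurePreserving_sub_right μ z
  have h1 : ∀ z, dilLp hp hb ((0 : ℤ), z) h = Lp.compMeasurePreserving (G z) (hG z) h := by
    intro z
    refine Lp.ext ((coeFn_dilLp hp hb _ _).trans ?_)
    refine EventuallyEq.trans ?_ (Lp.coeFn_compMeasurePreserving h (hG z)).symm
    refine ae_of_all _ fun x => ?_
    simp [dil, G]
  simp_rw [h1]
  exact tendsto_const_nhds.compMeasurePreservingLp (hg := (G.continuous.tendsto z₀).comp hz)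
    (fun k => hG (z k)) (hG z₀) hp

theorem Ultrafilter.eventually_eq_of_finite {ι α : Type*} (l : Ultrafilter ι) {f : ι → α}
    {s : Set α} (hs : s.Finite) (h : ∀ᶠ k in l, f k ∈ s) : ∃ a, ∀ᶠ k in l, f k = a := by
  have h1 : s ∈ l.map f := h
  obtain ⟨a, -, ha⟩ := Ultrafilter.eq_pure_of_finite_mem hs h1
  refine ⟨a, ?_⟩
  have : {a} ∈ l.map f := by rw [ha]; exact Set.mem_singleton a
  exact this

theorem exists_tendsto_of_not_decoupled (l : Ultrafilter ℕ) {d d' : ℕ → ℤ × E}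
    (h : ¬ Decoupled E l d d') :
    ∃ (j : ℤ) (z : ℕ → E) (z₀ : E), Tendsto z l (𝓝 z₀) ∧
      ∀ᶠ k in (l : Filter ℕ), relDil (d k) (d' k) = (j, z k) := by
  have h1 : ¬ Tendsto (fun k => |((relDil (d k) (d' k)).1 : ℝ)| +
      (1 + (2 : ℝ) ^ (relDil (d k) (d' k)).1) * ‖(relDil (d k) (d' k)).2‖) l atTop := by
    simp_rw [relDil_size]
    exact h
  rw [tendsto_atTop] at h1
  push Not at h1
  obtain ⟨C, hC'⟩ := h1
  have hj : ∀ᶠ k in (l : Filter ℕ), (relDil (d k) (d' k)).1 ∈ Set.Icc (-⌈C⌉) ⌈C⌉ := by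
    filter_upwards [hC'] with k hk
    have h2 : |((relDil (d k) (d' k)).1 : ℝ)| ≤ C := by
      refine le_trans ?_ hk.le
      exact le_add_of_nonneg_right (by positivity)
    have h3 := abs_le.1 (h2.trans (Int.le_ceil C))
    exact ⟨by exact_mod_cast h3.1, by exact_mod_cast h3.2⟩
  have hz : ∀ᶠ k in (l : Filter ℕ), (relDil (d k) (d' k)).2 ∈ Metric.closedBall (0 : E) C := by
    filter_upwards [hC'] with k hk
    rw [mem_closedBall_zero_iff]
    refine le_trans ?_ hk.le
    refine le_trans ?_ (le_add_of_nonneg_left (abs_nonneg _))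
    exact le_mul_of_one_le_left (norm_nonneg _) (le_add_of_nonneg_right (by positivity))
  obtain ⟨j, hj⟩ := Ultrafilter.eventually_eq_of_finite l (Set.finite_Icc _ _) hj
  obtain ⟨z₀, -, hz₀⟩ := (isCompact_closedBall (0 : E) C).ultrafilter_le_nhds
    (l.map fun k => (relDil (d k) (d' k)).2) (le_principal_iff.2 hz)
  refine ⟨j, fun k => (relDil (d k) (d' k)).2, z₀, hz₀, ?_⟩
  filter_upwards [hj] with k hk
  rw [← hk]

theorem exists_tendsto_dilEquiv_of_not_decoupled {F : Type*} [NormedAddCommGroup F]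
    [NormedSpace ℝ F] (l : Ultrafilter ℕ) {b : ℝ} {p : ENNReal} [Fact (1 ≤ p)] (hp : p ≠ ⊤)
    (hb : b * p.toReal = Module.finrank ℝ E) {d d' : ℕ → ℤ × E} (h : ¬ Decoupled E l d d') :
    ∃ Q : Lp F p μ ≃ₗᵢ[ℝ] Lp F p μ, ∀ f,
      Tendsto (fun k => (dilEquiv hp hb (d' k)).symm (dilEquiv hp hb (d k) f)) l (𝓝 (Q f)) := by
  obtain ⟨j, z, z₀, hz, hev⟩ := exists_tendsto_of_not_decoupled l (fun h' => h h'.symm)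
  refine ⟨dilEquiv hp hb (j, z₀), fun f => ?_⟩
  have hsplit : ∀ z : E, dilLp hp hb (j, z) f =
      dilLp hp hb ((0 : ℤ), z) (dilLp hp hb (j, (0 : E)) f) := by
    intro z
    rw [dilLp_dilLp]
    simp [dcomp]
  rw [dilEquiv_apply, hsplit]
  refine (tendsto_dilLp_translation hp hb hz _).congr' ?_
  filter_upwards [hev] with k hk
  rw [← hsplit, dilEquiv_symm_apply, dilEquiv_apply, dilLp_dilLp, ← hk]
  rfl

end Decoupling

section SobolevExtension

set_option linter.unusedSectionVars false

variable {E : Type*} [NormedAddCommGroup E] [InnerProductSpace ℝ E] [MeasurableSpace E]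
  [BorelSpace E] [FiniteDimensional ℝ E] {μ : Measure E} [μ.IsAddHaarMeasure]

variable (E) in
/-- Smooth compactly supported real functions. -/
def testFun : Submodule ℝ (E → ℝ) where
  carrier := {v | ContDiff ℝ (⊤ : ℕ∞) v ∧ HasCompactSupport v}
  add_mem' hf hg := ⟨hf.1.add hg.1, hf.2.add hg.2⟩
  zero_mem' := ⟨contDiff_const, HasCompactSupport.zero⟩
  smul_mem' c _ hf := ⟨hf.1.const_smul c, hf.2.smul_left (f := fun _ => c)⟩

theorem continuous_gradient {v : E → ℝ} (hv : ContDiff ℝ (⊤ : ℕ∞) v) : Continuous (gradient v) :=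
  (InnerProductSpace.toDual ℝ E).symm.continuous.comp (hv.continuous_fderiv (by simp))

theorem hasCompactSupport_gradient {v : E → ℝ} (hv : HasCompactSupport v) :
    HasCompactSupport (gradient v) :=
  (hv.fderiv (𝕜 := ℝ)).comp_left (g := (InnerProductSpace.toDual ℝ E).symm) (map_zero _)

theorem memLp_gradient {v : E → ℝ} (hv : v ∈ testFun E) : MemLp (gradient v) 2 μ :=
  (continuous_gradient hv.1).memLp_of_hasCompactSupport (hasCompactSupport_gradient hv.2)

theorem memLp_testFun {v : E → ℝ} (hv : v ∈ testFun E) (p : ENNReal) : MemLp v p μ :=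
  hv.1.continuous.memLp_of_hasCompactSupport hv.2

theorem norm_gradient (v : E → ℝ) (x : E) : ‖gradient v x‖ = ‖fderiv ℝ v x‖ :=
  (InnerProductSpace.toDual ℝ E).symm.norm_map _

variable (μ) in
/-- The gradient of a test function as an element of `L²`. -/
def gradLp : testFun E →ₗ[ℝ] Lp E 2 μ where
  toFun v := (memLp_gradient v.2).toLp _
  map_add' v w := by
    rw [← MemLp.toLp_add]
    congr 1
    funext x
    simp only [gradient, Submodule.coe_add, Pi.add_apply]
    rw [fderiv_add (v.2.1.differentiable (by simp) x) (w.2.1.differentiable (by simp) x), map_add]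
  map_smul' c v := by
    rw [RingHom.id_apply, ← MemLp.toLp_const_smul]
    congr 1
    funext x
    simp only [gradient, Submodule.coe_smul, Pi.smul_apply]
    rw [fderiv_const_smul (v.2.1.differentiable (by simp) x), map_smul]

variable (μ) in
/-- A test function as an element of `Lᵖ`. -/
def valLp (p : ENNReal) [Fact (1 ≤ p)] : testFun E →ₗ[ℝ] Lp ℝ p μ where
  toFun v := (memLp_testFun v.2 p).toLp _
  map_add' v w := MemLp.toLp_add (memLp_testFun v.2 p) (memLp_testFun w.2 p)
  map_smul' c v := MemLp.toLp_const_smul c (memLp_testFun v.2 p)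

theorem coeFn_gradLp (v : testFun E) : gradLp μ v =ᵐ[μ] gradient (v : E → ℝ) :=
  MemLp.coeFn_toLp (memLp_gradient v.2)

theorem coeFn_valLp (p : ENNReal) [Fact (1 ≤ p)] (v : testFun E) : valLp μ p v =ᵐ[μ] v :=
  MemLp.coeFn_toLp (memLp_testFun v.2 p)

theorem ofReal_norm_gradLp (v : testFun E) :
    ENNReal.ofReal ‖gradLp μ v‖ = eLpNorm (fderiv ℝ (v : E → ℝ)) 2 μ := by
  rw [gradLp, LinearMap.coe_mk, AddHom.coe_mk, Lp.norm_toLp,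
    ENNReal.ofReal_toReal (memLp_gradient v.2).2.ne]
  exact eLpNorm_congr_norm_ae (ae_of_all _ fun x => norm_gradient _ x)

theorem norm_valLp (p : ENNReal) [Fact (1 ≤ p)] (v : testFun E) :
    ‖valLp μ p v‖ = (eLpNorm (v : E → ℝ) p μ).toReal :=
  Lp.norm_toLp _ (memLp_testFun v.2 p)

theorem exists_norm_valLp_le {p : ENNReal} [Fact (1 ≤ p)] (hp : p ≠ ⊤) {a : ℝ} (ha : 0 < a)
    (hn : (Module.finrank ℝ E : ℝ) = 2 * a + 2) (hpa : p.toReal = 2 + 2 / a) :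
    ∃ C, ∀ v : testFun E, ‖valLp μ p v‖ ≤ C * ‖gradLp μ v‖ := by
  have h2 : ((2 : NNReal) : ENNReal) = 2 := rfl
  have hpn : ((p.toNNReal : NNReal) : ENNReal) = p := ENNReal.coe_toNNReal hp
  have hpr : ((p.toNNReal : NNReal) : ℝ) = 2 + 2 / a := hpa
  refine ⟨((eLpNormLESNormFDerivOfEqInnerConst μ (2 : NNReal) : NNReal) : ℝ), fun v => ?_⟩
  have h := eLpNorm_le_eLpNorm_fderiv_of_eq_inner μ (u := (v : E → ℝ)) (p := 2) (p' := p.toNNReal)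
    (v.2.1.of_le (by simp)) v.2.2 (by norm_num) (by
      rw [← Nat.cast_pos (α := ℝ), hn]; positivity) (by
      rw [hpr, hn]; push_cast; field_simp; ring)
  rw [hpn, h2, ← ofReal_norm_gradLp] at h
  rw [norm_valLp]
  refine ENNReal.toReal_le_of_le_ofReal (by positivity) (h.trans (le_of_eq ?_))
  rw [ENNReal.ofReal_mul (by positivity), ENNReal.ofReal_coe_nnreal]

/-- The Sobolev embedding, extended by zero to the orthogonal complement of the gradients. -/
theorem exists_sobolev_extension {p : ENNReal} [Fact (1 ≤ p)] (hp : p ≠ ⊤) {a : ℝ} (ha : 0 < a)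
    (hn : (Module.finrank ℝ E : ℝ) = 2 * a + 2) (hpa : p.toReal = 2 + 2 / a) :
    ∃ S : Lp E 2 μ →L[ℝ] Lp ℝ p μ, ∀ v, S (gradLp μ v) = valLp μ p v := by
  obtain ⟨C, hC⟩ := exists_norm_valLp_le (μ := μ) hp ha hn hpa
  let G : Submodule ℝ (Lp E 2 μ) := (LinearMap.range (gradLp μ)).topologicalClosure
  have : CompleteSpace G :=
    (Submodule.isClosed_topologicalClosure (LinearMap.range (gradLp μ))).completeSpace_coe
  have hG : ∀ v, gradLp μ v ∈ G :=
    fun v => Submodule.le_topologicalClosure _ (LinearMap.mem_range_self _ v)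
  let e : testFun E →ₗ[ℝ] G := (gradLp μ).codRestrict G hG
  have hdense : DenseRange e := by
    intro g
    rw [Metric.mem_closure_range_iff]
    intro ε hε
    obtain ⟨w, ⟨v, rfl⟩, hv⟩ := Metric.mem_closure_iff.1
      (show (g : Lp E 2 μ) ∈ closure (LinearMap.range (gradLp μ) : Set (Lp E 2 μ)) from g.2) ε hε
    exact ⟨v, hv⟩
  let S₀ : G →L[ℝ] Lp ℝ p μ := (valLp μ p).extendOfNorm e
  refine ⟨S₀.comp (G.orthogonalProjectionOnto), fun v => ?_⟩
  have h1 : G.orthogonalProjectionOnto (gradLp μ v) = e v :=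
    Submodule.orthogonalProjectionOnto_mem_subspace_eq_self (K := G) (e v)
  rw [ContinuousLinearMap.comp_apply, h1]
  exact LinearMap.extendOfNorm_eq hdense ⟨C, hC⟩ v

end SobolevExtension

section GradientSpace

set_option linter.unusedSectionVars false

variable {E : Type*} [NormedAddCommGroup E] [InnerProductSpace ℝ E] [MeasurableSpace E]
  [BorelSpace E] [FiniteDimensional ℝ E] {μ : Measure E} [μ.IsAddHaarMeasure]

theorem dil_mem_testFun (b : ℝ) (d : ℤ × E) {v : E → ℝ} (hv : v ∈ testFun E) :
    dil b d v ∈ testFun E := by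
  constructor
  · have h1 : ContDiff ℝ (⊤ : ℕ∞) fun x : E => (2 : ℝ) ^ d.1 • (x - d.2) := by fun_prop
    exact (hv.1.comp h1).const_smul _
  · rw [dil_eq_comp]
    exact (hv.2.comp_homeomorph (dilHomeo d)).smul_left (f := fun _ => ((2 : ℝ) ^ b) ^ d.1)

theorem gradient_dil (a : ℝ) (d : ℤ × E) {v : E → ℝ} (hv : v ∈ testFun E) :
    gradient (dil a d v) = dil (a + 1) d (gradient v) := by
  funext x
  have h1 : HasFDerivAt (fun x : E => (2 : ℝ) ^ d.1 • (x - d.2))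
      ((2 : ℝ) ^ d.1 • ContinuousLinearMap.id ℝ E) x :=
    ((hasFDerivAt_id x).sub_const d.2).const_smul _
  have h2 := (hv.1.differentiable (by simp) ((2 : ℝ) ^ d.1 • (x - d.2))).hasFDerivAt
  have h3 := ((h2.comp x h1).const_smul (((2 : ℝ) ^ a) ^ d.1)).fderiv
  have h4 : fderiv ℝ (dil a d v) x = (((2 : ℝ) ^ a) ^ d.1 * (2 : ℝ) ^ d.1) •
      fderiv ℝ v ((2 : ℝ) ^ d.1 • (x - d.2)) := by
    refine h3.trans ?_
    ext z
    simp [mul_assoc]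
  simp only [gradient, dil]
  rw [h4, map_smul, Real.rpow_add (by norm_num), Real.rpow_one, mul_zpow]

/-- Rescaling of test functions. -/
def dilTest (b : ℝ) (d : ℤ × E) (v : testFun E) : testFun E := ⟨dil b d v, dil_mem_testFun b d v.2⟩

theorem dilLp_gradLp {a : ℝ} (h2 : (2 : ENNReal) ≠ ⊤)
    (hb : (a + 1) * (2 : ENNReal).toReal = Module.finrank ℝ E) (d : ℤ × E) (v : testFun E) :
    dilLp h2 hb d (gradLp μ v) = gradLp μ (dilTest a d v) := by
  refine Lp.ext ((coeFn_dilLp h2 hb _ _).trans ((dil_congr_ae _ d (coeFn_gradLp v)).trans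
    (EventuallyEq.trans ?_ (coeFn_gradLp _).symm)))
  rw [← gradient_dil a d v.2]
  rfl

theorem dilLp_valLp {a : ℝ} {p : ENNReal} [Fact (1 ≤ p)] (hp : p ≠ ⊤)
    (hb : a * p.toReal = Module.finrank ℝ E) (d : ℤ × E) (v : testFun E) :
    dilLp hp hb d (valLp μ p v) = valLp μ p (dilTest a d v) :=
  Lp.ext ((coeFn_dilLp hp hb _ _).trans ((dil_congr_ae _ d (coeFn_valLp p v)).trans
    (coeFn_valLp p (dilTest a d v)).symm))

variable (μ) in
/-- The closure in `L²` of the gradients of test functions. -/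
def gradSpace : Submodule ℝ (Lp E 2 μ) := (LinearMap.range (gradLp μ)).topologicalClosure

theorem gradLp_mem_gradSpace (v : testFun E) : gradLp μ v ∈ gradSpace μ :=
  Submodule.le_topologicalClosure _ (LinearMap.mem_range_self _ v)

theorem isClosed_gradSpace : IsClosed (gradSpace μ : Set (Lp E 2 μ)) :=
  Submodule.isClosed_topologicalClosure _

theorem exists_tendsto_gradLp {g : Lp E 2 μ} (hg : g ∈ gradSpace μ) :
    ∃ v : ℕ → testFun E, Tendsto (fun n => gradLp μ (v n)) atTop (𝓝 g) := by
  obtain ⟨f, hf, hfg⟩ := mem_closure_iff_seq_limit.1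
    (show g ∈ closure (LinearMap.range (gradLp μ) : Set (Lp E 2 μ)) from hg)
  choose v hv using hf
  exact ⟨v, by simpa only [hv] using hfg⟩

theorem dilLp_mem_gradSpace {a : ℝ} (h2 : (2 : ENNReal) ≠ ⊤)
    (hb : (a + 1) * (2 : ENNReal).toReal = Module.finrank ℝ E) (d : ℤ × E) {g : Lp E 2 μ}
    (hg : g ∈ gradSpace μ) : dilLp h2 hb d g ∈ gradSpace μ := by
  obtain ⟨v, hv⟩ := exists_tendsto_gradLp hg
  refine isClosed_gradSpace.mem_of_tendsto (((dilLp h2 hb d).continuous.tendsto g).comp hv)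
    (Eventually.of_forall fun n => ?_)
  rw [Function.comp_apply, dilLp_gradLp]
  exact gradLp_mem_gradSpace _

theorem sobolev_dilLp {a : ℝ} {p : ENNReal} [Fact (1 ≤ p)] (hp : p ≠ ⊤)
    (hb : a * p.toReal = Module.finrank ℝ E) (h2 : (2 : ENNReal) ≠ ⊤)
    (hb2 : (a + 1) * (2 : ENNReal).toReal = Module.finrank ℝ E)
    {S : Lp E 2 μ →L[ℝ] Lp ℝ p μ} (hS : ∀ v, S (gradLp μ v) = valLp μ p v) (d : ℤ × E)
    {g : Lp E 2 μ} (hg : g ∈ gradSpace μ) :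
    S (dilLp h2 hb2 d g) = dilLp hp hb d (S g) := by
  obtain ⟨v, hv⟩ := exists_tendsto_gradLp hg
  have h1 := ((S.continuous.comp (dilLp h2 hb2 d).continuous).tendsto g).comp hv
  have h3 := (((dilLp hp hb d).continuous.comp S.continuous).tendsto g).comp hv
  refine tendsto_nhds_unique h1 (h3.congr fun n => ?_)
  simp only [Function.comp_apply, hS, dilLp_gradLp, dilLp_valLp]

theorem mem_gradSpace_of_weakTendsto {ι : Type*} {l : Filter ι} [l.NeBot] {g : ι → Lp E 2 μ}
    {w : Lp E 2 μ} (hg : ∀ k, g k ∈ gradSpace μ) (hw : WeakTendsto l g w) : w ∈ gradSpace μ := by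
  have : CompleteSpace (gradSpace μ) := isClosed_gradSpace.completeSpace_coe
  rw [← Submodule.orthogonal_orthogonal (gradSpace μ), Submodule.mem_orthogonal]
  intro h hh
  have h1 := hw h
  refine tendsto_nhds_unique h1 (tendsto_const_nhds.congr fun k => ?_)
  exact (Submodule.mem_orthogonal' _ _ |>.1 hh _ (hg k)).symm

theorem exists_integral_smul (F : Type*) [NormedAddCommGroup F] [NormedSpace ℝ F] [CompleteSpace F]
    {p : ENNReal} [Fact (1 ≤ p)] {ψ : E → ℝ} (hψ : AEStronglyMeasurable ψ μ) {C R : ℝ}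
    (hC : ∀ x, ‖ψ x‖ ≤ C) (hR : ∀ x, x ∉ Metric.closedBall 0 R → ψ x = 0) :
    ∃ L : Lp F p μ →L[ℝ] F, ∀ f, Integrable (fun x => ψ x • f x) μ ∧ L f = ∫ x, ψ x • f x ∂μ := by
  obtain ⟨K, hK⟩ := exists_lintegral_closedBall_le F μ (p := p) Fact.out R
  have hle : ∀ f : Lp F p μ, ∫⁻ x, ‖ψ x • f x‖ₑ ∂μ ≤ ENNReal.ofReal (C * (K * ‖f‖)) := by
    intro f
    have hC0 : 0 ≤ C := (norm_nonneg _).trans (hC 0)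
    rw [ENNReal.ofReal_mul hC0, ENNReal.ofReal_mul K.coe_nonneg, ENNReal.ofReal_coe_nnreal, ofReal_norm,
      Lp.enorm_def]
    refine le_trans ?_ (mul_le_mul_right (hK f (Lp.aestronglyMeasurable f)) _)
    rw [← lintegral_const_mul' _ _ ENNReal.ofReal_ne_top,
      ← lintegral_indicator Metric.isClosed_closedBall.measurableSet]
    refine lintegral_mono fun x => ?_
    by_cases hx : x ∈ Metric.closedBall (0 : E) R
    · rw [Set.indicator_of_mem hx, enorm_smul]
      refine mul_le_mul_left ?_ _
      rw [← ofReal_norm]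
      exact ENNReal.ofReal_le_ofReal (hC x)
    · simp [hR x hx]
  have hint : ∀ f : Lp F p μ, Integrable (fun x => ψ x • f x) μ := fun f =>
    ⟨hψ.smul (Lp.aestronglyMeasurable f), (hle f).trans_lt ENNReal.ofReal_lt_top⟩
  let L : Lp F p μ →ₗ[ℝ] F :=
    { toFun := fun f => ∫ x, ψ x • f x ∂μ
      map_add' := fun f g => by
        rw [← integral_add (hint f) (hint g)]
        refine integral_congr_ae ?_
        filter_upwards [Lp.coeFn_add f g] with x hx
        rw [hx, Pi.add_apply, smul_add]
      map_smul' := fun c f => by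
        rw [RingHom.id_apply, ← integral_smul]
        refine integral_congr_ae ?_
        filter_upwards [Lp.coeFn_smul c f] with x hx
        rw [hx, Pi.smul_apply, smul_comm] }
  refine ⟨L.mkContinuous (C * K) fun f => ?_, fun f => ⟨hint f, rfl⟩⟩
  have hC0 : 0 ≤ C := (norm_nonneg _).trans (hC 0)
  have h1 := (enorm_integral_le_lintegral_enorm (μ := μ) fun x => ψ x • f x).trans (hle f)
  rw [← ofReal_norm, ENNReal.ofReal_le_ofReal_iff (by positivity), ← mul_assoc] at h1
  exact h1

theorem exists_bound_of_hasCompactSupport {ψ : E → ℝ} (hψ : Continuous ψ)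
    (hψc : HasCompactSupport ψ) :
    ∃ C R : ℝ, (∀ x, ‖ψ x‖ ≤ C) ∧ ∀ x, x ∉ Metric.closedBall 0 R → ψ x = 0 := by
  obtain ⟨C, hC⟩ := hψ.bounded_above_of_compact_support hψc
  obtain ⟨R, hR⟩ := hψc.isCompact.isBounded.subset_closedBall 0
  exact ⟨C, R, hC, fun x hx => image_eq_zero_of_notMem_tsupport fun h => hx (hR h)⟩

theorem integral_sobolev_mul_fderiv {p : ENNReal} [Fact (1 ≤ p)]
    {S : Lp E 2 μ →L[ℝ] Lp ℝ p μ} (hS : ∀ v, S (gradLp μ v) = valLp μ p v) {g : Lp E 2 μ}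
    (hg : g ∈ gradSpace μ) {φ : E → ℝ} (hφ : φ ∈ testFun E) (e : E) :
    ∫ x, S g x * fderiv ℝ φ x e ∂μ = -∫ x, ⟪e, g x⟫ * φ x ∂μ := by
  have hdc : Continuous fun x => fderiv ℝ φ x e :=
    (hφ.1.continuous_fderiv (by simp)).clm_apply continuous_const
  have hds : HasCompactSupport fun x => fderiv ℝ φ x e := hφ.2.fderiv_apply (𝕜 := ℝ) e
  obtain ⟨C₁, R₁, hC₁, hR₁⟩ := exists_bound_of_hasCompactSupport hdc hds
  obtain ⟨C₂, R₂, hC₂, hR₂⟩ := exists_bound_of_hasCompactSupport hφ.1.continuous hφ.2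
  obtain ⟨L₁, hL₁⟩ := exists_integral_smul ℝ (p := p) (μ := μ) hdc.aestronglyMeasurable hC₁ hR₁
  obtain ⟨L₂, hL₂⟩ := exists_integral_smul E (p := 2) (μ := μ)
    hφ.1.continuous.aestronglyMeasurable hC₂ hR₂
  have hL₂' : ∀ f : Lp E 2 μ, ⟪e, L₂ f⟫ = ∫ x, ⟪e, f x⟫ * φ x ∂μ := by
    intro f
    rw [(hL₂ f).2, ← integral_inner (hL₂ f).1]
    refine integral_congr_ae (ae_of_all _ fun x => ?_)
    simp only [real_inner_smul_right, mul_comm]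
  have hL₁' : ∀ f : Lp ℝ p μ, L₁ f = ∫ x, f x * fderiv ℝ φ x e ∂μ := by
    intro f
    rw [(hL₁ f).2]
    refine integral_congr_ae (ae_of_all _ fun x => ?_)
    simp only [smul_eq_mul, mul_comm]
  rw [← hL₁', ← hL₂']
  obtain ⟨v, hv⟩ := exists_tendsto_gradLp hg
  have h1 := ((L₁.continuous.comp S.continuous).tendsto g).comp hv
  have hc : Continuous fun g => -⟪e, L₂ g⟫ := (continuous_const.inner L₂.continuous).neg
  have h2 := (hc.tendsto g).comp hv
  refine tendsto_nhds_unique h1 (h2.congr fun n => ?_)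
  simp only [Function.comp_apply, hS, hL₁', hL₂']
  have hvc := (v n).2.1.continuous
  have hvd : Continuous fun x => fderiv ℝ (v n : E → ℝ) x e :=
    ((v n).2.1.continuous_fderiv (by simp)).clm_apply continuous_const
  have h3 := integral_mul_fderiv_eq_neg_fderiv_mul_of_integrable (μ := μ) (v := e)
    (f := (v n : E → ℝ)) (g := φ)
    ((hvd.mul hφ.1.continuous).integrable_of_hasCompactSupport hφ.2.mul_left)
    ((hvc.mul hdc).integrable_of_hasCompactSupport hds.mul_left)
    ((hvc.mul hφ.1.continuous).integrable_of_hasCompactSupport hφ.2.mul_left)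
    (fun x _ => (v n).2.1.differentiable (by simp) x) (fun x _ => hφ.1.differentiable (by simp) x)
  have h4 : ∫ x, valLp μ p (v n) x * fderiv ℝ φ x e ∂μ =
      ∫ x, (v n : E → ℝ) x * fderiv ℝ φ x e ∂μ := by
    refine integral_congr_ae ?_
    filter_upwards [coeFn_valLp (μ := μ) p (v n)] with x hx
    rw [hx]
  rw [h4, h3]
  congr 1
  refine integral_congr_ae ?_
  filter_upwards [coeFn_gradLp (μ := μ) (v n)] with x hx
  rw [hx, real_inner_comm, gradient, InnerProductSpace.toDual_symm_apply]

/-- The improved Sobolev inequality on the closure of the gradients: smallness of the pairings of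
all rescalings with a suitable fixed element gives smallness in the critical Lebesgue norm. -/
theorem exists_norm_sobolev_rpow_le {p : ENNReal} [Fact (1 ≤ p)] (hp : p ≠ ⊤) {a : ℝ} (ha : 0 < a)
    (hpa : p.toReal = 2 + 2 / a) (h2 : (2 : ENNReal) ≠ ⊤)
    (hb2 : (a + 1) * (2 : ENNReal).toReal = Module.finrank ℝ E)
    {S : Lp E 2 μ →L[ℝ] Lp ℝ p μ} (hS : ∀ v, S (gradLp μ v) = valLp μ p v) :
    ∃ (φ : Lp E 2 μ) (K : NNReal), ∀ g ∈ gradSpace μ, ∀ ρ : ℝ, 0 < ρ →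
      (∀ d, |⟪φ, (dilEquiv h2 hb2 d).symm g⟫| ≤ ρ) →
      ‖S g‖ ^ (2 + 2 / a) ≤ K * ρ ^ (2 / a) * ‖g‖ ^ 2 := by
  set B := Metric.closedBall (0 : E) 1 with hB
  have hB0 : μ B ≠ 0 := (Metric.measure_closedBall_pos μ 0 one_pos).ne'
  have hBt : μ B ≠ ⊤ := measure_closedBall_lt_top.ne
  let ψ : E → ℝ := B.indicator fun _ => (μ.real B)⁻¹
  have hψm : AEStronglyMeasurable ψ μ :=
    (stronglyMeasurable_const.indicator Metric.isClosed_closedBall.measurableSet).aestronglyMeasurable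
  obtain ⟨L, hL⟩ := exists_integral_smul ℝ (p := p) hψm (C := (μ.real B)⁻¹) (R := 1)
    (fun x => by
      simp only [ψ, Set.indicator]
      split_ifs
      · rw [Real.norm_of_nonneg (by positivity)]
      · rw [norm_zero]; positivity) (fun x hx => Set.indicator_of_notMem hx _)
  let ν : Measure E := (μ B)⁻¹ • μ.restrict B
  have hν : IsProbabilityMeasure ν := ⟨by simp [ν, ENNReal.inv_mul_cancel hB0 hBt]⟩
  have hν1 : ∀ᵐ h ∂ν, ‖h‖ ≤ 1 := by
    refine Measure.ae_smul_measure ?_ _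
    filter_upwards [ae_restrict_mem Metric.isClosed_closedBall.measurableSet] with x hx
    simpa [hB] using hx
  have hνint : ∀ f : E → ℝ, ∫ x, f x ∂ν = ∫ x, ψ x • f x ∂μ := by
    intro f
    have h1 : (fun x => ψ x • f x) = B.indicator fun x => (μ.real B)⁻¹ • f x := by
      funext x
      by_cases hx : x ∈ B <;> simp [ψ, hx]
    rw [h1, integral_indicator Metric.isClosed_closedBall.measurableSet, integral_smul,
      integral_smul_measure, ENNReal.toReal_inv, Measure.real]
  obtain ⟨K, hK⟩ := exists_lintegral_rpow_le_of_average_le μ ha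
  let φ : Lp E 2 μ := (InnerProductSpace.toDual ℝ (Lp E 2 μ)).symm (L.comp S)
  have hφ : ∀ g, ⟪φ, g⟫ = L (S g) := fun g => InnerProductSpace.toDual_symm_apply
  have hsm : ∀ (v : testFun E) (ρ : ℝ), 0 < ρ →
      (∀ d, |⟪φ, (dilEquiv h2 hb2 d).symm (gradLp μ v)⟫| ≤ ρ) →
      ‖S (gradLp μ v)‖ ^ (2 + 2 / a) ≤ K * ρ ^ (2 / a) * ‖gradLp μ v‖ ^ 2 := by
    intro v ρ hρ h
    have h1 := hK v ν ρ (v.2.1.of_le (by simp)) v.2.2 hν hν1 hρ (fun j y => by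
      have h3 := h (j, y)
      rw [dilEquiv_symm_apply, dilLp_gradLp, hφ, hS, (hL _).2] at h3
      have h4 : ∫ x, ψ x • valLp μ p (dilTest a (dinv (j, y)) v) x ∂μ =
          ((2 : ℝ) ^ a) ^ (-j) * ∫ x, (v : E → ℝ) (y + (2 : ℝ) ^ (-j) • x) ∂ν := by
        rw [hνint, ← integral_const_mul]
        refine integral_congr_ae ?_
        filter_upwards [coeFn_valLp (μ := μ) p (dilTest a (dinv (j, y)) v)] with x hx
        rw [hx]
        simp only [dilTest, dil, dinv, smul_eq_mul, sub_neg_eq_add, smul_add, smul_smul]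
        rw [← zpow_add₀ (by norm_num), neg_add_cancel, zpow_zero, one_smul, add_comm y]
        ring
      rw [h4, abs_mul, abs_of_pos (by positivity), zpow_neg, inv_mul_le_iff₀ (by positivity)] at h3
      rw [mul_comm ρ]
      exact h3)
    have hp0 : p ≠ 0 := (zero_lt_one.trans_le Fact.out).ne'
    have h5 : ENNReal.ofReal (‖S (gradLp μ v)‖ ^ (2 + 2 / a)) =
        ∫⁻ x, ‖(v : E → ℝ) x‖ₑ ^ (2 + 2 / a) ∂μ := by
      rw [← ENNReal.ofReal_rpow_of_nonneg (norm_nonneg _) (by positivity), hS, norm_valLp,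
        ENNReal.ofReal_toReal (memLp_testFun v.2 p).2.ne,
        eLpNorm_eq_lintegral_rpow_enorm_toReal hp0 hp, hpa, ← ENNReal.rpow_mul,
        one_div_mul_cancel (by positivity), ENNReal.rpow_one]
    have h6 : ENNReal.ofReal (‖gradLp μ v‖ ^ 2) = ∫⁻ x, ‖fderiv ℝ (v : E → ℝ) x‖ₑ ^ 2 ∂μ := by
      rw [ENNReal.ofReal_pow (norm_nonneg _), ofReal_norm_gradLp,
        eLpNorm_eq_lintegral_rpow_enorm_toReal two_ne_zero h2, ← ENNReal.rpow_natCast,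
        ← ENNReal.rpow_mul]
      simp
    rw [← h5, ← h6, ← ENNReal.ofReal_coe_nnreal, ← ENNReal.ofReal_mul K.coe_nonneg,
      ← ENNReal.ofReal_mul (by positivity), ENNReal.ofReal_le_ofReal_iff (by positivity)] at h1
    exact h1
  refine ⟨φ, K, fun g hg ρ hρ h => ?_⟩
  obtain ⟨v, hv⟩ := exists_tendsto_gradLp hg
  have h1 : Tendsto (fun n => ‖S (gradLp μ (v n))‖ ^ (2 + 2 / a)) atTop (𝓝 (‖S g‖ ^ (2 + 2 / a))) :=
    (((S.continuous.norm).tendsto g).comp hv).rpow_const (Or.inr (by positivity))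
  have h3 : Tendsto (fun n => ρ + ‖φ‖ * ‖gradLp μ (v n) - g‖) atTop (𝓝 ρ) := by
    simpa using ((tendsto_iff_norm_sub_tendsto_zero.1 hv).const_mul ‖φ‖).const_add ρ
  have h4 := (((h3.rpow_const (p := 2 / a) (Or.inr (by positivity))).const_mul (K : ℝ)).mul
    (((continuous_norm.tendsto g).comp hv).pow 2))
  refine le_of_tendsto_of_tendsto' h1 h4 fun n => hsm (v n) _ (by positivity) fun d => ?_
  have h5 : (dilEquiv h2 hb2 d).symm (gradLp μ (v n)) = (dilEquiv h2 hb2 d).symm g +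
      (dilEquiv h2 hb2 d).symm (gradLp μ (v n) - g) := by
    rw [← map_add, add_sub_cancel]
  rw [h5, inner_add_right]
  refine (abs_add_le _ _).trans (add_le_add (h d) ((abs_real_inner_le_norm _ _).trans_eq ?_))
  rw [LinearIsometryEquiv.norm_map (dilEquiv h2 hb2 d).symm]

end GradientSpace

section Concentration

set_option linter.unusedSectionVars false

theorem WeakTendsto.apply {H : Type*} [NormedAddCommGroup H] [InnerProductSpace ℝ H]
    [CompleteSpace H] {ι : Type*} {l : Filter ι} {v : ι → H} {w : H} (h : WeakTendsto l v w)
    (Λ : H →L[ℝ] ℝ) : Tendsto (fun k => Λ (v k)) l (𝓝 (Λ w)) := by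
  have h1 := h ((InnerProductSpace.toDual ℝ H).symm Λ)
  simpa only [InnerProductSpace.toDual_symm_apply] using h1

variable {E : Type*} [NormedAddCommGroup E] [InnerProductSpace ℝ E] [MeasurableSpace E]
  [BorelSpace E] [FiniteDimensional ℝ E] {μ : Measure E} [μ.IsAddHaarMeasure]

theorem eq_zero_of_weakTendsto_gradLp {p : ENNReal} [Fact (1 ≤ p)]
    {S : Lp E 2 μ →L[ℝ] Lp ℝ p μ} (hS : ∀ v, S (gradLp μ v) = valLp μ p v) {l : Filter ℕ} [l.NeBot]
    {v : ℕ → testFun E} {g : Lp E 2 μ} (hg : WeakTendsto l (fun k => gradLp μ (v k)) g)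
    {s : ENNReal} (hs : 1 ≤ s) (hv : Tendsto (fun k => eLpNorm (v k : E → ℝ) s μ) l (𝓝 0)) :
    g = 0 := by
  have key : ∀ φ : E → ℝ, φ ∈ testFun E → ∫ x, φ x • g x ∂μ = 0 := by
    intro φ hφ
    obtain ⟨C₂, R₂, hC₂, hR₂⟩ := exists_bound_of_hasCompactSupport hφ.1.continuous hφ.2
    obtain ⟨L₂, hL₂⟩ := exists_integral_smul E (p := 2) (μ := μ)
      hφ.1.continuous.aestronglyMeasurable hC₂ hR₂
    rw [← (hL₂ g).2]
    refine ext_inner_left ℝ fun e => ?_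
    rw [inner_zero_right]
    have hdc : Continuous fun x => fderiv ℝ φ x e :=
      (hφ.1.continuous_fderiv (by simp)).clm_apply continuous_const
    have hds : HasCompactSupport fun x => fderiv ℝ φ x e := hφ.2.fderiv_apply (𝕜 := ℝ) e
    obtain ⟨C, R, hC, hR⟩ := exists_bound_of_hasCompactSupport hdc hds
    obtain ⟨K, hK⟩ := exists_lintegral_closedBall_le ℝ μ hs R
    have h1 : Tendsto (fun k => ⟪e, L₂ (gradLp μ (v k))⟫) l (𝓝 ⟪e, L₂ g⟫) :=
      hg.apply ((innerSL ℝ e).comp L₂)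
    refine tendsto_nhds_unique h1 ?_
    have h2 : ∀ k, ⟪e, L₂ (gradLp μ (v k))⟫ = -∫ x, (v k : E → ℝ) x * fderiv ℝ φ x e ∂μ := by
      intro k
      have h3 := integral_sobolev_mul_fderiv hS (gradLp_mem_gradSpace (v k)) hφ e
      have h4 : ∫ x, S (gradLp μ (v k)) x * fderiv ℝ φ x e ∂μ =
          ∫ x, (v k : E → ℝ) x * fderiv ℝ φ x e ∂μ := by
        rw [hS]
        refine integral_congr_ae ?_
        filter_upwards [coeFn_valLp (μ := μ) p (v k)] with x hx
        rw [hx]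
      rw [← h4, h3, neg_neg, (hL₂ _).2, ← integral_inner (hL₂ _).1]
      refine integral_congr_ae (ae_of_all _ fun x => ?_)
      simp only [real_inner_smul_right, mul_comm]
    rw [tendsto_zero_iff_enorm_tendsto_zero]
    have h5 : Tendsto (fun k => ENNReal.ofReal C * (K * eLpNorm (v k : E → ℝ) s μ)) l (𝓝 0) := by
      have := ENNReal.Tendsto.const_mul (a := ENNReal.ofReal C)
        (ENNReal.Tendsto.const_mul (a := (K : ENNReal)) hv (Or.inr ENNReal.coe_ne_top))
        (Or.inr ENNReal.ofReal_ne_top)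
      simpa using this
    refine tendsto_of_tendsto_of_tendsto_of_le_of_le tendsto_const_nhds h5 (fun _ => zero_le)
      fun k => ?_
    simp only []
    rw [h2, enorm_neg]
    refine (enorm_integral_le_lintegral_enorm _).trans ?_
    refine le_trans ?_ (mul_le_mul_right (hK _ (v k).2.1.continuous.aestronglyMeasurable) _)
    rw [← lintegral_const_mul' _ _ ENNReal.ofReal_ne_top,
      ← lintegral_indicator Metric.isClosed_closedBall.measurableSet]
    refine lintegral_mono fun x => ?_
    by_cases hx : x ∈ Metric.closedBall (0 : E) R
    · rw [Set.indicator_of_mem hx, mul_comm, enorm_mul]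
      refine mul_le_mul_left ?_ _
      rw [← ofReal_norm]
      exact ENNReal.ofReal_le_ofReal (hC x)
    · simp [hR x hx]
  have h6 := ae_eq_zero_of_integral_contDiff_smul_eq_zero (μ := μ)
    ((Lp.memLp g).locallyIntegrable (by norm_num)) fun φ hφ hφc => key φ ⟨hφ, hφc⟩
  exact Lp.ext (EventuallyEq.trans h6 (Lp.coeFn_zero _ _ _).symm)

/-- A sequence vanishing in a subcritical Lebesgue space can only concentrate. -/
theorem tendsto_scale_atTop {a : ℝ} {p : ENNReal} [Fact (1 ≤ p)] (h2 : (2 : ENNReal) ≠ ⊤)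
    (hb2 : (a + 1) * (2 : ENNReal).toReal = Module.finrank ℝ E)
    {S : Lp E 2 μ →L[ℝ] Lp ℝ p μ} (hS : ∀ v, S (gradLp μ v) = valLp μ p v) {l : Ultrafilter ℕ}
    {v : ℕ → testFun E} {d : ℕ → ℤ × E} {g : Lp E 2 μ} (hg0 : g ≠ 0)
    (hg : WeakTendsto l (fun k => (dilEquiv h2 hb2 (d k)).symm (gradLp μ (v k))) g)
    {s : ENNReal} (hs : 1 ≤ s) (hst : s ≠ ⊤) (has : a * s.toReal < Module.finrank ℝ E)
    (hv : Tendsto (fun k => eLpNorm (v k : E → ℝ) s μ) l (𝓝 0)) :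
    Tendsto (fun k => (d k).1) l atTop := by
  rw [tendsto_atTop]
  by_contra h
  push Not at h
  obtain ⟨M, hM⟩ := h
  refine hg0 (eq_zero_of_weakTendsto_gradLp hS (v := fun k => dilTest a (dinv (d k)) (v k)) (l := l)
    (by simpa only [dilEquiv_symm_apply, dilLp_gradLp] using hg) hs ?_)
  have hs0 : 0 < s.toReal := ENNReal.toReal_pos (zero_lt_one.trans_le hs).ne' hst
  have h1 : Tendsto (fun k => ENNReal.ofReal ((2 : ℝ) ^ ((M : ℝ) * (Module.finrank ℝ E / s.toReal - a))) *
      eLpNorm (v k : E → ℝ) s μ) l (𝓝 0) := by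
    simpa using ENNReal.Tendsto.const_mul hv (Or.inr ENNReal.ofReal_ne_top)
  refine tendsto_of_tendsto_of_tendsto_of_le_of_le' tendsto_const_nhds h1
    (Eventually.of_forall fun _ => zero_le) ?_
  filter_upwards [hM] with k hk
  rw [dilTest, eLpNorm_dil (zero_lt_one.trans_le hs).ne' hst]
  refine mul_le_mul_left (ENNReal.ofReal_le_ofReal ?_) _
  refine Real.rpow_le_rpow_of_exponent_le (by norm_num) ?_
  have h3 : 0 < Module.finrank ℝ E / s.toReal - a := by
    rw [sub_pos, lt_div_iff₀ hs0]; exact has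
  have h4 : ((d k).1 : ℝ) ≤ M := by exact_mod_cast hk.le
  simp only [dinv, Int.cast_neg]
  nlinarith

end Concentration

section Bubbles

set_option linter.unusedSectionVars false

variable {E : Type*} [NormedAddCommGroup E] [InnerProductSpace ℝ E] [MeasurableSpace E]
  [BorelSpace E] [FiniteDimensional ℝ E] {μ : Measure E} [μ.IsAddHaarMeasure]

theorem decoupled_translation {e₀ : E} (he : e₀ ≠ 0) {m n : ℕ} (hmn : m ≠ n) {l : Filter ℕ}
    (hl : l ≤ atTop) :
    Decoupled E l (fun k => ((k : ℤ), (m : ℝ) • e₀)) (fun k => ((k : ℤ), (n : ℝ) • e₀)) := by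
  have h0 : 0 < ‖(m : ℝ) • e₀ - (n : ℝ) • e₀‖ := by
    rw [norm_pos_iff, ← sub_smul]
    exact smul_ne_zero (sub_ne_zero.2 (by exact_mod_cast hmn)) he
  have h1 : Tendsto (fun k : ℕ => ((2 : ℝ) ^ k + (2 : ℝ) ^ k) * ‖(m : ℝ) • e₀ - (n : ℝ) • e₀‖)
      atTop atTop :=
    ((tendsto_pow_atTop_atTop_of_one_lt one_lt_two).atTop_add_atTop
      (tendsto_pow_atTop_atTop_of_one_lt one_lt_two)).atTop_mul_const h0
  refine (h1.mono_left hl).congr fun k => ?_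
  simp

theorem tendsto_lintegral_rescaled_sub {a : ℝ} (ha : 0 < a) {p : ENNReal} [Fact (1 ≤ p)]
    (hp1 : 1 < p) (hp : p ≠ ⊤) (hb : a * p.toReal = Module.finrank ℝ E) {l : Filter ℕ}
    {v : ℕ → Lp ℝ p μ} {d : ℕ → ℕ → ℤ × E} {w : ℕ → Lp ℝ p μ}
    (hd : ∀ m n, m ≠ n → Decoupled E l (d m) (d n))
    (hv : ∀ ε : ℝ, 0 < ε → ∃ ν₀ : ℕ, ∀ ν ≥ ν₀, ∀ᶠ k in l,
      ‖v k - ∑ n ∈ Finset.range ν, dilLp hp hb (d n k) (w n)‖ ≤ ε) (n : ℕ) (R : ℝ) :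
    Tendsto (fun k => ∫⁻ x in Metric.closedBall 0 R, ‖dil a (dinv (d n k)) (v k) x - w n x‖ₑ ∂μ)
      l (𝓝 0) := by
  obtain ⟨K, hK⟩ := exists_lintegral_closedBall_le ℝ μ (Fact.out : 1 ≤ p) R
  set B := Metric.closedBall (0 : E) R
  rw [ENNReal.tendsto_nhds_zero]
  intro ε hε
  obtain ⟨δ, hδ, hδε⟩ : ∃ δ : NNReal, 0 < δ ∧ (K : ENNReal) * δ ≤ ε / 2 := by
    have h1 : Tendsto (fun δ : NNReal => (K : ENNReal) * δ) (𝓝[>] 0) (𝓝 0) := by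
      have := ENNReal.Tendsto.const_mul (a := (K : ENNReal))
        (ENNReal.tendsto_coe.2 (tendsto_id (x := 𝓝 (0 : NNReal)))) (Or.inr ENNReal.coe_ne_top)
      simpa using this.mono_left nhdsWithin_le_nhds
    have h2 := (ENNReal.tendsto_nhds_zero.1 h1 (ε / 2) (ENNReal.half_pos hε.ne'))
    obtain ⟨δ, h3, h4⟩ := (h2.and self_mem_nhdsWithin).exists
    exact ⟨δ, h4, h3⟩
  obtain ⟨ν₀, hν₀⟩ := hv δ (by exact_mod_cast hδ)
  set ν := max ν₀ (n + 1)
  have hn : n ∈ Finset.range ν := Finset.mem_range.2 (lt_of_lt_of_le n.lt_succ_self (le_max_right _ _))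
  have h5 : Tendsto (fun k => ∑ m ∈ (Finset.range ν).erase n,
      ∫⁻ x in B, ‖dil a (relDil (d n k) (d m k)) (w m) x‖ₑ ∂μ) l (𝓝 0) := by
    have := tendsto_finsetSum ((Finset.range ν).erase n) fun m hm =>
      tendsto_lintegral_dil hp1 hp ha hb (hd n m (Finset.ne_of_mem_erase hm).symm).tendsto_relDil
        (Lp.memLp (w m)) R
    simpa using this
  filter_upwards [hν₀ ν (le_max_left _ _),
    ENNReal.tendsto_nhds_zero.1 h5 (ε / 2) (ENNReal.half_pos hε.ne')] with k hk1 hk2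
  set r := v k - ∑ m ∈ Finset.range ν, dilLp hp hb (d m k) (w m) with hr
  have h6 : dilLp hp hb (dinv (d n k)) (v k) - w n =
      ∑ m ∈ (Finset.range ν).erase n, dilLp hp hb (relDil (d n k) (d m k)) (w m) +
        dilLp hp hb (dinv (d n k)) r := by
    rw [hr, map_sub, map_sum, ← Finset.sum_erase_add _ _ hn]
    simp only [dilLp_dilLp, dinv_dcomp, dilLp_zero, relDil]
    abel
  have h7 : ∫⁻ x in B, ‖dil a (dinv (d n k)) (v k) x - w n x‖ₑ ∂μ =
      eLpNorm (dilLp hp hb (dinv (d n k)) (v k) - w n : Lp ℝ p μ) 1 (μ.restrict B) := by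
    rw [eLpNorm_one_eq_lintegral_enorm]
    refine lintegral_congr_ae (ae_restrict_of_ae ?_)
    filter_upwards [coeFn_dilLp hp hb (dinv (d n k)) (v k),
      Lp.coeFn_sub (dilLp hp hb (dinv (d n k)) (v k)) (w n)] with x hx1 hx2
    rw [hx2, Pi.sub_apply, hx1]
  have hmeas : ∀ f : Lp ℝ p μ, AEStronglyMeasurable f (μ.restrict B) := fun f =>
    (Lp.aestronglyMeasurable f).restrict
  have h8 : eLpNorm (∑ m ∈ (Finset.range ν).erase n,
      dilLp hp hb (relDil (d n k) (d m k)) (w m) : Lp ℝ p μ) 1 (μ.restrict B) ≤ ε / 2 := by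
    refine le_trans ?_ hk2
    rw [eLpNorm_congr_ae (ae_restrict_of_ae (Lp.coeFn_finsetSum _ _))]
    refine (eLpNorm_sum_le (fun _ _ => hmeas _) le_rfl).trans (Finset.sum_le_sum fun m _ => ?_)
    rw [eLpNorm_one_eq_lintegral_enorm]
    refine (lintegral_congr_ae (ae_restrict_of_ae ?_)).le
    filter_upwards [coeFn_dilLp hp hb (relDil (d n k) (d m k)) (w m)] with x hx
    rw [hx]
  have h9 : eLpNorm (dilLp hp hb (dinv (d n k)) r) 1 (μ.restrict B) ≤ ε / 2 := by
    rw [eLpNorm_one_eq_lintegral_enorm]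
    refine (hK _ (Lp.aestronglyMeasurable _)).trans (le_trans ?_ hδε)
    refine mul_le_mul_right ?_ _
    rw [← Lp.enorm_def, ← ofReal_norm, LinearIsometry.norm_map]
    exact (ENNReal.ofReal_le_ofReal hk1).trans (ENNReal.ofReal_coe_nnreal).le
  rw [h7, h6, eLpNorm_congr_ae (ae_restrict_of_ae (Lp.coeFn_add _ _))]
  refine (eLpNorm_add_le (hmeas _) (hmeas _) le_rfl).trans ?_
  exact (add_le_add h8 h9).trans (ENNReal.add_halves ε).le

end Bubbles

section BubbleDecomposition

set_option linter.unusedSectionVars false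

variable {E : Type*} [NormedAddCommGroup E] [InnerProductSpace ℝ E] [MeasurableSpace E]
  [BorelSpace E] [FiniteDimensional ℝ E] {μ : Measure E} [μ.IsAddHaarMeasure]

/-- Bubble decomposition along an ultrafilter of a bounded sequence of test functions vanishing in
a subcritical Lebesgue space. -/
theorem exists_bubbles {a : ℝ} (ha : 0 < a) {p : ENNReal} [Fact (1 ≤ p)] (hp : p ≠ ⊤)
    (hpa : p.toReal = 2 + 2 / a) (hb : a * p.toReal = Module.finrank ℝ E) (h2 : (2 : ENNReal) ≠ ⊤)
    (hb2 : (a + 1) * (2 : ENNReal).toReal = Module.finrank ℝ E)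
    {S : Lp E 2 μ →L[ℝ] Lp ℝ p μ} (hS : ∀ v, S (gradLp μ v) = valLp μ p v) {l : Ultrafilter ℕ}
    (hl : (l : Filter ℕ) ≤ atTop) {u : ℕ → testFun E} {C : ℝ} (hC : ∀ k, ‖gradLp μ (u k)‖ ≤ C)
    {L : ℝ} (hL : Tendsto (fun k => ‖gradLp μ (u k)‖ ^ 2) l (𝓝 L))
    {s : ENNReal} (hs : 1 ≤ s) (hst : s ≠ ⊤) (has : a * s.toReal < Module.finrank ℝ E)
    (hu : Tendsto (fun k => eLpNorm (u k : E → ℝ) s μ) l (𝓝 0)) :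
    ∃ (d : ℕ → ℕ → ℤ × E) (w : ℕ → Lp E 2 μ),
      (∀ n, w n ∈ gradSpace μ) ∧ (∀ n, Tendsto (fun k => (d n k).1) l atTop) ∧
      (∀ m n, m ≠ n → Decoupled E l (d m) (d n)) ∧
      Summable (fun n => ‖w n‖ ^ 2) ∧ ∑' n, ‖w n‖ ^ 2 ≤ L ∧
      ∀ ε : ℝ, 0 < ε → ∃ ν₀ : ℕ, ∀ ν ≥ ν₀, ∀ᶠ k in (l : Filter ℕ),
        ‖valLp μ p (u k) - ∑ n ∈ Finset.range ν, dilLp hp hb (d n k) (S (w n))‖ ≤ ε := by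
  have hn0 : (0 : ℝ) < Module.finrank ℝ E := by
    rw [← hb2]; simp only [ENNReal.toReal_ofNat]; positivity
  have : Nontrivial E := Module.finrank_pos_iff.1 (by exact_mod_cast hn0 : 0 < Module.finrank ℝ E)
  obtain ⟨e₀, he₀⟩ := exists_ne (0 : E)
  obtain ⟨d, w, hw, hd, hpad, hsum, hle, hrem⟩ := exists_profiles
    (fun d : ℤ × E => dilEquiv (F := E) (μ := μ) h2 hb2 d) l (Decoupled E (l : Filter ℕ))
    (fun _ _ h => h.symm) not_decoupled_self
    (fun d d' h => h.tendsto_inner_dilLp (by positivity) h2 hb2)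
    (fun d d' h => exists_tendsto_dilEquiv_of_not_decoupled l h2 hb2 h)
    (fun m k => ((k : ℤ), (m : ℝ) • e₀)) (fun m n hmn => decoupled_translation he₀ hmn hl)
    (fun k => gradLp μ (u k)) hC hL
  have hwG : ∀ n, w n ∈ gradSpace μ := fun n =>
    mem_gradSpace_of_weakTendsto (fun k => by
      rw [dilEquiv_symm_apply]
      exact dilLp_mem_gradSpace h2 hb2 _ (gradLp_mem_gradSpace (u k))) (hw n)
  refine ⟨d, w, hwG, fun n => ?_, hd, hsum, hle, fun ε hε => ?_⟩
  · rcases hpad n with h | ⟨m, hm⟩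
    · exact tendsto_scale_atTop h2 hb2 hS h (hw n) hs hst has hu
    · rw [← hm]
      exact tendsto_natCast_atTop_atTop.mono_left hl
  obtain ⟨φ, K, hK⟩ := exists_norm_sobolev_rpow_le (μ := μ) hp ha hpa h2 hb2 hS
  obtain ⟨ρ, hρ, hρε⟩ : ∃ ρ : ℝ, 0 < ρ ∧ K * ρ ^ (2 / a) * (L + 1) < ε ^ (2 + 2 / a) := by
    have h1 : Tendsto (fun ρ : ℝ => K * ρ ^ (2 / a) * (L + 1)) (𝓝[>] 0) (𝓝 0) := by
      have h3 : ContinuousAt (fun ρ : ℝ => K * ρ ^ (2 / a) * (L + 1)) 0 :=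
        ((Real.continuousAt_rpow_const _ _ (Or.inr (by positivity))).const_mul _).mul_const _
      have h4 := h3.tendsto
      rw [Real.zero_rpow (by positivity), mul_zero, zero_mul] at h4
      exact h4.mono_left nhdsWithin_le_nhds
    obtain ⟨ρ, h3, h4⟩ := ((h1.eventually_lt_const
      (show (0 : ℝ) < ε ^ (2 + 2 / a) by positivity)).and self_mem_nhdsWithin).exists
    exact ⟨ρ, h4, h3⟩
  obtain ⟨ν₀, hν₀⟩ := hrem φ ρ hρ
  refine ⟨ν₀, fun ν hν => ?_⟩
  have h5 := tendsto_sq_norm_sub_sum (fun d : ℤ × E => dilEquiv (F := E) (μ := μ) h2 hb2 d)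
    hL (Finset.range ν) d w (fun n _ => hw n)
    fun m _ n _ hmn => (hd m n hmn).tendsto_inner_dilLp (by positivity) h2 hb2
  have h6 : L - ∑ n ∈ Finset.range ν, ‖w n‖ ^ 2 < L + 1 := by
    have : 0 ≤ ∑ n ∈ Finset.range ν, ‖w n‖ ^ 2 := Finset.sum_nonneg fun _ _ => by positivity
    linarith
  filter_upwards [hν₀ ν hν, h5.eventually_lt_const h6] with k hk1 hk2
  set g := gradLp μ (u k) - ∑ n ∈ Finset.range ν, dilEquiv h2 hb2 (d n k) (w n) with hg
  have hgG : g ∈ gradSpace μ := by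
    refine Submodule.sub_mem _ (gradLp_mem_gradSpace _) (Submodule.sum_mem _ fun n _ => ?_)
    rw [dilEquiv_apply]
    exact dilLp_mem_gradSpace h2 hb2 _ (hwG n)
  have h7 : S g = valLp μ p (u k) - ∑ n ∈ Finset.range ν, dilLp hp hb (d n k) (S (w n)) := by
    rw [hg, map_sub, map_sum, hS]
    congr 1
    refine Finset.sum_congr rfl fun n _ => ?_
    rw [dilEquiv_apply]
    exact sobolev_dilLp hp hb h2 hb2 hS (d n k) (hwG n)
  rw [← h7]
  have h8 : ‖S g‖ ^ (2 + 2 / a) ≤ ε ^ (2 + 2 / a) := by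
    refine (hK g hgG ρ hρ hk1).trans (le_trans ?_ hρε.le)
    exact mul_le_mul_of_nonneg_left hk2.le (by positivity)
  exact (Real.rpow_le_rpow_iff (norm_nonneg _) hε.le (by positivity)).1 h8

end BubbleDecomposition

section Subsequence

set_option linter.unusedSectionVars false

theorem exists_strictMono_tendsto_of_le {l : Filter ℕ} [l.NeBot] (hl : l ≤ atTop) {ι : Type*}
    [Countable ι] (F : ι → Filter ℕ) (hF : ∀ i, (F i).IsCountablyGenerated)
    (h : ∀ i, l ≤ F i) :
    ∃ φ : ℕ → ℕ, StrictMono φ ∧ ∀ i, Tendsto φ atTop (F i) := by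
  have : ((⨅ i, F i) ⊓ atTop).NeBot := NeBot.mono ‹_› (le_inf (le_iInf h) hl)
  obtain ⟨x, hx⟩ := exists_seq_tendsto ((⨅ i, F i) ⊓ atTop)
  obtain ⟨ψ, hψ, hxψ⟩ := strictMono_subseq_of_tendsto_atTop (tendsto_inf.1 hx).2
  exact ⟨x ∘ ψ, hxψ, fun i =>
    ((tendsto_iInf.1 (tendsto_inf.1 hx).1 i).comp hψ.tendsto_atTop)⟩

theorem exists_strictMono_le_two_pow {I : ℕ → ℕ → ℕ → ENNReal}
    (h : ∀ n i, Tendsto (I n i) atTop (𝓝 0)) :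
    ∃ φ : ℕ → ℕ, StrictMono φ ∧ ∀ i, ∀ n ≤ i, I n i (φ i) ≤ (2⁻¹ : ENNReal) ^ i := by
  refine extraction_forall_of_eventually (P := fun i k => ∀ n ≤ i, I n i k ≤ (2⁻¹ : ENNReal) ^ i)
    fun i => ?_
  have h1 := (Finset.range (i + 1)).eventually_all (l := (atTop : Filter ℕ))
    (p := fun n k => I n i k ≤ (2⁻¹ : ENNReal) ^ i)
  refine ((h1.2 fun n _ => ENNReal.tendsto_nhds_zero.1 (h n i) _
    (ENNReal.pow_pos (by simp) _))).mono fun k hk n hn => hk n (Finset.mem_range.2 (by omega))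

theorem ae_tendsto_of_lintegral_closedBall_le {E : Type*} [NormedAddCommGroup E]
    [MeasurableSpace E] [BorelSpace E] {μ : Measure E} {f : ℕ → E → ℝ} {g : E → ℝ} {n : ℕ}
    (hf : ∀ i, AEStronglyMeasurable (f i) μ) (hg : AEStronglyMeasurable g μ)
    (h : ∀ i ≥ n, ∫⁻ x in Metric.closedBall 0 (i : ℝ), ‖f i x - g x‖ₑ ∂μ ≤ (2⁻¹ : ENNReal) ^ i) :
    ∀ᵐ x ∂μ, Tendsto (fun i => f i x) atTop (𝓝 (g x)) := by
  let G : ℕ → E → ENNReal := fun i => (Metric.closedBall 0 ((i + n : ℕ) : ℝ)).indicator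
    fun x => ‖f (i + n) x - g x‖ₑ
  have hG : ∀ i, AEMeasurable (G i) μ := fun i =>
    (((hf _).sub hg).enorm).indicator Metric.isClosed_closedBall.measurableSet
  have h1 : ∫⁻ x, ∑' i, G i x ∂μ ≠ ⊤ := by
    rw [lintegral_tsum hG]
    have h2 : ∑' i, ∫⁻ x, G i x ∂μ ≤ ∑' i : ℕ, (2⁻¹ : ENNReal) ^ i := by
      refine ENNReal.tsum_le_tsum fun i => ?_
      rw [lintegral_indicator Metric.isClosed_closedBall.measurableSet]
      exact (h _ (Nat.le_add_left _ _)).trans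
        (pow_le_pow_right_of_le_one' (ENNReal.inv_le_one.2 one_le_two) (Nat.le_add_right _ _))
    refine (h2.trans_lt ?_).ne
    rw [ENNReal.tsum_geometric, ENNReal.one_sub_inv_two, inv_inv]
    exact ENNReal.ofNat_lt_top
  filter_upwards [ae_lt_top' (AEMeasurable.tsum hG) h1] with x hx
  have h3 := ENNReal.tendsto_atTop_zero_of_tsum_ne_top hx.ne
  rw [← tendsto_add_atTop_iff_nat n, tendsto_iff_edist_tendsto_0]
  refine h3.congr' ?_
  filter_upwards [eventually_ge_atTop ⌈‖x‖⌉₊] with i hi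
  have h4 : x ∈ Metric.closedBall 0 ((i + n : ℕ) : ℝ) := by
    rw [mem_closedBall_zero_iff]
    exact (Nat.le_ceil _).trans (by exact_mod_cast hi.trans (Nat.le_add_right _ _))
  simp only [G, Set.indicator_of_mem h4, edist_eq_enorm_sub]

variable {E : Type*} [NormedAddCommGroup E] [InnerProductSpace ℝ E] [MeasurableSpace E]
  [BorelSpace E] [FiniteDimensional ℝ E] {μ : Measure E} [μ.IsAddHaarMeasure]

/-- Bubble decomposition of a subsequence of a bounded sequence of test functions vanishing in a
subcritical Lebesgue space. -/
theorem exists_bubble_subsequence {a : ℝ} (ha : 0 < a) {p : ENNReal} [Fact (1 ≤ p)] (hp : p ≠ ⊤)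
    (hpa : p.toReal = 2 + 2 / a) (hb : a * p.toReal = Module.finrank ℝ E) (h2 : (2 : ENNReal) ≠ ⊤)
    (hb2 : (a + 1) * (2 : ENNReal).toReal = Module.finrank ℝ E)
    {S : Lp E 2 μ →L[ℝ] Lp ℝ p μ} (hS : ∀ v, S (gradLp μ v) = valLp μ p v)
    {u : ℕ → testFun E} {C : ℝ} (hC : ∀ k, ‖gradLp μ (u k)‖ ≤ C)
    {s : ENNReal} (hs : 1 ≤ s) (hst : s ≠ ⊤) (has : a * s.toReal < Module.finrank ℝ E)
    (hu : Tendsto (fun k => eLpNorm (u k : E → ℝ) s μ) atTop (𝓝 0)) :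
    ∃ φ : ℕ → ℕ, StrictMono φ ∧ ∃ (d : ℕ → ℕ → ℤ × E) (w : ℕ → Lp E 2 μ) (L : ℝ),
      (∀ n, w n ∈ gradSpace μ) ∧ (∀ n, Tendsto (fun k => (d n k).1) atTop atTop) ∧
      (∀ m n, m ≠ n → Decoupled E atTop (d m) (d n)) ∧
      Summable (fun n => ‖w n‖ ^ 2) ∧ ∑' n, ‖w n‖ ^ 2 ≤ L ∧
      Tendsto (fun k => ‖gradLp μ (u (φ k))‖ ^ 2) atTop (𝓝 L) ∧
      (∀ ε : ℝ, 0 < ε → ∃ ν : ℕ, ∀ᶠ k in atTop,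
        ‖valLp μ p (u (φ k)) - ∑ n ∈ Finset.range ν, dilLp hp hb (d n k) (S (w n))‖ ≤ ε) ∧
      ∀ n, ∀ᵐ x ∂μ, Tendsto (fun k => dil a (dinv (d n k)) (u (φ k)) x) atTop (𝓝 (S (w n) x)) := by
  let l : Ultrafilter ℕ := hyperfilter ℕ
  have hl : (l : Filter ℕ) ≤ atTop := Nat.hyperfilter_le_atTop
  have hp1 : 1 < p := by
    rw [← ENNReal.toReal_lt_toReal ENNReal.one_ne_top hp, hpa, ENNReal.toReal_one]
    have : 0 < 2 / a := by positivity
    linarith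
  obtain ⟨L, -, hL⟩ : ∃ L ∈ Set.Icc 0 (C ^ 2),
      ((l.map fun k => ‖gradLp μ (u k)‖ ^ 2 : Ultrafilter ℝ) : Filter ℝ) ≤ 𝓝 L :=
    isCompact_Icc.ultrafilter_le_nhds _ (by
      rw [le_principal_iff]
      exact Ultrafilter.mem_map.2 (univ_mem' fun k =>
        ⟨by positivity, pow_le_pow_left₀ (norm_nonneg _) (hC k) 2⟩))
  have hL' : Tendsto (fun k => ‖gradLp μ (u k)‖ ^ 2) l (𝓝 L) := hL
  obtain ⟨d, w, hw, hd1, hd, hsum, hle, hrem⟩ := exists_bubbles ha hp hpa hb h2 hb2 hS hl hC hL'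
    hs hst has (hu.mono_left hl)
  let J : ℕ → ℕ → ℕ → ENNReal := fun n i k => ∫⁻ x in Metric.closedBall 0 (i : ℝ),
    ‖dil a (dinv (d n k)) (valLp μ p (u k)) x - S (w n) x‖ₑ ∂μ
  have hJ : ∀ n i, Tendsto (J n i) l (𝓝 0) := fun n i =>
    tendsto_lintegral_rescaled_sub ha hp1 hp hb hd hrem n (i : ℝ)
  choose ν₀ hν₀ using fun m : ℕ => hrem (1 / (m + 1)) (by positivity)
  let F : Unit ⊕ ℕ ⊕ {q : ℕ × ℕ // q.1 ≠ q.2} ⊕ ℕ ⊕ (ℕ × ℕ) → Filter ℕ :=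
    Sum.elim (fun _ => comap (fun k => ‖gradLp μ (u k)‖ ^ 2) (𝓝 L))
      (Sum.elim (fun n => comap (fun k => (d n k).1) atTop)
        (Sum.elim (fun q => comap (fun k => |((d q.1.2 k).1 : ℝ) - (d q.1.1 k).1| +
          ((2 : ℝ) ^ (d q.1.2 k).1 + (2 : ℝ) ^ (d q.1.1 k).1) *
            ‖(d q.1.1 k).2 - (d q.1.2 k).2‖) atTop)
          (Sum.elim (fun m => 𝓟 {k | ‖valLp μ p (u k) -
              ∑ n ∈ Finset.range (ν₀ m), dilLp hp hb (d n k) (S (w n))‖ ≤ 1 / (m + 1)})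
            fun q => comap (J q.1 q.2) (𝓝 0))))
  obtain ⟨φ₁, hφ₁, h₁⟩ := exists_strictMono_tendsto_of_le hl F
    (by rintro (_ | _ | _ | _ | _) <;> simp only [F, Sum.elim_inl, Sum.elim_inr] <;> infer_instance)
    (by
      rintro (_ | n | q | m | q)
      · exact hL'.le_comap
      · exact (hd1 n).le_comap
      · exact (hd q.1.1 q.1.2 q.2).le_comap
      · exact le_principal_iff.2 (hν₀ m _ le_rfl)
      · exact (hJ q.1 q.2).le_comap)
  have hI : ∀ n i : ℕ, Tendsto (J n i ∘ φ₁) atTop (𝓝 0) := fun n i =>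
    tendsto_comap_iff.1 (h₁ (Sum.inr (Sum.inr (Sum.inr (Sum.inr (n, i))))))
  obtain ⟨φ₂, hφ₂, h₂⟩ := exists_strictMono_le_two_pow hI
  have hφ₂t := hφ₂.tendsto_atTop
  refine ⟨φ₁ ∘ φ₂, hφ₁.comp hφ₂, fun n k => d n (φ₁ (φ₂ k)), w, L, hw,
    fun n => (tendsto_comap_iff.1 (h₁ (Sum.inr (Sum.inl n)))).comp hφ₂t,
    fun m n hmn => (tendsto_comap_iff.1
      (h₁ (Sum.inr (Sum.inr (Sum.inl ⟨(m, n), hmn⟩))))).comp hφ₂t, hsum, hle,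
    (tendsto_comap_iff.1 (h₁ (Sum.inl ()))).comp hφ₂t, fun ε hε => ?_, fun n => ?_⟩
  · obtain ⟨m, hm⟩ := exists_nat_one_div_lt hε
    refine ⟨ν₀ m, ?_⟩
    filter_upwards [hφ₂t.eventually
      (tendsto_principal.1 (h₁ (Sum.inr (Sum.inr (Sum.inr (Sum.inl m))))))] with k hk
    exact le_trans hk hm.le
  · have h3 := ae_tendsto_of_lintegral_closedBall_le (n := n) (μ := μ)
      (f := fun i => dil a (dinv (d n (φ₁ (φ₂ i)))) (valLp μ p (u (φ₁ (φ₂ i)))))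
      (fun i => aestronglyMeasurable_dil _ _ (Lp.aestronglyMeasurable _))
      (Lp.aestronglyMeasurable (S (w n))) (fun i hi => h₂ i n hi)
    have h4 : ∀ᵐ x ∂μ, ∀ k, dil a (dinv (d n (φ₁ (φ₂ k)))) (valLp μ p (u (φ₁ (φ₂ k)))) x =
        dil a (dinv (d n (φ₁ (φ₂ k)))) (u (φ₁ (φ₂ k))) x :=
      ae_all_iff.2 fun k => dil_congr_ae a _ (coeFn_valLp p (u (φ₁ (φ₂ k))))
    filter_upwards [h3, h4] with x hx1 hx2
    exact hx1.congr hx2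

end Subsequence

section Cutoff

set_option linter.unusedSectionVars false

variable {E : Type*} [NormedAddCommGroup E] [InnerProductSpace ℝ E] [MeasurableSpace E]
  [BorelSpace E] [FiniteDimensional ℝ E] {μ : Measure E} [μ.IsAddHaarMeasure]

theorem aestronglyMeasurable_one_sub_cutoff {χ : E → ℝ} (hχ : Continuous χ) {f : E → ℝ}
    (hf : AEStronglyMeasurable f μ) (j : ℕ) :
    AEStronglyMeasurable (fun x => (1 - χ (((2 : ℝ) ^ j)⁻¹ • x)) * f x) μ :=
  AEStronglyMeasurable.mul
    (by fun_prop : Continuous fun x => 1 - χ (((2 : ℝ) ^ j)⁻¹ • x)).aestronglyMeasurable hf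

theorem tendsto_eLpNorm_one_sub_cutoff {p : ENNReal} (hp0 : p ≠ 0) (hp : p ≠ ⊤) {χ : E → ℝ}
    (hχ : Continuous χ) (hχ01 : ∀ x, 0 ≤ χ x ∧ χ x ≤ 1) {ρ : ℝ} (hρ : 0 < ρ)
    (hχ1 : ∀ x, ‖x‖ ≤ ρ → χ x = 1) {f : E → ℝ} (hf : MemLp f p μ) {j : ℕ → ℕ}
    (hj : Tendsto j atTop atTop) :
    Tendsto (fun k => eLpNorm (fun x => (1 - χ (((2 : ℝ) ^ j k)⁻¹ • x)) * f x) p μ)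
      atTop (𝓝 0) := by
  have hp' : 0 < p.toReal := ENNReal.toReal_pos hp0 hp
  have h1 : Tendsto (fun k => ∫⁻ x, ‖(1 - χ (((2 : ℝ) ^ j k)⁻¹ • x)) * f x‖ₑ ^ p.toReal ∂μ)
      atTop (𝓝 (∫⁻ _, 0 ∂μ)) := by
    refine tendsto_lintegral_filter_of_dominated_convergence' (fun x => ‖f x‖ₑ ^ p.toReal)
      (Eventually.of_forall fun k => (aestronglyMeasurable_one_sub_cutoff hχ hf.1 (j k)).enorm.pow_const _)
      (Eventually.of_forall fun k => ae_of_all _ fun x => ?_)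
      (lintegral_rpow_enorm_lt_top_of_eLpNorm_lt_top hp0 hp hf.2).ne (ae_of_all _ fun x => ?_)
    · refine ENNReal.rpow_le_rpow ?_ hp'.le
      rw [enorm_mul]
      refine mul_le_of_le_one_left' ?_
      rw [← ofReal_norm, Real.norm_eq_abs, ENNReal.ofReal_le_one, abs_le]
      have := hχ01 (((2 : ℝ) ^ j k)⁻¹ • x)
      constructor <;> linarith
    · refine tendsto_const_nhds.congr' ?_
      have h2 : Tendsto (fun k => (2 : ℝ) ^ j k * ρ) atTop atTop :=
        ((tendsto_pow_atTop_atTop_of_one_lt one_lt_two).comp hj).atTop_mul_const hρ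
      filter_upwards [h2.eventually_ge_atTop ‖x‖] with k hk
      have h3 : ‖((2 : ℝ) ^ j k)⁻¹ • x‖ ≤ ρ := by
        rw [norm_smul, norm_inv, norm_pow, Real.norm_ofNat, inv_mul_le_iff₀ (by positivity)]
        exact hk
      simp [hχ1 _ h3, hp']
  rw [lintegral_zero] at h1
  have h4 := h1.ennrpow_const (1 / p.toReal)
  rw [ENNReal.zero_rpow_of_pos (by positivity)] at h4
  refine h4.congr fun k => ?_
  rw [eLpNorm_eq_lintegral_rpow_enorm_toReal hp0 hp]

/-- A rescaled profile, cut off in the original variable. -/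
def cutDil (b : ℝ) (χ : E → ℝ) (j : ℕ) (y : E) (f : E → ℝ) : E → ℝ := fun x =>
  (2 : ℝ) ^ ((j : ℝ) * b) * χ (x - y) * f ((2 : ℝ) ^ j • (x - y))

theorem dil_sub_cutDil (b : ℝ) (χ : E → ℝ) (j : ℕ) (y : E) (f : E → ℝ) :
    dil b ((j : ℤ), y) f - cutDil b χ j y f =
      dil b ((j : ℤ), y) fun x => (1 - χ (((2 : ℝ) ^ j)⁻¹ • x)) * f x := by
  funext x
  have h1 : ((2 : ℝ) ^ b) ^ j = (2 : ℝ) ^ ((j : ℝ) * b) := by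
    rw [← Real.rpow_natCast, ← Real.rpow_mul (by norm_num), mul_comm]
  simp only [dil, cutDil, Pi.sub_apply, smul_eq_mul, zpow_natCast, smul_smul, h1]
  rw [inv_mul_cancel₀ (by positivity), one_smul]
  ring

theorem aestronglyMeasurable_cutDil (b : ℝ) {χ : E → ℝ} (hχ : Continuous χ) (j : ℕ) (y : E)
    {f : E → ℝ} (hf : AEStronglyMeasurable f μ) : AEStronglyMeasurable (cutDil b χ j y f) μ := by
  rw [← sub_sub_cancel (dil b ((j : ℤ), y) f) (cutDil b χ j y f), dil_sub_cutDil]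
  exact (aestronglyMeasurable_dil _ _ hf).sub
    (aestronglyMeasurable_dil _ _ (aestronglyMeasurable_one_sub_cutoff hχ hf j))

theorem tendsto_eLpNorm_dil_sub_cutDil {b : ℝ} {p : ENNReal} (hp0 : p ≠ 0) (hp : p ≠ ⊤)
    (hb : b * p.toReal = Module.finrank ℝ E) {χ : E → ℝ} (hχ : Continuous χ)
    (hχ01 : ∀ x, 0 ≤ χ x ∧ χ x ≤ 1) {ρ : ℝ} (hρ : 0 < ρ) (hχ1 : ∀ x, ‖x‖ ≤ ρ → χ x = 1) {f : E → ℝ}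
    (hf : MemLp f p μ) {j : ℕ → ℕ} (hj : Tendsto j atTop atTop) (y : ℕ → E) :
    Tendsto (fun k => eLpNorm (dil b ((j k : ℤ), y k) f - cutDil b χ (j k) (y k) f) p μ)
      atTop (𝓝 0) := by
  refine (tendsto_eLpNorm_one_sub_cutoff hp0 hp hχ hχ01 hρ hχ1 hf hj).congr fun k => ?_
  rw [dil_sub_cutDil, eLpNorm_dil_of_eq hp0 hp hb]

theorem eventually_eLpNorm_sub_sum_cutDil_le {b : ℝ} {p : ENNReal} [Fact (1 ≤ p)] (hp : p ≠ ⊤)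
    (hb : b * p.toReal = Module.finrank ℝ E) {χ : E → ℝ} (hχ : Continuous χ)
    (hχ01 : ∀ x, 0 ≤ χ x ∧ χ x ≤ 1) {ρ : ℝ} (hρ : 0 < ρ) (hχ1 : ∀ x, ‖x‖ ≤ ρ → χ x = 1)
    {u : ℕ → testFun E} {w : ℕ → Lp ℝ p μ} {j : ℕ → ℕ → ℕ} (hj : ∀ n, Tendsto (j n) atTop atTop)
    {y : ℕ → ℕ → E} {ε : ℝ} (hε : 0 < ε) {ν : ℕ}
    (h : ∀ᶠ k in atTop, ‖valLp μ p (u k) -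
      ∑ n ∈ Finset.range ν, dilLp hp hb ((j n k : ℤ), y n k) (w n)‖ ≤ ε) :
    ∀ᶠ k in atTop, eLpNorm ((u k : E → ℝ) -
      ∑ n ∈ Finset.range ν, cutDil b χ (j n k) (y n k) (w n)) p μ ≤ ENNReal.ofReal (2 * ε) := by
  have hp0 : p ≠ 0 := (zero_lt_one.trans_le Fact.out).ne'
  have h1 : Tendsto (fun k => ∑ n ∈ Finset.range ν,
      eLpNorm (dil b ((j n k : ℤ), y n k) (w n) - cutDil b χ (j n k) (y n k) (w n)) p μ)
      atTop (𝓝 0) := by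
    simpa using tendsto_finsetSum (Finset.range ν) fun n _ => tendsto_eLpNorm_dil_sub_cutDil hp0 hp hb
      hχ hχ01 hρ hχ1 (Lp.memLp (w n)) (hj n) (y n)
  filter_upwards [h, ENNReal.tendsto_nhds_zero.1 h1 (ENNReal.ofReal ε) (by simpa using hε)]
    with k hk1 hk2
  set r := valLp μ p (u k) - ∑ n ∈ Finset.range ν, dilLp hp hb ((j n k : ℤ), y n k) (w n) with hr
  have hmeas : ∀ n, AEStronglyMeasurable
      (dil b ((j n k : ℤ), y n k) (w n) - cutDil b χ (j n k) (y n k) (w n)) μ := by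
    intro n
    rw [dil_sub_cutDil]
    exact aestronglyMeasurable_dil _ _
      (aestronglyMeasurable_one_sub_cutoff hχ (Lp.aestronglyMeasurable _) _)
  have h2 : (u k : E → ℝ) - ∑ n ∈ Finset.range ν, cutDil b χ (j n k) (y n k) (w n) =ᵐ[μ]
      (r : E → ℝ) + ∑ n ∈ Finset.range ν,
        (dil b ((j n k : ℤ), y n k) (w n) - cutDil b χ (j n k) (y n k) (w n)) := by
    have h3 : ∀ᵐ x ∂μ, ∀ n, dilLp hp hb ((j n k : ℤ), y n k) (w n) x =
      dil b ((j n k : ℤ), y n k) (w n) x := ae_all_iff.2 fun n => coeFn_dilLp hp hb _ _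
    filter_upwards [h3, coeFn_valLp (μ := μ) p (u k), Lp.coeFn_sub (valLp μ p (u k))
      (∑ n ∈ Finset.range ν, dilLp hp hb ((j n k : ℤ), y n k) (w n)),
      Lp.coeFn_finsetSum (Finset.range ν) fun n => dilLp hp hb ((j n k : ℤ), y n k) (w n)]
      with x hx1 hx2 hx3 hx4
    simp only [Pi.add_apply, Pi.sub_apply, Finset.sum_apply, hx3, hx4, hx2, hr, hx1,
      Finset.sum_sub_distrib]
    ring
  rw [eLpNorm_congr_ae h2, two_mul, ENNReal.ofReal_add hε.le hε.le]
  refine (eLpNorm_add_le (Lp.aestronglyMeasurable r)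
    (Finset.aestronglyMeasurable_sum _ fun n _ => hmeas n) Fact.out).trans (add_le_add ?_ ?_)
  · rw [← Lp.enorm_def, ← ofReal_norm]
    exact ENNReal.ofReal_le_ofReal hk1
  · exact (eLpNorm_sum_le (fun n _ => hmeas n) Fact.out).trans hk2

end Cutoff

section ToNat

set_option linter.unusedSectionVars false

variable {E : Type*} [NormedAddCommGroup E] [InnerProductSpace ℝ E] [MeasurableSpace E]
  [BorelSpace E] [FiniteDimensional ℝ E] {μ : Measure E} [μ.IsAddHaarMeasure]

theorem sq_norm_eq_integral_sq_norm (f : Lp E 2 μ) : ‖f‖ ^ 2 = ∫ x, ‖f x‖ ^ 2 ∂μ := by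
  rw [← real_inner_self_eq_norm_sq, L2.inner_def]
  simp only [real_inner_self_eq_norm_sq]

theorem sq_norm_gradLp (v : testFun E) : ‖gradLp μ v‖ ^ 2 = ∫ x, ‖gradient (v : E → ℝ) x‖ ^ 2 ∂μ := by
  rw [sq_norm_eq_integral_sq_norm]
  refine integral_congr_ae ?_
  filter_upwards [coeFn_gradLp (μ := μ) v] with x hx
  rw [hx]

theorem sq_norm_gradLp_le {v : E → ℝ} (hv : v ∈ testFun E) :
    ‖gradLp μ ⟨v, hv⟩‖ ^ 2 ≤ ∫ x, (‖gradient v x‖ ^ 2 + v x ^ 2) ∂μ := by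
  have h1 : Integrable (fun x => ‖gradient v x‖ ^ 2) μ := (memLp_gradient hv).integrable_norm_pow (by norm_num)
  have h2 : Integrable (fun x => v x ^ 2) μ := (memLp_testFun hv 2).integrable_sq
  rw [sq_norm_gradLp, integral_add h1 h2]
  exact le_add_of_nonneg_right (integral_nonneg fun x => sq_nonneg _)

theorem tendsto_eLpNorm_of_tendsto_integral {p : ℝ} (hp : 0 < p) {u : ℕ → E → ℝ}
    (hu : ∀ k, u k ∈ testFun E) (h : Tendsto (fun k => ∫ x, |u k x| ^ p ∂μ) atTop (𝓝 0)) :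
    Tendsto (fun k => eLpNorm (u k) (ENNReal.ofReal p) μ) atTop (𝓝 0) := by
  have h1 := ENNReal.tendsto_ofReal (h.rpow_const (p := p⁻¹) (Or.inr (by positivity)))
  rw [Real.zero_rpow (by positivity), ENNReal.ofReal_zero] at h1
  refine h1.congr fun k => ?_
  rw [(memLp_testFun (hu k) _).eLpNorm_eq_integral_rpow_norm (by simpa using hp)
    ENNReal.ofReal_ne_top, ENNReal.toReal_ofReal hp.le]
  simp only [Real.norm_eq_abs]

theorem dil_dinv_natCast (a : ℝ) (j : ℕ) (y : E) (u : E → ℝ) (ξ : E) :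
    dil a (dinv ((j : ℤ), y)) u ξ = ((2 : ℝ) ^ ((j : ℝ) * a))⁻¹ * u (y + ((2 : ℝ) ^ j)⁻¹ • ξ) := by
  have h1 : ((2 : ℝ) ^ a) ^ j = (2 : ℝ) ^ ((j : ℝ) * a) := by
    rw [← Real.rpow_natCast, ← Real.rpow_mul (by norm_num), mul_comm]
  simp only [dil, dinv, zpow_neg, zpow_natCast, h1, smul_eq_mul, sub_neg_eq_add, smul_add, smul_smul]
  rw [inv_mul_cancel₀ (by positivity), one_smul, add_comm]

end ToNat

/-- Theorem 3.3 of the paper in ℝ^N: profile decomposition, into bubbles, of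
bounded H¹ sequences vanishing in some subcritical L^p. -/
theorem struwe_solimini_stmt11 (N : ℕ) (hN : 3 ≤ N) (r : ℝ) (hr : 0 < r)
    (χ : EuclideanSpace ℝ (Fin N) → ℝ) (hχsm : ContDiff ℝ (⊤ : ℕ∞) χ) (hχc : HasCompactSupport χ)
    (hχ01 : ∀ x, 0 ≤ χ x ∧ χ x ≤ 1)
    (hχ1 : ∀ x : EuclideanSpace ℝ (Fin N), ‖x‖ ≤ r / 2 → χ x = 1)
    (hχ0 : ∀ x : EuclideanSpace ℝ (Fin N), r ≤ ‖x‖ → χ x = 0)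
    (u : ℕ → EuclideanSpace ℝ (Fin N) → ℝ)
    (hsm : ∀ k, ContDiff ℝ (⊤ : ℕ∞) (u k)) (hsupp : ∀ k, HasCompactSupport (u k))
    (hbd : ∃ C : ℝ, ∀ k, (∫ x, (‖gradient (u k) x‖ ^ 2 + (u k x) ^ 2)) ≤ C)
    (p : ℝ) (hp1 : 2 < p) (hp2 : p < (2 * (N : ℝ)) / ((N : ℝ) - 2))
    (hvan : Tendsto (fun k => ∫ x, |u k x| ^ p) atTop (𝓝 0)) :
    ∃ φ : ℕ → ℕ, StrictMono φ ∧
    ∃ (y : ℕ → ℕ → EuclideanSpace ℝ (Fin N)) (j : ℕ → ℕ → ℕ)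
      (w : ℕ → EuclideanSpace ℝ (Fin N) → ℝ)
      (g : ℕ → EuclideanSpace ℝ (Fin N) → EuclideanSpace ℝ (Fin N)),
      (∀ n, Tendsto (j n) atTop atTop) ∧
      (∀ n, Integrable (fun x => |w n x| ^ ((2 * (N : ℝ)) / ((N : ℝ) - 2)))) ∧
      (∀ n, LocallyIntegrable (w n)) ∧
      (∀ n, HasWeakGradient (w n) (g n)) ∧
      (∀ n, Integrable (fun x => ‖g n x‖ ^ 2)) ∧
      -- (a) a.e. convergence of the rescaled translates to the profiles
      (∀ n, ∀ᵐ ξ : EuclideanSpace ℝ (Fin N),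
        Tendsto (fun k => ((2 : ℝ) ^ ((j n k : ℝ) * (((N : ℝ) - 2) / 2)))⁻¹ *
            u (φ k) (y n k + ((2 : ℝ) ^ (j n k))⁻¹ • ξ)) atTop (𝓝 (w n ξ))) ∧
      -- (b) asymptotic decoupling
      (∀ n n', n ≠ n' →
        Tendsto (fun k => |(j n' k : ℝ) - (j n k : ℝ)| +
            ((2 : ℝ) ^ (j n' k) + (2 : ℝ) ^ (j n k)) * ‖y n k - y n' k‖) atTop atTop) ∧
      -- (c) remainder vanishes in L^{2*}
      (∀ ε : ℝ, 0 < ε → ∃ ν K : ℕ, ∀ k, K ≤ k →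
        (∫ x, |u (φ k) x - ∑ n ∈ Finset.range ν,
            (2 : ℝ) ^ ((j n k : ℝ) * (((N : ℝ) - 2) / 2)) * χ (x - y n k) *
              w n ((2 : ℝ) ^ (j n k) • (x - y n k))| ^ ((2 * (N : ℝ)) / ((N : ℝ) - 2)))
          ^ (((N : ℝ) - 2) / (2 * (N : ℝ))) < ε) ∧
      -- (d) Plancherel-type inequality
      Summable (fun n => ∫ x, ‖g n x‖ ^ 2) ∧
      (∑' n, ∫ x, ‖g n x‖ ^ 2) ≤
        atTop.liminf (fun k => ∫ x, ‖gradient (u (φ k)) x‖ ^ 2) := by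
  obtain ⟨C, hC⟩ := hbd
  have hN' : (3 : ℝ) ≤ N := by exact_mod_cast hN
  have hN0 : 0 < (N : ℝ) - 2 := by linarith
  set q : ℝ := 2 * (N : ℝ) / ((N : ℝ) - 2) with hq
  set a : ℝ := ((N : ℝ) - 2) / 2 with ha_def
  have ha : 0 < a := by positivity
  have hq2 : q = 2 + 2 / a := by rw [hq, ha_def]; field_simp; ring
  have hq0 : 0 < q := by positivity
  have hq1 : 1 ≤ q := by
    have : 0 < 2 / a := by positivity
    linarith
  have hqt : (ENNReal.ofReal q).toReal = q := ENNReal.toReal_ofReal hq0.le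
  have hfin : Module.finrank ℝ (EuclideanSpace ℝ (Fin N)) = N := finrank_euclideanSpace_fin
  have : Fact (1 ≤ ENNReal.ofReal q) := ⟨ENNReal.one_le_ofReal.2 hq1⟩
  have hqT : ENNReal.ofReal q ≠ ⊤ := ENNReal.ofReal_ne_top
  have hq00 : ENNReal.ofReal q ≠ 0 := by simpa using hq0
  have hpa : (ENNReal.ofReal q).toReal = 2 + 2 / a := by rw [hqt, hq2]
  have haq : a * q = N := by rw [hq, ha_def]; field_simp
  have hb : a * (ENNReal.ofReal q).toReal = Module.finrank ℝ (EuclideanSpace ℝ (Fin N)) := by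
    rw [hqt, hfin, haq]
  have hb2 : (a + 1) * (2 : ENNReal).toReal = Module.finrank ℝ (EuclideanSpace ℝ (Fin N)) := by
    rw [hfin, ENNReal.toReal_ofNat, ha_def]; ring
  have hfin2 : (Module.finrank ℝ (EuclideanSpace ℝ (Fin N)) : ℝ) = 2 * a + 2 := by
    rw [hfin, ha_def]; ring
  have htest : ∀ k, u k ∈ testFun (EuclideanSpace ℝ (Fin N)) := fun k => ⟨hsm k, hsupp k⟩
  obtain ⟨S, hS⟩ := exists_sobolev_extension
    (μ := (volume : Measure (EuclideanSpace ℝ (Fin N)))) hqT ha hfin2 hpa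
  let v : ℕ → testFun (EuclideanSpace ℝ (Fin N)) := fun k => ⟨u k, htest k⟩
  have hv : ∀ k, ‖gradLp (volume : Measure (EuclideanSpace ℝ (Fin N))) (v k)‖ ≤ √C := fun k =>
    Real.le_sqrt_of_sq_le ((sq_norm_gradLp_le (htest k)).trans (hC k))
  have hp0 : 0 < p := by linarith
  have has : a * (ENNReal.ofReal p).toReal < Module.finrank ℝ (EuclideanSpace ℝ (Fin N)) := by
    rw [ENNReal.toReal_ofReal hp0.le, hfin, ← haq]
    exact mul_lt_mul_of_pos_left hp2 ha
  obtain ⟨φ, hφ, d, W, L, hW, hd1, hd, hsum, hle, hL, hrem, hae⟩ := exists_bubble_subsequence ha hqT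
    hpa hb ENNReal.ofNat_ne_top hb2 hS hv (ENNReal.one_le_ofReal.2 (by linarith : (1 : ℝ) ≤ p))
    ENNReal.ofReal_ne_top has (tendsto_eLpNorm_of_tendsto_integral hp0 htest hvan)
  let j : ℕ → ℕ → ℕ := fun n k => (d n k).1.toNat
  let y : ℕ → ℕ → EuclideanSpace ℝ (Fin N) := fun n k => (d n k).2
  have hdj : ∀ n, ∀ᶠ k in atTop, d n k = ((j n k : ℤ), y n k) := fun n => by
    filter_upwards [(hd1 n).eventually_ge_atTop 0] with k hk
    exact Prod.ext (Int.toNat_of_nonneg hk).symm rfl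
  have hj : ∀ n, Tendsto (j n) atTop atTop := fun n => by
    rw [← tendsto_natCast_atTop_iff (R := ℤ)]
    refine (hd1 n).congr' ?_
    filter_upwards [hdj n] with k hk
    rw [hk]
  refine ⟨φ, hφ, y, j, fun n => S (W n), fun n => W n, hj, fun n => ?_, fun n => ?_, fun n => ?_,
    fun n => ?_, fun n => ?_, fun n n' hnn => ?_, fun ε hε => ?_, ?_, ?_⟩
  · have := (Lp.memLp (S (W n))).integrable_norm_rpow hq00 hqT
    simpa only [hqt, Real.norm_eq_abs] using this
  · exact (Lp.memLp (S (W n))).locallyIntegrable Fact.out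
  · intro f hf hfc i
    have := integral_sobolev_mul_fderiv hS (hW n) (φ := f) ⟨hf, hfc⟩ (EuclideanSpace.single i 1)
    simpa [EuclideanSpace.inner_single_left] using this
  · exact (Lp.memLp (W n)).integrable_norm_pow (by norm_num)
  · filter_upwards [hae n] with ξ hξ
    refine hξ.congr' ?_
    filter_upwards [hdj n] with k hk
    rw [hk, dil_dinv_natCast]
  · refine (hd n n' hnn).congr' ?_
    filter_upwards [hdj n, hdj n'] with k hk hk'
    rw [hk, hk']
    simp
  · obtain ⟨ν, hν⟩ := hrem (ε / 4) (by positivity)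
    have hν' : ∀ᶠ k in atTop, ‖valLp volume (ENNReal.ofReal q) (v (φ k)) -
        ∑ n ∈ Finset.range ν, dilLp hqT hb ((j n k : ℤ), y n k) (S (W n))‖ ≤ ε / 4 := by
      filter_upwards [hν, (Finset.range ν).eventually_all.2 fun n _ => hdj n] with k hk hk'
      rw [Finset.sum_congr rfl fun n hn =>
        congrArg (fun e => dilLp hqT hb e (S (W n))) (hk' n hn).symm]
      exact hk
    obtain ⟨K, hK⟩ := eventually_atTop.1 (eventually_eLpNorm_sub_sum_cutDil_le hqT hb
      hχsm.continuous hχ01 (half_pos hr) hχ1 (u := fun k => v (φ k)) hj (by positivity) hν')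
    refine ⟨ν, K, fun k hk => ?_⟩
    have h1 := hK k hk
    have h2 : AEStronglyMeasurable (u (φ k) - ∑ n ∈ Finset.range ν,
        cutDil a χ (j n k) (y n k) (S (W n))) volume :=
      (hsm (φ k)).continuous.aestronglyMeasurable.sub (Finset.aestronglyMeasurable_sum _ fun n _ =>
        aestronglyMeasurable_cutDil a hχsm.continuous _ _ (Lp.aestronglyMeasurable _))
    rw [MemLp.eLpNorm_eq_integral_rpow_norm hq00 hqT ⟨h2, h1.trans_lt ENNReal.ofReal_lt_top⟩,
      ENNReal.ofReal_le_ofReal_iff (by positivity), hqt] at h1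
    have h3 : q⁻¹ = ((N : ℝ) - 2) / (2 * N) := by rw [hq, inv_div]
    rw [h3] at h1
    simp only [Pi.sub_apply, Finset.sum_apply, Real.norm_eq_abs] at h1
    exact h1.trans_lt (by linarith)
  · simpa only [sq_norm_eq_integral_sq_norm] using hsum
  · have h1 : Tendsto (fun k => ∫ x, ‖gradient (u (φ k)) x‖ ^ 2) atTop (𝓝 L) := by
      simpa only [sq_norm_gradLp] using hL
    rw [h1.liminf_eq]
    simpa only [sq_norm_eq_integral_sq_norm] using hle
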